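/- arXiv:1502.02310 — 4 statements merged into one kernel-verified Lean document; each statement's English description precedes it below -/
import Mathlib

section
/- Let Σ and Δ be finite alphabets, φ : Σ* → Σ* a morphism, a ∈ Σ a letter with φ(a) = aγ for some γ ∈ Σ* such that φ^n(γ) is nonempty for every n ≥ 0, let α = φ^∞(a) be the resulting pure morphic sequence, let ψ : Σ → Δ be a coding, and let β = ψ(α). Then either there exists an integer k ≥ 1 such that p_β(n) = Θ(n^(1+1/k)) as n → ∞, or p_β(n) = O(n·log n) as n → ∞. -/
open Asymptotics Filter

/-- Apply a morphism (given by its values on letters) to a finite word. -/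
def substWord {A : Type*} (φ : A → List A) : List A → List A
  | [] => []
  | a :: w => φ a ++ substWord φ w

/-- The `n`-th iterate of a morphism applied to a word. -/
def iterWord {A : Type*} (φ : A → List A) (n : ℕ) (w : List A) : List A :=
  (substWord φ)^[n] w

/-- The subword complexity of an infinite word `β`: the number of distinct
factors of `β` of length `n`. -/
noncomputable def complexity {B : Type*} (β : ℕ → B) (n : ℕ) : ℕ :=
  Set.ncard {w : List B | ∃ i : ℕ, w = List.ofFn (fun j : Fin n => β (i + (j : ℕ)))}

namespace MorphicComplexity

/-! ### Powers of words -/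

section Words

variable {B : Type*}

/-- The `n`-th power of a word. -/
def wpow (g : List B) (n : ℕ) : List B := (List.replicate n g).flatten

@[simp] lemma wpow_zero (g : List B) : wpow g 0 = [] := rfl

lemma wpow_succ (g : List B) (n : ℕ) : wpow g (n + 1) = g ++ wpow g n := by
  simp [wpow, List.replicate_succ]

@[simp] lemma wpow_one (g : List B) : wpow g 1 = g := by simp [wpow_succ]

@[simp] lemma wpow_nil (n : ℕ) : wpow ([] : List B) n = [] := by
  induction n with
  | zero => rfl
  | succ n ih => simp [wpow_succ, ih]

lemma wpow_add (g : List B) (m n : ℕ) : wpow g (m + n) = wpow g m ++ wpow g n := by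
  induction m with
  | zero => simp
  | succ m ih => rw [Nat.add_right_comm, wpow_succ, ih, wpow_succ, List.append_assoc]

lemma wpow_succ' (g : List B) (n : ℕ) : wpow g (n + 1) = wpow g n ++ g := by
  simp [wpow_add]

lemma wpow_mul (g : List B) (m n : ℕ) : wpow g (m * n) = wpow (wpow g m) n := by
  induction n with
  | zero => simp
  | succ n ih => rw [Nat.mul_succ, wpow_add, ih, wpow_succ']

@[simp] lemma length_wpow (g : List B) (n : ℕ) : (wpow g n).length = n * g.length := by
  simp [wpow]

lemma wpow_prefix (g : List B) {m n : ℕ} (h : m ≤ n) : wpow g m <+: wpow g n := by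
  obtain ⟨k, rfl⟩ := Nat.exists_eq_add_of_le h
  exact ⟨_, (wpow_add g m k).symm⟩

lemma wpow_suffix (g : List B) {m n : ℕ} (h : m ≤ n) : wpow g m <:+ wpow g n := by
  obtain ⟨k, rfl⟩ := Nat.exists_eq_add_of_le' h
  exact ⟨_, (wpow_add g k m).symm⟩

lemma reverse_wpow (g : List B) (n : ℕ) : (wpow g n).reverse = wpow g.reverse n := by
  induction n with
  | zero => rfl
  | succ n ih => rw [wpow_succ, List.reverse_append, ih, wpow_succ']

lemma wpow_conj {g h s : List B} (e : g ++ s = s ++ h) (n : ℕ) :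
    wpow g n ++ s = s ++ wpow h n := by
  induction n with
  | zero => simp
  | succ n ih => rw [wpow_succ, List.append_assoc, ih, ← List.append_assoc, e, wpow_succ,
      List.append_assoc]

/-- A word `s ++ h` which is a prefix of a power of `g` continues the period `g`. -/
lemma conj_of_prefix {g h s : List B} (hl : g.length = h.length) {K : ℕ}
    (hp : s ++ h <+: wpow g K) : g ++ s = s ++ h := by
  have h1 : s ++ h <+: wpow g (K + 1) := hp.trans (wpow_prefix g (Nat.le_succ K))
  have h2 : g ++ s <+: wpow g (K + 1) := by
    rw [wpow_succ]
    exact (List.prefix_append_right_inj g).2 ((List.prefix_append s h).trans hp)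
  have hl' : (g ++ s).length = (s ++ h).length := by simp [hl, Nat.add_comm]
  exact (List.prefix_of_prefix_length_le h2 h1 hl'.le).eq_of_length hl'

lemma conj_of_suffix {g h s : List B} (hl : g.length = h.length) {K : ℕ}
    (hp : g ++ s <:+ wpow h K) : g ++ s = s ++ h := by
  have h1 : g ++ s <:+ wpow h (K + 1) := hp.trans (wpow_suffix h (Nat.le_succ K))
  have h2 : s ++ h <:+ wpow h (K + 1) := by
    rw [wpow_succ']
    obtain ⟨u, hu⟩ := (List.suffix_append g s).trans hp
    exact ⟨u, by rw [← hu, List.append_assoc]⟩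
  have hl' : (g ++ s).length = (s ++ h).length := by simp [hl, Nat.add_comm]
  exact (List.suffix_of_suffix_length_le h1 h2 hl'.le).eq_of_length hl'

lemma le_mul_length {g : List B} (hg : g ≠ []) (n : ℕ) : n ≤ n * g.length :=
  Nat.le_mul_of_pos_right _ (List.length_pos_iff.2 hg)

end Words

/-! ### Polynomially growing exponents -/

/-- `PolyDeg j n` says that `n` is a nonnegative combination of binomial functions `t.choose i`
(up to the constant term) of degree exactly `j`. -/
def PolyDeg : ℕ → (ℕ → ℕ) → Prop
  | 0, n => ∃ c, 0 < c ∧ ∀ t, n t = c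
  | j + 1, n => ∃ m, PolyDeg j m ∧ ∀ t, n (t + 1) = n t + m t

namespace PolyDeg

lemma add_const {j : ℕ} {n : ℕ → ℕ} (h : PolyDeg j n) (c : ℕ) :
    PolyDeg j (fun t => n t + c) := by
  cases j with
  | zero =>
    obtain ⟨a, ha, hn⟩ := h
    exact ⟨a + c, by omega, fun t => by simp [hn]⟩
  | succ j =>
    obtain ⟨m, hm, hn⟩ := h
    exact ⟨m, hm, fun t => by simp only [hn]; omega⟩

lemma add {i : ℕ} : ∀ {j : ℕ} {n m : ℕ → ℕ}, PolyDeg i n → PolyDeg j m →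
    PolyDeg (max i j) (fun t => n t + m t) := by
  induction i with
  | zero =>
    intro j n m hn hm
    obtain ⟨a, ha, hn⟩ := hn
    simpa [hn, Nat.add_comm] using hm.add_const a
  | succ i ih =>
    intro j n m hn hm
    cases j with
    | zero =>
      obtain ⟨a, ha, hm⟩ := hm
      simpa [hm] using hn.add_const a
    | succ j =>
      obtain ⟨n', hn', hn⟩ := hn
      obtain ⟨m', hm', hm⟩ := hm
      rw [Nat.succ_max_succ]
      exact ⟨_, ih hn' hm', fun t => by simp only [hn, hm]; omega⟩

lemma sum {j : ℕ} {f : ℕ → ℕ → ℕ} {q : ℕ} (hq : 0 < q) (h : ∀ i, PolyDeg j (f i)) :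
    PolyDeg j (fun t => ∑ i ∈ Finset.range q, f i t) := by
  induction q with
  | zero => omega
  | succ q ih =>
    rcases Nat.eq_zero_or_pos q with rfl | hq'
    · simpa using h 0
    · simp only [Finset.sum_range_succ]
      simpa using (ih hq').add (h q)

lemma iterate_diff {n m : ℕ → ℕ} (h : ∀ t, n (t + 1) = n t + m t) (a q : ℕ) :
    n (a + q) = n a + ∑ i ∈ Finset.range q, m (a + i) := by
  induction q with
  | zero => simp
  | succ q ih => rw [Finset.sum_range_succ, ← Nat.add_assoc, h, ih]; omega

lemma subsample {j : ℕ} : ∀ {n : ℕ → ℕ}, PolyDeg j n → ∀ {q : ℕ}, 0 < q → ∀ r : ℕ,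
    PolyDeg j (fun t => n (q * t + r)) := by
  induction j with
  | zero =>
    intro n hn q _ r
    obtain ⟨a, ha, hn⟩ := hn
    exact ⟨a, ha, fun t => hn _⟩
  | succ j ih =>
    intro n hn q hq r
    obtain ⟨m, hm, hn⟩ := hn
    refine ⟨_, sum hq (fun i => ih hm hq (r + i)), fun t => ?_⟩
    have := iterate_diff hn (q * t + r) q
    simp only [Nat.add_assoc] at this ⊢
    rw [← this]
    congr 1
    ring

lemma shift {j : ℕ} {n : ℕ → ℕ} (h : PolyDeg j n) (r : ℕ) : PolyDeg j (fun t => n (t + r)) := by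
  simpa using h.subsample Nat.one_pos r

lemma sum_range {j : ℕ} {n : ℕ → ℕ} (h : PolyDeg j n) :
    PolyDeg (j + 1) (fun t => ∑ i ∈ Finset.range t, n i) :=
  ⟨n, h, fun _ => Finset.sum_range_succ _ _⟩

lemma id : PolyDeg 1 (fun t => t) := ⟨fun _ => 1, ⟨1, Nat.one_pos, fun _ => rfl⟩, fun _ => rfl⟩

lemma periodic_mod {j : ℕ} : ∀ {n : ℕ → ℕ}, PolyDeg j n → ∀ {l : ℕ}, 0 < l →
    ∃ q, 0 < q ∧ ∀ t, (n (t + q) : ZMod l) = n t := by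
  induction j with
  | zero =>
    intro n hn l _
    obtain ⟨a, ha, hn⟩ := hn
    exact ⟨1, Nat.one_pos, fun t => by simp [hn]⟩
  | succ j ih =>
    intro n hn l hl
    obtain ⟨m, hm, hn⟩ := hn
    obtain ⟨q, hq, hper⟩ := ih hm hl
    have hσ : ∀ t, ((∑ i ∈ Finset.range q, m (t + i) : ℕ) : ZMod l)
        = (∑ i ∈ Finset.range q, m i : ℕ) := by
      intro t
      induction t with
      | zero => simp
      | succ t iht =>
        rw [← iht]
        have h1 := Finset.sum_range_succ (fun i => m (t + i)) q
        have h2 := Finset.sum_range_succ' (fun i => m (t + i)) q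
        have h3 : (∑ i ∈ Finset.range q, m (t + 1 + i)) + m t
            = (∑ i ∈ Finset.range q, m (t + i)) + m (t + q) := by
          rw [← h1, h2]
          simp [Nat.add_assoc, Nat.add_comm 1]
        have h4 := congrArg (Nat.cast : ℕ → ZMod l) h3
        push_cast at h4 ⊢
        rw [hper] at h4
        exact add_right_cancel h4
    have hi : ∀ i t, (n (t + q * i) : ZMod l)
        = n t + i * (∑ i ∈ Finset.range q, m i : ℕ) := by
      intro i t
      induction i with
      | zero => simp
      | succ i ihi =>
        rw [Nat.mul_succ, ← Nat.add_assoc, iterate_diff hn, Nat.cast_add, ihi, hσ]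
        push_cast
        ring
    exact ⟨q * l, Nat.mul_pos hq hl, fun t => by simp [hi]⟩

lemma div {j : ℕ} : ∀ {n : ℕ → ℕ}, PolyDeg j n → ∀ {l : ℕ}, 0 < l → (∀ t, l ∣ n t) →
    PolyDeg j (fun t => n t / l) := by
  induction j with
  | zero =>
    intro n hn l hl hd
    obtain ⟨a, ha, hn⟩ := hn
    refine ⟨a / l, Nat.div_pos (Nat.le_of_dvd ha ?_) hl, fun t => by simp [hn]⟩
    simpa [hn] using hd 0
  | succ j ih =>
    intro n hn l hl hd
    obtain ⟨m, hm, hn⟩ := hn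
    have hdm : ∀ t, l ∣ m t := fun t => by
      have := hd (t + 1)
      rw [hn] at this
      exact (Nat.dvd_add_right (hd t)).1 this
    exact ⟨_, ih hm hl hdm, fun t => by simp only [hn]; exact Nat.add_div_of_dvd_right (hd t)⟩

/-- On residue classes, an exponent of positive degree is divisible by `l` up to a constant. -/
lemma split {j : ℕ} {n : ℕ → ℕ} (h : PolyDeg (j + 1) n) {l : ℕ} (hl : 0 < l) :
    ∃ q, 0 < q ∧ ∀ r, ∃ n' c, PolyDeg (j + 1) n' ∧ ∀ t, n (q * t + r) = l * n' t + c := by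
  obtain ⟨q, hq, hper⟩ := h.periodic_mod hl
  refine ⟨q, hq, fun r => ?_⟩
  obtain ⟨m, hm, hn⟩ := h.subsample hq r
  have hstep : ∀ t, (n (q * t + r) : ZMod l) = n r := by
    intro t
    induction t with
    | zero => simp
    | succ t ih => rw [show q * (t + 1) + r = q * t + r + q by ring, hper, ih]
  have hdm : ∀ t, l ∣ m t := by
    intro t
    have h1 := congrArg (Nat.cast : ℕ → ZMod l) (hn t)
    rw [Nat.cast_add, hstep, hstep] at h1
    rw [← ZMod.natCast_eq_zero_iff]
    simpa using h1
  refine ⟨fun t => n (q * t + r) / l, n r % l, ⟨_, div hm hl hdm, fun t => ?_⟩, fun t => ?_⟩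
  · simp only [hn]
    exact Nat.add_div_of_dvd_left (hdm t)
  · have h1 := (ZMod.natCast_eq_natCast_iff' _ _ _).1 (hstep t)
    rw [← h1]
    exact (Nat.div_add_mod _ _).symm

lemma monotone {j : ℕ} {n : ℕ → ℕ} (h : PolyDeg j n) : Monotone n := by
  cases j with
  | zero =>
    obtain ⟨a, -, hn⟩ := h
    intro s t _
    simp [hn]
  | succ j =>
    obtain ⟨m, -, hn⟩ := h
    exact monotone_nat_of_le_succ fun t => by rw [hn]; omega

lemma choose_le {j : ℕ} : ∀ {n : ℕ → ℕ}, PolyDeg j n → ∀ t, t.choose j ≤ n t := by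
  induction j with
  | zero =>
    rintro n ⟨a, ha, hn⟩ t
    rw [hn, Nat.choose_zero_right]
    exact ha
  | succ j ih =>
    rintro n ⟨m, hm, hn⟩ t
    induction t with
    | zero => simp
    | succ t iht =>
      rw [Nat.choose_succ_succ', hn]
      have := ih hm t
      omega

lemma pos {j : ℕ} {n : ℕ → ℕ} (h : PolyDeg j n) {t : ℕ} (ht : j ≤ t) : 0 < n t :=
  (Nat.choose_pos ht).trans_le (h.choose_le t)

lemma lt_succ {j : ℕ} {n : ℕ → ℕ} (h : PolyDeg (j + 1) n) {t : ℕ} (ht : j ≤ t) :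
    n t < n (t + 1) := by
  obtain ⟨m, hm, hn⟩ := h
  have := hm.pos ht
  rw [hn]
  omega

lemma le_pow {j : ℕ} : ∀ {n : ℕ → ℕ}, PolyDeg j n → ∃ c, ∀ t, n t ≤ c * (t + 1) ^ j := by
  induction j with
  | zero =>
    rintro n ⟨a, ha, hn⟩
    exact ⟨a, fun t => by simp [hn]⟩
  | succ j ih =>
    rintro n ⟨m, hm, hn⟩
    obtain ⟨c, hc⟩ := ih hm
    refine ⟨c + n 0, fun t => ?_⟩
    have h1 : n t = n 0 + ∑ i ∈ Finset.range t, m i := by simpa using iterate_diff hn 0 t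
    have h2 : ∑ i ∈ Finset.range t, m i ≤ t * (c * (t + 1) ^ j) := by
      have := Finset.sum_le_card_nsmul (Finset.range t) m (c * (t + 1) ^ j) (fun i hi => by
        refine (hc i).trans ?_
        have := Finset.mem_range.1 hi
        gcongr)
      simpa using this
    have h3 : 0 < (t + 1) ^ j := by positivity
    rw [h1, pow_succ]
    nlinarith [Nat.zero_le (n 0 * t * (t + 1) ^ j)]

end PolyDeg

lemma pow_le_of_choose_le {j : ℕ} {n : ℕ → ℕ} (h : ∀ t, t.choose j ≤ n t) :
    ∃ c, ∀ t, t ^ j ≤ c * (n t + 1) := by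
  refine ⟨2 ^ j * j.factorial + (2 * j) ^ j, fun t => ?_⟩
  rcases le_total t (2 * j) with ht | ht
  · have : t ^ j ≤ (2 * j) ^ j := Nat.pow_le_pow_left ht j
    nlinarith [Nat.zero_le (2 ^ j * j.factorial), Nat.zero_le (n t * (2 * j) ^ j),
      Nat.zero_le (n t * (2 ^ j * j.factorial))]
  · have h1 : (t + 1 - j) ^ j ≤ j.factorial * t.choose j := by
      rw [← Nat.descFactorial_eq_factorial_mul_choose]
      exact Nat.pow_sub_le_descFactorial t j
    have h2 : t ^ j ≤ (2 * (t + 1 - j)) ^ j := Nat.pow_le_pow_left (by omega) j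
    rw [mul_pow] at h2
    calc t ^ j ≤ 2 ^ j * (t + 1 - j) ^ j := h2
      _ ≤ 2 ^ j * (j.factorial * (n t + 1)) := by
          gcongr
          exact h1.trans (Nat.mul_le_mul_left _ ((h t).trans (Nat.le_succ _)))
      _ ≤ _ := by
          rw [← mul_assoc]
          gcongr
          exact Nat.le_add_right _ _

/-! ### Words with polynomially growing runs -/

section Tame

variable {B : Type*}

/-- A fixed word followed by a growing power of a fixed word. -/
structure Block (B : Type*) where
  /-- the fixed word preceding the run -/
  pre : List B
  /-- the repeated word -/
  base : List B
  /-- the exponent of the run -/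
  exp : ℕ → ℕ

/-- The value of a block at time `t`. -/
def Block.word (b : Block B) (t : ℕ) : List B := b.pre ++ wpow b.base (b.exp t)

/-- The run of the block has period length `l` and an exponent of degree between `1` and `d`. -/
def Block.Good (d l : ℕ) (b : Block B) : Prop :=
  b.base.length = l ∧ ∃ j, 1 ≤ j ∧ j ≤ d ∧ PolyDeg j b.exp

/-- Concatenation of blocks at time `t`. -/
def blocks (p : List (Block B)) (t : ℕ) : List B := p.flatMap (fun b => b.word t)

@[simp] lemma blocks_nil (t : ℕ) : blocks ([] : List (Block B)) t = [] := rfl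

@[simp] lemma blocks_cons (b : Block B) (p : List (Block B)) (t : ℕ) :
    blocks (b :: p) t = b.pre ++ (wpow b.base (b.exp t) ++ blocks p t) := by
  simp [blocks, Block.word]

@[simp] lemma blocks_append (p p' : List (Block B)) (t : ℕ) :
    blocks (p ++ p') t = blocks p t ++ blocks p' t := by
  simp [blocks]

/-- The sequence of words is given by good blocks followed by a fixed word. -/
def Pat (d l : ℕ) (W : ℕ → List B) : Prop :=
  ∃ (p : List (Block B)) (fin : List B), (∀ b ∈ p, b.Good d l) ∧ ∀ t, W t = blocks p t ++ fin

namespace Pat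

variable {d l : ℕ} {W V : ℕ → List B}

lemma const (d l : ℕ) (s : List B) : Pat d l (fun _ => s) := ⟨[], s, by simp, by simp⟩

lemma power {g : List B} (hg : g.length = l) {j : ℕ} (h1 : 1 ≤ j) (h2 : j ≤ d) {n : ℕ → ℕ}
    (hn : PolyDeg j n) : Pat d l (fun t => wpow g (n t)) :=
  ⟨[⟨[], g, n⟩], [], by simpa using ⟨hg, j, h1, h2, hn⟩, by simp⟩

lemma append (hW : Pat d l W) (hV : Pat d l V) : Pat d l (fun t => W t ++ V t) := by
  obtain ⟨p, f, hp, hW⟩ := hW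
  obtain ⟨p', f', hp', hV⟩ := hV
  cases p' with
  | nil => exact ⟨p, f ++ f', hp, fun t => by simp [hW, hV]⟩
  | cons b p' =>
    refine ⟨p ++ ⟨f ++ b.pre, b.base, b.exp⟩ :: p', f', ?_, fun t => by simp [hW, hV]⟩
    intro c hc
    simp only [List.mem_append, List.mem_cons] at hc
    rcases hc with hc | rfl | hc
    · exact hp c hc
    · exact hp' b (by simp)
    · exact hp' c (by simp [hc])

lemma mono {d' : ℕ} (h : d ≤ d') (hW : Pat d l W) : Pat d' l W := by
  obtain ⟨p, f, hp, hW⟩ := hW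
  refine ⟨p, f, fun b hb => ?_, hW⟩
  obtain ⟨h1, j, h2, h3, h4⟩ := hp b hb
  exact ⟨h1, j, h2, h3.trans h, h4⟩

/-- Closure properties which suffice to treat a concatenation of blocks. -/
lemma induct {P : (ℕ → List B) → Prop} (hc : ∀ s, P fun _ => s)
    (hp : ∀ (g : List B) (j : ℕ) (n : ℕ → ℕ), g.length = l → 1 ≤ j → j ≤ d → PolyDeg j n →
      P fun t => wpow g (n t))
    (ha : ∀ W V, P W → P V → P fun t => W t ++ V t) (hW : Pat d l W) : P W := by
  obtain ⟨p, f, hg, hW⟩ := hW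
  rw [funext hW]
  refine ha _ _ ?_ (hc f)
  clear hW
  induction p with
  | nil => exact hc []
  | cons b p ih =>
    obtain ⟨h1, j, h2, h3, h4⟩ := hg b (by simp)
    rw [funext (blocks_cons b p)]
    exact ha _ _ (hc _) (ha _ _ (hp _ j _ h1 h2 h3 h4) (ih fun c hc => hg c (by simp [hc])))

lemma reverse (hW : Pat d l W) : Pat d l (fun t => (W t).reverse) := by
  refine hW.induct (P := fun W => Pat d l (fun t => (W t).reverse)) (fun s => const _ _ _)
    (fun g j n h1 h2 h3 h4 => ?_) (fun W V h1 h2 => ?_)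
  · simp only [reverse_wpow]
    exact power (by simpa using h1) h2 h3 h4
  · simp only [List.reverse_append]
    exact h2.append h1

end Pat

/-- On every sufficiently divisible arithmetic progression, `W` is eventually given by blocks,
whose periods may be given any sufficiently divisible common length. -/
def Tame (d : ℕ) (W : ℕ → List B) : Prop :=
  ∃ l₀, 0 < l₀ ∧ ∀ l, 0 < l → l₀ ∣ l → ∃ Q, 0 < Q ∧ ∀ q, 0 < q → Q ∣ q →
    ∃ R, ∀ r, R ≤ r → Pat d l (fun t => W (q * t + r))

namespace Tame

variable {d : ℕ} {W V : ℕ → List B}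

lemma const (d : ℕ) (s : List B) : Tame d (fun _ => s) :=
  ⟨1, one_pos, fun l _ _ => ⟨1, one_pos, fun _ _ _ => ⟨0, fun _ _ => Pat.const d l s⟩⟩⟩

lemma power {g : List B} (hg : g ≠ []) {j : ℕ} (h1 : 1 ≤ j) (h2 : j ≤ d) {n : ℕ → ℕ}
    (hn : PolyDeg j n) : Tame d (fun t => wpow g (n t)) := by
  refine ⟨g.length, List.length_pos_iff.2 hg, fun l hl hd => ?_⟩
  obtain ⟨k, rfl⟩ := hd
  obtain ⟨j, rfl⟩ := Nat.exists_eq_add_of_le' h1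
  obtain ⟨Q, hQ, hs⟩ := hn.split (Nat.pos_of_mul_pos_left hl)
  refine ⟨Q, hQ, fun q hq hQq => ⟨0, fun r _ => ?_⟩⟩
  obtain ⟨m, rfl⟩ := hQq
  obtain ⟨n', c, hn', he⟩ := hs r
  have h3 : (fun t => wpow g (n (Q * m * t + r)))
      = fun t => wpow (wpow g k) (n' (m * t + 0)) ++ wpow g c := by
    funext t
    rw [mul_assoc, he, wpow_add, wpow_mul, Nat.add_zero]
  rw [h3]
  exact (Pat.power (by simp [Nat.mul_comm]) h1 h2
    (hn'.subsample (Nat.pos_of_mul_pos_left hq) 0)).append (Pat.const _ _ _)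

lemma append (hW : Tame d W) (hV : Tame d V) : Tame d (fun t => W t ++ V t) := by
  obtain ⟨l₁, hl₁, h₁⟩ := hW
  obtain ⟨l₂, hl₂, h₂⟩ := hV
  refine ⟨l₁ * l₂, Nat.mul_pos hl₁ hl₂, fun l hl hd => ?_⟩
  obtain ⟨Q₁, hQ₁, h₁⟩ := h₁ l hl ((Nat.dvd_mul_right _ _).trans hd)
  obtain ⟨Q₂, hQ₂, h₂⟩ := h₂ l hl ((Nat.dvd_mul_left _ _).trans hd)
  refine ⟨Q₁ * Q₂, Nat.mul_pos hQ₁ hQ₂, fun q hq hd => ?_⟩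
  obtain ⟨R₁, h₁⟩ := h₁ q hq ((Nat.dvd_mul_right _ _).trans hd)
  obtain ⟨R₂, h₂⟩ := h₂ q hq ((Nat.dvd_mul_left _ _).trans hd)
  exact ⟨max R₁ R₂, fun r hr => (h₁ r (by omega)).append (h₂ r (by omega))⟩

lemma of_pat {l : ℕ} (hl : 0 < l) (hW : Pat d l W) : Tame d W :=
  hW.induct (const d)
    (fun _ _ _ h1 h2 h3 h4 => power (List.length_pos_iff.1 (h1 ▸ hl)) h2 h3 h4)
    (fun _ _ h1 h2 => h1.append h2)

lemma mono {d' : ℕ} (h : d ≤ d') (hW : Tame d W) : Tame d' W := by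
  obtain ⟨l₀, hl₀, hW⟩ := hW
  refine ⟨l₀, hl₀, fun l hl hd => ?_⟩
  obtain ⟨Q, hQ, hW⟩ := hW l hl hd
  refine ⟨Q, hQ, fun q hq hd => ?_⟩
  obtain ⟨R, hR⟩ := hW q hq hd
  exact ⟨R, fun r hr => (hR r hr).mono h⟩

lemma reverse (hW : Tame d W) : Tame d (fun t => (W t).reverse) := by
  obtain ⟨l₀, hl₀, hW⟩ := hW
  refine ⟨l₀, hl₀, fun l hl hd => ?_⟩
  obtain ⟨Q, hQ, hW⟩ := hW l hl hd
  refine ⟨Q, hQ, fun q hq hd => ?_⟩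
  obtain ⟨R, hR⟩ := hW q hq hd
  exact ⟨R, fun r hr => (hR r hr).reverse⟩

lemma subsample (hW : Tame d W) {a : ℕ} (ha : 0 < a) (b : ℕ) :
    Tame d (fun t => W (a * t + b)) := by
  obtain ⟨l₀, hl₀, hW⟩ := hW
  refine ⟨l₀, hl₀, fun l hl hd => ?_⟩
  obtain ⟨Q, hQ, hW⟩ := hW l hl hd
  refine ⟨Q, hQ, fun q hq hd => ?_⟩
  obtain ⟨R, hR⟩ := hW (a * q) (Nat.mul_pos ha hq) (hd.trans (Nat.dvd_mul_left _ _))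
  refine ⟨R, fun r hr => ?_⟩
  have h1 := hR (a * r + b) (by nlinarith)
  simpa [mul_add, mul_assoc, add_assoc] using h1

/-- Tameness may be checked on the residue classes of any modulus, from any time on. -/
lemma of_residues {Q : ℕ} (hQ : 0 < Q) (t₀ : ℕ)
    (h : ∀ r, r < Q → Tame d (fun t => W (Q * t + (t₀ + r)))) : Tame d W := by
  have h' : ∀ r, Tame d (fun t => if r < Q then W (Q * t + (t₀ + r)) else []) := by
    intro r
    by_cases hr : r < Q
    · simpa [hr] using h r hr
    · simpa [hr] using const d []
  choose l₀ hl₀ h' using h'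
  refine ⟨∏ r ∈ Finset.range Q, l₀ r, Finset.prod_pos fun r _ => hl₀ r, fun l hl hd => ?_⟩
  have h2 : ∀ r, ∃ Q', 0 < Q' ∧ (r < Q → ∀ q, 0 < q → Q' ∣ q →
      ∃ R, ∀ s, R ≤ s → Pat d l (fun t => W (Q * (q * t + s) + (t₀ + r)))) := by
    intro r
    by_cases hr : r < Q
    · obtain ⟨Q', hQ', h2⟩ := h' r l hl
        ((Finset.dvd_prod_of_mem l₀ (Finset.mem_range.2 hr)).trans hd)
      exact ⟨Q', hQ', fun _ => by simpa [hr] using h2⟩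
    · exact ⟨1, one_pos, fun h => absurd h hr⟩
  choose Q' hQ' h2 using h2
  refine ⟨Q * ∏ r ∈ Finset.range Q, Q' r,
    Nat.mul_pos hQ (Finset.prod_pos fun r _ => hQ' r), fun q hq hd => ?_⟩
  obtain ⟨m, rfl⟩ := hd
  rw [mul_assoc] at hq ⊢
  have hm := Nat.pos_of_mul_pos_left hq
  have h3 : ∀ r, ∃ R, r < Q → ∀ s, R ≤ s → Pat d l (fun t =>
      W (Q * ((∏ r ∈ Finset.range Q, Q' r) * m * t + s) + (t₀ + r))) := by
    intro r
    by_cases hr : r < Q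
    · obtain ⟨R, hR⟩ := h2 r hr _ hm
        ((Finset.dvd_prod_of_mem Q' (Finset.mem_range.2 hr)).trans (Nat.dvd_mul_right _ _))
      exact ⟨R, fun _ => hR⟩
    · exact ⟨0, fun h => absurd h hr⟩
  choose R hR using h3
  refine ⟨Q * (∑ r ∈ Finset.range Q, R r) + t₀, fun s hs => ?_⟩
  have hr := Nat.mod_lt (s - t₀) hQ
  have h4 : R ((s - t₀) % Q) ≤ (s - t₀) / Q := by
    refine (Finset.single_le_sum (f := R) (fun _ _ => Nat.zero_le _)
      (Finset.mem_range.2 hr)).trans ?_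
    rw [Nat.le_div_iff_mul_le hQ, mul_comm]
    omega
  have h5 := hR _ hr _ h4
  have h6 : ∀ x, Q * (x + (s - t₀) / Q) + (t₀ + (s - t₀) % Q) = Q * x + s := by
    intro x
    have h7 := Nat.div_add_mod (s - t₀) Q
    have h8 := Nat.mul_add Q x ((s - t₀) / Q)
    have h9 : t₀ ≤ s := (Nat.le_add_left _ _).trans hs
    omega
  simpa [h6, mul_assoc] using h5

lemma of_shift (t₀ : ℕ) (h : Tame d (fun t => W (t + t₀))) : Tame d W :=
  of_residues one_pos t₀ fun r hr => by
    obtain rfl : r = 0 := by omega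
    simpa using h

lemma flatMap {A : Type*} {f : ℕ → A → List B} (w : List A)
    (h : ∀ a ∈ w, Tame d (fun t => f t a)) : Tame d (fun t => w.flatMap (f t)) := by
  induction w with
  | nil => exact const d []
  | cons a w ih =>
    simp only [List.flatMap_cons]
    exact (h a (by simp)).append (ih fun b hb => h b (by simp [hb]))

end Tame

end Tame

/-! ### Long runs -/

section Runs

variable {B : Type*}

lemma PolyDeg.exists_bounds {j : ℕ} {n : ℕ → ℕ} (h : PolyDeg j n) :
    ∃ c, ∀ t, j ≤ t → t ^ j ≤ c * n t ∧ n t ≤ c * (t + 1) ^ j := by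
  obtain ⟨c, hc⟩ := pow_le_of_choose_le h.choose_le
  obtain ⟨c', hc'⟩ := h.le_pow
  refine ⟨2 * c + c', fun t ht => ⟨?_, ?_⟩⟩
  · have h1 := h.pos ht
    have h2 : c * (n t + 1) ≤ c * (2 * n t) := Nat.mul_le_mul_left _ (by omega)
    nlinarith [hc t, Nat.zero_le (c' * n t)]
  · nlinarith [hc' t, Nat.zero_le (2 * c * (t + 1) ^ j)]

/-- A set of words closed under factors. -/
def FactorClosed (L : Set (List B)) : Prop := ∀ u v, u <:+: v → v ∈ L → u ∈ L

/-- The language `L` contains maximal runs whose lengths grow like `t ^ j`, preceded by at least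
as long words. -/
def HasRuns (L : Set (List B)) (j : ℕ) : Prop :=
  ∃ (g e e' : List B) (n : ℕ → ℕ) (t₀ c : ℕ), g ≠ [] ∧ (∀ K, ¬ e <:+ wpow g K) ∧
    (∀ K, ¬ e' <+: wpow g K) ∧ (∀ t, t₀ ≤ t → n t < n (t + 1)) ∧
    ∀ t, t₀ ≤ t → t ^ j ≤ c * n t ∧ n t ≤ c * (t + 1) ^ j ∧
      ∃ X Y, X ++ e ++ wpow g (n t) ++ e' ++ Y ∈ L ∧ t ^ j ≤ c * (X ++ e).length

/-- The language `L` contains maximal runs whose lengths grow like `t ^ j`, preceded and followed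
by at least as long words. -/
def HasRunsBoth (L : Set (List B)) (j : ℕ) : Prop :=
  ∃ (g e e' : List B) (n : ℕ → ℕ) (t₀ c : ℕ), g ≠ [] ∧ (∀ K, ¬ e <:+ wpow g K) ∧
    (∀ K, ¬ e' <+: wpow g K) ∧ (∀ t, t₀ ≤ t → n t < n (t + 1)) ∧
    ∀ t, t₀ ≤ t → t ^ j ≤ c * n t ∧ n t ≤ c * (t + 1) ^ j ∧
      ∃ X Y, X ++ e ++ wpow g (n t) ++ e' ++ Y ∈ L ∧ t ^ j ≤ c * (X ++ e).length ∧
        t ^ j ≤ c * (e' ++ Y).length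

lemma HasRunsBoth.hasRuns {L : Set (List B)} {j : ℕ} (h : HasRunsBoth L j) : HasRuns L j := by
  obtain ⟨g, e, e', n, t₀, c, h1, h2, h3, h4, h5⟩ := h
  refine ⟨g, e, e', n, t₀, c, h1, h2, h3, h4, fun t ht => ?_⟩
  obtain ⟨h6, h7, X, Y, h8, h9, -⟩ := h5 t ht
  exact ⟨h6, h7, X, Y, h8, h9⟩

/-- The reversed language. -/
def revLang (L : Set (List B)) : Set (List B) := {w | w.reverse ∈ L}

lemma FactorClosed.revLang {L : Set (List B)} (h : FactorClosed L) : FactorClosed (revLang L) :=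
  fun _ _ huv hv => h _ _ (List.reverse_infix.2 huv) hv

lemma HasRunsBoth.of_revLang {L : Set (List B)} {j : ℕ} (h : HasRunsBoth (revLang L) j) :
    HasRunsBoth L j := by
  obtain ⟨g, e, e', n, t₀, c, h1, h2, h3, h4, h5⟩ := h
  refine ⟨g.reverse, e'.reverse, e.reverse, n, t₀, c, by simpa using h1, fun K hK => ?_,
    fun K hK => ?_, h4, fun t ht => ?_⟩
  · rw [← reverse_wpow, List.reverse_suffix] at hK
    exact h3 K hK
  · rw [← reverse_wpow, List.reverse_prefix] at hK
    exact h2 K hK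
  · obtain ⟨h6, h7, X, Y, h8, h9, h10⟩ := h5 t ht
    refine ⟨h6, h7, Y.reverse, X.reverse, ?_, ?_, ?_⟩
    · have h11 : (X ++ e ++ wpow g (n t) ++ e' ++ Y).reverse ∈ L := h8
      simpa [reverse_wpow] using h11
    · rw [List.length_append, List.length_reverse, List.length_reverse]
      rw [List.length_append] at h10
      rwa [Nat.add_comm]
    · rw [List.length_append, List.length_reverse, List.length_reverse]
      rw [List.length_append] at h9
      rwa [Nat.add_comm]

lemma hasRunsBoth_of_triples {L : Set (List B)} {j : ℕ} (hj : 1 ≤ j) {s g e e' : List B}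
    {n : ℕ → ℕ} {T : ℕ → List B} (hn : PolyDeg j n) (hg : g ≠ [])
    (hL : ∀ t, (s ++ wpow g (n t) ++ T t) ++ (s ++ wpow g (n (t + 1)) ++ T (t + 1)) ++
      (s ++ wpow g (n (t + 2)) ++ T (t + 2)) ∈ L)
    (he : ∀ K, ¬ e <:+ wpow g K) (he' : ∀ K, ¬ e' <+: wpow g K) (t₀ : ℕ)
    (h1 : ∀ t, t₀ ≤ t → e <:+ (s ++ wpow g (n t) ++ T t) ++ s)
    (h2 : ∀ t, t₀ ≤ t → e' <+: T t ++ (s ++ wpow g (n (t + 1)) ++ T (t + 1))) :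
    HasRunsBoth L j := by
  obtain ⟨c, hc⟩ := hn.exists_bounds
  obtain ⟨c', hc'⟩ := (hn.shift 1).exists_bounds
  obtain ⟨i, rfl⟩ := Nat.exists_eq_add_of_le' hj
  refine ⟨g, e, e', fun t => n (t + 1), t₀ + i + 1, c + c', hg, he, he', fun t ht => ?_,
    fun t ht => ?_⟩
  · exact hn.lt_succ (by omega)
  · obtain ⟨X, hX⟩ := h1 t (by omega)
    obtain ⟨Y, hY⟩ := h2 (t + 1) (by omega)
    obtain ⟨h3, -⟩ := hc t (by omega)
    obtain ⟨h4, h5⟩ := hc' t (by omega)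
    have h6 : n t ≤ n (t + 1 + 1) := hn.monotone (by omega)
    refine ⟨?_, ?_, X, Y, ?_, ?_, ?_⟩
    · nlinarith [Nat.zero_le (c * n (t + 1))]
    · nlinarith [Nat.zero_le (c * (t + 1) ^ (i + 1))]
    · rw [hX, List.append_assoc _ e' Y, hY]
      simpa using hL t
    · rw [hX]
      have h7 : n t ≤ ((s ++ wpow g (n t) ++ T t) ++ s).length := by
        have := le_mul_length hg (n t)
        simp only [List.length_append, length_wpow]
        omega
      nlinarith [Nat.mul_le_mul_left c h7]
    · rw [hY]
      have h7 : n t ≤ (T (t + 1) ++ (s ++ wpow g (n (t + 1 + 1)) ++ T (t + 1 + 1))).length := by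
        have : n (t + 1 + 1) ≤ n (t + 1 + 1) * g.length := le_mul_length hg _
        simp only [List.length_append, length_wpow]
        omega
      nlinarith [Nat.mul_le_mul_left c h7]

/-! ### Products of consecutive tame words -/

/-- The product `U 0 ++ U 1 ++ ⋯ ++ U (t - 1)`. -/
def wprod (U : ℕ → List B) (t : ℕ) : List B := (List.range t).flatMap U

@[simp] lemma wprod_zero (U : ℕ → List B) : wprod U 0 = [] := rfl

lemma wprod_succ (U : ℕ → List B) (t : ℕ) : wprod U (t + 1) = wprod U t ++ U t := by
  simp [wprod, List.range_succ]

lemma wprod_add (U : ℕ → List B) (a b : ℕ) :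
    wprod U (a + b) = wprod U a ++ wprod (fun i => U (a + i)) b := by
  simp [wprod, List.range_add, List.flatMap_map]

lemma exists_blocks_prepend {d l : ℕ} (s : List B) (p : List (Block B)) (fin : List B)
    (hp : ∀ b ∈ p, b.Good d l) :
    ∃ (p' : List (Block B)) (fin' : List B), p'.length = p.length ∧ (∀ b ∈ p', b.Good d l) ∧
      ∀ t, blocks p' t ++ fin' = s ++ (blocks p t ++ fin) := by
  cases p with
  | nil => exact ⟨[], s ++ fin, rfl, by simp, by simp⟩
  | cons b p =>
    refine ⟨⟨s ++ b.pre, b.base, b.exp⟩ :: p, fin, rfl, fun c hc => ?_, fun t => by simp⟩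
    rcases List.mem_cons.1 hc with rfl | hc
    · exact hp b (by simp)
    · exact hp c (by simp [hc])

lemma wprod_of_commute {s g fin : List B} (h : g ++ (fin ++ s) = (fin ++ s) ++ g) (n : ℕ → ℕ)
    (t : ℕ) : wprod (fun i => s ++ (wpow g (n i) ++ fin)) (t + 1)
      = s ++ (wpow g (∑ i ∈ Finset.range (t + 1), n i) ++ (wpow (fin ++ s) t ++ fin)) := by
  induction t with
  | zero => simp [wprod_succ]
  | succ t ih =>
    rw [wprod_succ, ih, Finset.sum_range_succ _ (t + 1), wpow_add]
    have h1 := wpow_conj (wpow_conj h (n (t + 1))).symm (t + 1)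
    have h2 : wpow (fin ++ s) t ++ (fin ++ (s ++ wpow g (n (t + 1))))
        = wpow g (n (t + 1)) ++ wpow (fin ++ s) (t + 1) := by
      rw [← h1, wpow_succ']
      simp
    simp only [List.append_assoc]
    congr 2
    have h3 := congrArg (· ++ fin) h2
    simpa using h3

lemma infix_wprod_triple (U : ℕ → List B) (t : ℕ) :
    U t ++ U (t + 1) ++ U (t + 2) <:+: wprod U (t + 3) := by
  refine ⟨wprod U t, [], ?_⟩
  simp [wprod_succ]

lemma tame_wprod_blocks {L : Set (List B)} (hL : FactorClosed L) {d l : ℕ} (hl : 0 < l)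
    (hno : ∀ j, 1 ≤ j → j ≤ d → ¬ HasRunsBoth L j) (m : ℕ) :
    ∀ (p : List (Block B)) (fin : List B), p.length = m → (∀ b ∈ p, b.Good d l) →
      (∀ t, wprod (fun i => blocks p i ++ fin) t ∈ L) →
      Tame (d + 1) (wprod (fun i => blocks p i ++ fin)) := by
  induction m with
  | zero =>
    intro p fin hp _ _
    obtain rfl := List.length_eq_zero_iff.1 hp
    have h1 : wprod (fun i => blocks ([] : List (Block B)) i ++ fin) = fun t => wpow fin t := by
      funext t
      induction t with
      | zero => rfl
      | succ t ih => rw [wprod_succ, ih, wpow_succ']; rfl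
    rw [h1]
    rcases eq_or_ne fin [] with rfl | hf
    · exact (funext wpow_nil : wpow ([] : List B) = fun _ => []) ▸ Tame.const (d + 1) []
    · exact Tame.power hf le_rfl (by omega) PolyDeg.id
  | succ m ih =>
    intro p fin hp hgood hmem
    obtain ⟨b, p, rfl⟩ := List.exists_cons_of_length_eq_add_one hp
    simp only [List.length_cons, Nat.add_right_cancel_iff] at hp
    obtain ⟨hbl, j, hj1, hjd, hbn⟩ := hgood b (by simp)
    have hb0 : b.base ≠ [] := List.length_pos_iff.1 (hbl ▸ hl)
    have htriple : ∀ t, (b.pre ++ wpow b.base (b.exp t) ++ (blocks p t ++ fin)) ++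
        (b.pre ++ wpow b.base (b.exp (t + 1)) ++ (blocks p (t + 1) ++ fin)) ++
        (b.pre ++ wpow b.base (b.exp (t + 2)) ++ (blocks p (t + 2) ++ fin)) ∈ L := fun t => by
      have := hL _ _ (infix_wprod_triple _ t) (hmem (t + 3))
      simpa using this
    rcases List.eq_nil_or_concat p with rfl | ⟨p, bm, rfl⟩
    · by_cases hc : b.base ++ (fin ++ b.pre) = (fin ++ b.pre) ++ b.base
      · refine Tame.of_shift 1 ?_
        have h1 := wprod_of_commute hc b.exp
        simp only [blocks_cons, blocks_nil, List.append_nil, List.append_assoc]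
        simp only [h1]
        refine (Tame.const _ _).append ((Tame.power hb0 (by omega) (Nat.succ_le_succ hjd)
          (hbn.sum_range.shift 1)).append (Tame.append ?_ (Tame.const _ _)))
        rcases eq_or_ne (fin ++ b.pre) [] with h2 | h2
        · rw [h2, (funext wpow_nil : wpow ([] : List B) = fun _ => [])]
          exact Tame.const (d + 1) []
        · exact Tame.power h2 le_rfl (by omega) PolyDeg.id
      · refine absurd (hasRunsBoth_of_triples (e := b.base ++ (fin ++ b.pre))
          (e' := (fin ++ b.pre) ++ b.base) hj1 hbn hb0 htriple
          (fun K hK => hc (conj_of_suffix rfl hK)) (fun K hK => hc (conj_of_prefix rfl hK)) j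
          (fun t ht => ?_) (fun t ht => ?_)) (hno j hj1 hjd)
        · obtain ⟨i, hi⟩ := Nat.exists_eq_add_of_le' (hbn.pos ht)
          refine ⟨b.pre ++ wpow b.base i, ?_⟩
          rw [hi, wpow_succ']
          simp
        · obtain ⟨i, hi⟩ := Nat.exists_eq_add_of_le' (hbn.pos (Nat.le_succ_of_le ht))
          refine ⟨wpow b.base i ++ fin, ?_⟩
          rw [hi, wpow_succ]
          simp
    · rw [List.concat_eq_append] at *
      obtain ⟨hml, jm, hjm1, hjmd, hmn⟩ := hgood bm (by simp)
      have hgp : ∀ c ∈ p, c.Good d l := fun c hc => hgood c (by simp [hc])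
      by_cases hc : bm.base ++ (fin ++ b.pre) = (fin ++ b.pre) ++ b.base
      · -- rotate the first run to the end
        have hrot := ih (p ++ [⟨bm.pre, bm.base, fun t => bm.exp t + b.exp (t + 1)⟩])
          (fin ++ b.pre) (by simpa using hp) (fun c hc => by
            rcases List.mem_append.1 hc with hc | hc
            · exact hgp c hc
            · rw [List.mem_singleton.1 hc]
              exact ⟨hml, _, le_max_of_le_left hjm1, max_le hjmd hjd, hmn.add (hbn.shift 1)⟩)
        have hword : ∀ t, blocks (p ++ [⟨bm.pre, bm.base, fun t => bm.exp t + b.exp (t + 1)⟩]) t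
            ++ (fin ++ b.pre) = (blocks (p ++ [bm]) t ++ fin) ++ (b.pre ++
              wpow b.base (b.exp (t + 1))) := fun t => by
          have h1 := wpow_conj hc (b.exp (t + 1))
          simp only [blocks_append, blocks_cons, blocks_nil, List.append_nil, wpow_add,
            List.append_assoc] at h1 ⊢
          rw [h1]
        have hprod : ∀ t, wprod (fun i => blocks (b :: (p ++ [bm])) i ++ fin) (t + 1)
            = (b.pre ++ wpow b.base (b.exp 0)) ++ (wprod (fun i =>
              blocks (p ++ [⟨bm.pre, bm.base, fun t => bm.exp t + b.exp (t + 1)⟩]) i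
                ++ (fin ++ b.pre)) t ++ (blocks (p ++ [bm]) t ++ fin)) := fun t => by
          induction t with
          | zero => simp [wprod_succ]
          | succ t iht =>
            rw [wprod_succ, iht, wprod_succ _ t, hword, blocks_cons]
            simp only [List.append_assoc]
        refine Tame.of_shift 1 ?_
        simp only [hprod]
        refine (Tame.const _ _).append ((hrot fun t => ?_).append
          ((Tame.of_pat hl ⟨_, _, fun c hc => hgood c (List.mem_cons_of_mem _ hc), fun _ =>
            rfl⟩).mono (Nat.le_succ d)))
        refine hL _ _ ?_ (hmem (t + 1))
        rw [hprod]
        exact ⟨_, _, List.append_assoc _ _ _⟩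
      · obtain ⟨b1, p1, hp1⟩ : ∃ b1 p1, p ++ [bm] = b1 :: p1 :=
          List.exists_cons_of_ne_nil (by simp)
        obtain ⟨h1l, j1, hj11, hj1d, h1n⟩ := hgood b1 (by simp [hp1])
        by_cases hc1 : b.base ++ b1.pre = b1.pre ++ b1.base
        · -- merge the first two runs
          obtain ⟨p', fin', hlen, hg', hw'⟩ := exists_blocks_prepend (d := d) (l := l) b1.pre p1
            fin (fun c hc => hgood c (by simp [hp1, hc]))
          have hword : ∀ t, blocks (b :: (p ++ [bm])) t ++ fin
              = blocks (⟨b.pre, b.base, fun t => b.exp t + b1.exp t⟩ :: p') t ++ fin' := fun t => by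
            have h1 := wpow_conj hc1 (b1.exp t)
            simp only [hp1, blocks_cons, wpow_add, List.append_assoc, hw']
            rw [← List.append_assoc (wpow b.base (b1.exp t)), h1]
            simp only [List.append_assoc]
          simp only [hword] at hmem ⊢
          refine ih _ fin' ?_ ?_ hmem
          · have := congrArg List.length hp1
            simp only [List.length_cons] at this ⊢
            omega
          · intro c hc
            rcases List.mem_cons.1 hc with rfl | hc
            · exact ⟨hbl, _, le_max_of_le_left hj1, max_le hjd hj1d, hbn.add h1n⟩
            · exact hg' c hc
        · refine absurd (hasRunsBoth_of_triples (e := bm.base ++ (fin ++ b.pre))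
            (e' := b1.pre ++ b1.base) hj1 hbn hb0 htriple
            (fun K hK => hc (conj_of_suffix (hml.trans hbl.symm) hK))
            (fun K hK => hc1 (conj_of_prefix (hbl.trans h1l.symm) hK)) (max jm j1)
            (fun t ht => ?_) (fun t ht => ?_)) (hno j hj1 hjd)
          · obtain ⟨i, hi⟩ := Nat.exists_eq_add_of_le' (hmn.pos (le_of_max_le_left ht))
            refine ⟨b.pre ++ wpow b.base (b.exp t) ++ blocks p t ++ bm.pre ++ wpow bm.base i, ?_⟩
            simp [hi, wpow_succ']
          · obtain ⟨i, hi⟩ := Nat.exists_eq_add_of_le' (h1n.pos (le_of_max_le_right ht))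
            rw [hp1, blocks_cons, hi, wpow_succ]
            simp only [List.append_assoc]
            rw [← List.append_assoc]
            exact List.prefix_append _ _

/-- Products of consecutive tame words are tame unless they create long runs. -/
lemma tame_wprod {L : Set (List B)} (hL : FactorClosed L) {d : ℕ}
    (hno : ∀ j, 1 ≤ j → j ≤ d → ¬ HasRunsBoth L j) {W : ℕ → List B} (hW : Tame d W)
    (hmem : ∀ t, wprod W t ∈ L) : Tame (d + 1) (wprod W) := by
  obtain ⟨l, hl, hW⟩ := hW
  obtain ⟨Q, hQ, hW⟩ := hW l hl dvd_rfl
  obtain ⟨R, hR⟩ := hW Q hQ dvd_rfl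
  have hpat : ∀ r, Pat d l (fun t => wprod (fun i => W (Q * t + R + i)) r) := by
    intro r
    induction r with
    | zero => exact Pat.const d l []
    | succ r ih =>
      simp only [wprod_succ]
      refine ih.append ?_
      simpa [Nat.add_assoc] using hR (R + r) (Nat.le_add_right _ _)
  obtain ⟨p, fin, hp, hU⟩ := hpat Q
  have hgroup : ∀ t, wprod W (Q * t + R)
      = wprod W R ++ wprod (fun i => blocks p i ++ fin) t := by
    intro t
    induction t with
    | zero => simp
    | succ t ih =>
      rw [show Q * (t + 1) + R = Q * t + R + Q by ring, wprod_add, ih, wprod_succ, ← hU]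
      simp
  refine Tame.of_residues hQ R fun r _ => ?_
  have h1 : ∀ t, wprod W (Q * t + (R + r)) = (wprod W R ++ wprod (fun i => blocks p i ++ fin) t)
      ++ wprod (fun i => W (Q * t + R + i)) r := fun t => by
    rw [← Nat.add_assoc, wprod_add, hgroup]
  simp only [h1]
  refine ((Tame.const _ _).append (tame_wprod_blocks hL hl hno _ p fin rfl hp fun t => ?_)).append
    ((Tame.of_pat hl (hpat r)).mono (Nat.le_succ d))
  refine hL _ _ ?_ (hmem (Q * t + R))
  rw [hgroup]
  exact (List.suffix_append _ _).isInfix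

/-- The product `W (t - 1) ++ ⋯ ++ W 1 ++ W 0`. -/
def wprodRev (W : ℕ → List B) (t : ℕ) : List B := (wprod (fun i => (W i).reverse) t).reverse

@[simp] lemma wprodRev_zero (W : ℕ → List B) : wprodRev W 0 = [] := rfl

lemma wprodRev_succ (W : ℕ → List B) (t : ℕ) : wprodRev W (t + 1) = W t ++ wprodRev W t := by
  simp [wprodRev, wprod_succ]

lemma tame_wprodRev {L : Set (List B)} (hL : FactorClosed L) {d : ℕ}
    (hno : ∀ j, 1 ≤ j → j ≤ d → ¬ HasRunsBoth L j) {W : ℕ → List B} (hW : Tame d W)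
    (hmem : ∀ t, wprodRev W t ∈ L) : Tame (d + 1) (wprodRev W) :=
  (tame_wprod hL.revLang (fun j h1 h2 h3 => hno j h1 h2 h3.of_revLang) hW.reverse hmem).reverse

end Runs

/-! ### Factors of an infinite word -/

section Factors

variable {B : Type*}

/-- The factor of length `n` at position `i`. -/
def factor (β : ℕ → B) (i n : ℕ) : List B := List.ofFn (fun j : Fin n => β (i + (j : ℕ)))

@[simp] lemma length_factor (β : ℕ → B) (i n : ℕ) : (factor β i n).length = n := by
  simp [factor]

lemma factor_add (β : ℕ → B) (i m n : ℕ) :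
    factor β i (m + n) = factor β i m ++ factor β (i + m) n := by
  simp [factor, List.ofFn_add, Nat.add_assoc]

/-- The set of factors of an infinite word. -/
def lang (β : ℕ → B) : Set (List B) := {w | ∃ i, w = factor β i w.length}

lemma mem_lang_iff {β : ℕ → B} {w : List B} : w ∈ lang β ↔ ∃ i n, w = factor β i n := by
  constructor
  · rintro ⟨i, h⟩
    exact ⟨i, _, h⟩
  · rintro ⟨i, n, rfl⟩
    exact ⟨i, by simp⟩

lemma eq_factor_of_append {β : ℕ → B} {u v : List B} {i n : ℕ} (h : u ++ v = factor β i n) :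
    u = factor β i u.length ∧ v = factor β (i + u.length) v.length := by
  have h1 : n = u.length + v.length := by
    have := congrArg List.length h
    simpa using this.symm
  rw [h1, factor_add] at h
  exact List.append_inj h (by simp)

lemma factorClosed_lang (β : ℕ → B) : FactorClosed (lang β) := by
  rintro u v ⟨s, t, rfl⟩ ⟨i, h⟩
  obtain ⟨h1, -⟩ := eq_factor_of_append h
  obtain ⟨-, h2⟩ := eq_factor_of_append h1
  exact ⟨_, h2⟩

lemma exists_append_mem_lang {β : ℕ → B} {w : List B} (hw : w ∈ lang β) {N : ℕ}
    (hN : w.length ≤ N) : ∃ y, w ++ y ∈ lang β ∧ (w ++ y).length = N := by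
  obtain ⟨i, h⟩ := hw
  obtain ⟨k, rfl⟩ := Nat.exists_eq_add_of_le hN
  refine ⟨factor β (i + w.length) k, ?_, by simp⟩
  rw [mem_lang_iff]
  refine ⟨i, w.length + k, ?_⟩
  rw [factor_add, ← h]

lemma complexity_eq (β : ℕ → B) (n : ℕ) :
    complexity β n = {w | w ∈ lang β ∧ w.length = n}.ncard := by
  unfold complexity
  congr 1
  ext w
  constructor
  · rintro ⟨i, rfl⟩
    exact ⟨mem_lang_iff.2 ⟨i, n, rfl⟩, by simp⟩
  · rintro ⟨⟨i, h⟩, rfl⟩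
    exact ⟨i, h⟩

lemma finite_of_length [Finite B] {S : Set (List B)} {N : ℕ} (h : ∀ w ∈ S, w.length = N) :
    S.Finite :=
  (List.finite_length_eq B N).subset h

lemma not_prefix_wpow {g e l : List B} (hg : g ≠ []) (he : ∀ K, ¬ e <:+ wpow g K) (n : ℕ) :
    ¬ l ++ e ++ g <+: wpow g n := by
  intro h
  have h1 := wpow_conj (conj_of_prefix rfl h) (l ++ e).length
  have h2 : l ++ e <:+ wpow g (l ++ e).length :=
    List.suffix_of_suffix_length_le (List.suffix_append _ _)
      (h1.symm ▸ List.suffix_append (l ++ e) (wpow g (l ++ e).length))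
      (by rw [length_wpow]; exact le_mul_length hg _)
  exact he _ ((List.suffix_append l e).trans h2)

lemma not_prefix_append {g e : List B} (hg : g ≠ []) (he : ∀ K, ¬ e <+: wpow g K) :
    ¬ e <+: g ++ e := by
  intro h
  have h1 : ∀ i, e <+: wpow g i ++ e := by
    intro i
    induction i with
    | zero => simp
    | succ i ih =>
      refine h.trans ?_
      rw [wpow_succ, List.append_assoc]
      exact (List.prefix_append_right_inj g).2 ih
  exact he e.length (List.prefix_of_prefix_length_le (h1 e.length) (List.prefix_append _ _)
    (by rw [length_wpow]; exact le_mul_length hg _))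

lemma strictMono_from {n : ℕ → ℕ} {t₀ : ℕ} (h : ∀ t, t₀ ≤ t → n t < n (t + 1)) {s t : ℕ}
    (hs : t₀ ≤ s) (hst : s < t) : n s < n t := by
  induction t, hst using Nat.le_induction with
  | base => exact h s hs
  | succ t hst ih => exact ih.trans (h t (by omega))

/-- Position and length of a maximal run are determined by the word. -/
lemma run_unique {g e e' x x' y y' : List B} {n n' : ℕ} (hg : g ≠ [])
    (he : ∀ K, ¬ e <:+ wpow g K) (he' : ∀ K, ¬ e' <+: wpow g K)
    (h : x ++ e ++ wpow g n ++ e' ++ y = x' ++ e ++ wpow g n' ++ e' ++ y')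
    (hlen : x.length + e.length ≤ x'.length ∨ x.length = x'.length)
    (hn : x'.length + 1 ≤ x.length + n) (hn' : 0 < n') :
    x.length = x'.length ∧ n ≤ n' := by
  have hpos := List.length_pos_iff.2 hg
  rcases hlen with hlen | hlen
  · exfalso
    obtain ⟨k, rfl⟩ := Nat.exists_eq_add_of_le' hn'
    have h1 : x ++ e <+: x' := by
      refine List.prefix_of_prefix_length_le (l₃ := x ++ e ++ wpow g n ++ e' ++ y) ?_ ?_
        (by simpa using hlen)
      · simp only [List.append_assoc]
        rw [← List.append_assoc x e]
        exact List.prefix_append _ _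
      · rw [h]
        simp only [List.append_assoc]
        exact List.prefix_append _ _
    obtain ⟨l, rfl⟩ := h1
    have h2 : wpow g n ++ (e' ++ y) = l ++ e ++ g ++ (wpow g k ++ e' ++ y') := by
      have h3 := h
      rw [wpow_succ] at h3
      simp only [List.append_assoc, List.append_cancel_left_eq] at h3 ⊢
      exact h3
    refine not_prefix_wpow (l := l) hg he n
      (List.prefix_of_prefix_length_le (l₃ := wpow g n ++ (e' ++ y)) ?_ (List.prefix_append _ _) ?_)
    · rw [h2]
      exact List.prefix_append _ _
    · simp only [List.length_append, length_wpow] at hn ⊢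
      have : l.length + e.length + 1 ≤ n := by omega
      nlinarith
  · refine ⟨hlen, ?_⟩
    by_contra hlt
    obtain ⟨k, rfl⟩ := Nat.exists_eq_add_of_lt (not_le.1 hlt)
    simp only [List.append_assoc] at h
    have h1 := List.append_cancel_left (List.append_inj h hlen).2
    rw [Nat.add_assoc, wpow_add, List.append_assoc] at h1
    have h2 := List.append_cancel_left h1
    refine not_prefix_append (g := wpow g (k + 1)) (e := e') ?_ ?_ ?_
    · intro h0
      have := congrArg List.length h0
      simp only [length_wpow, List.length_nil] at this
      exact absurd this (Nat.mul_pos (Nat.succ_pos k) hpos).ne'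
    · intro K hK
      rw [← wpow_mul] at hK
      exact he' _ hK
    · refine List.prefix_of_prefix_length_le (l₃ := e' ++ y') (List.prefix_append _ _) ?_ (by simp)
      rw [← h2, ← List.append_assoc]
      exact List.prefix_append _ _

/-- Long runs force a large complexity. -/
lemma HasRuns.le_complexity [Finite B] {β : ℕ → B} {j : ℕ} (hj : 1 ≤ j)
    (h : HasRuns (lang β) j) :
    ∃ M K T₀, 0 < M ∧ ∀ T N, T₀ ≤ T → M * T ^ j ≤ N → T ^ (j + 1) ≤ K * complexity β N := by
  obtain ⟨g, e, e', n, t₀, c, hg, he, he', hmono, hrun⟩ := h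
  have hc : 0 < c := by
    obtain ⟨h1, -⟩ := hrun (t₀ + 1) (by omega)
    by_contra h0
    obtain rfl : c = 0 := by omega
    have : 0 < (t₀ + 1) ^ j := by positivity
    omega
  set E := e.length + 1 with hE
  refine ⟨c * 3 ^ j * (1 + g.length) + E + e'.length, 2 * (c * E), t₀ + c * E, by omega,
    fun T N hT hN => ?_⟩
  have hcE : 0 < c * E := Nat.mul_pos hc (by omega)
  set I := T ^ j / (c * E) with hI
  have hTj : T ≤ T ^ j := Nat.le_self_pow (by omega) T
  -- the windows
  have hwin : ∀ x : ℕ × ℕ, ∃ w, x ∈ Finset.range I ×ˢ Finset.Ioc T (2 * T) →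
      w ∈ lang β ∧ w.length = N ∧ I * E ≤ n x.2 ∧
      ∃ u y, u.length = x.1 * E ∧ w = u ++ e ++ wpow g (n x.2) ++ e' ++ y := by
    rintro ⟨i, t⟩
    by_cases hx : (i, t) ∈ Finset.range I ×ˢ Finset.Ioc T (2 * T)
    swap
    · exact ⟨[], fun h => absurd h hx⟩
    simp only [Finset.mem_product, Finset.mem_range, Finset.mem_Ioc] at hx
    obtain ⟨hi, ht1, ht2⟩ := hx
    obtain ⟨h1, h2, X, Y, h3, h4⟩ := hrun t (by omega)
    have h5 : T ^ j ≤ t ^ j := Nat.pow_le_pow_left ht1.le j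
    have h6 : (i + 1) * (c * E) ≤ T ^ j :=
      (Nat.le_div_iff_mul_le hcE).1 hi
    have h7 : I * E ≤ n t := by
      refine le_of_mul_le_mul_left (a := c) ?_ hc
      calc c * (I * E) = T ^ j / (c * E) * (c * E) := by rw [hI]; ring
        _ ≤ T ^ j := Nat.div_mul_le_self _ _
        _ ≤ _ := by omega
    have h7' : (i + 1) * E ≤ I * E := Nat.mul_le_mul_right _ hi
    have h8 : (i + 1) * E ≤ (X ++ e).length := by
      refine le_of_mul_le_mul_left (a := c) ?_ hc
      calc c * ((i + 1) * E) = (i + 1) * (c * E) := by ring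
        _ ≤ _ := by omega
    rw [List.length_append] at h8
    have h9 : i * E + E = (i + 1) * E := by ring
    have h10 : n t ≤ c * 3 ^ j * T ^ j := by
      refine h2.trans ?_
      rw [mul_assoc, ← mul_pow]
      exact Nat.mul_le_mul_left c (Nat.pow_le_pow_left (by omega) j)
    have hsuf : X.drop (X.length - i * E) ++ e ++ wpow g (n t) ++ e' ∈ lang β := by
      refine factorClosed_lang β _ _ ⟨X.take (X.length - i * E), Y, ?_⟩ h3
      simp only [← List.append_assoc, List.take_append_drop]
    have hlen : (X.drop (X.length - i * E) ++ e ++ wpow g (n t) ++ e').length ≤ N := by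
      refine le_trans ?_ hN
      simp only [List.length_append, length_wpow, List.length_drop]
      have h11 : n t * g.length ≤ c * 3 ^ j * T ^ j * g.length := Nat.mul_le_mul_right _ h10
      have h12 : 0 < T ^ j := by
        have : 0 < T := by omega
        positivity
      have h13 : E + e'.length ≤ (E + e'.length) * T ^ j := Nat.le_mul_of_pos_right _ h12
      have h14 : (c * 3 ^ j * (1 + g.length) + E + e'.length) * T ^ j
          = c * 3 ^ j * T ^ j + c * 3 ^ j * T ^ j * g.length + (E + e'.length) * T ^ j := by ring
      omega
    obtain ⟨y, hy1, hy2⟩ := exists_append_mem_lang hsuf hlen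
    refine ⟨_, fun _ => ⟨hy1, hy2, h7, _, y, ?_, rfl⟩⟩
    rw [List.length_drop]
    dsimp only
    omega
  choose w hw using hwin
  have hinj : Set.InjOn w (Finset.range I ×ˢ Finset.Ioc T (2 * T) : Finset (ℕ × ℕ)) := by
    have key : ∀ x ∈ Finset.range I ×ˢ Finset.Ioc T (2 * T),
        ∀ x' ∈ Finset.range I ×ˢ Finset.Ioc T (2 * T), x.1 ≤ x'.1 → w x = w x' →
        x.1 = x'.1 ∧ n x.2 ≤ n x'.2 := by
      intro x hx x' hx' hle heq
      obtain ⟨-, -, h1, u, y, h2, h3⟩ := hw x hx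
      obtain ⟨-, -, h1', u', y', h2', h3'⟩ := hw x' hx'
      have h4 : u.length + e.length ≤ u'.length ∨ u.length = u'.length := by
        rcases hle.lt_or_eq with h | h
        · left
          have : (x.1 + 1) * E ≤ x'.1 * E := Nat.mul_le_mul_right _ h
          rw [h2, h2']
          linarith
        · right
          rw [h2, h2', h]
      have h5 : (x'.1 + 1) * E ≤ I * E := by
        simp only [Finset.mem_product, Finset.mem_range] at hx'
        exact Nat.mul_le_mul_right _ hx'.1
      have h6 : (x'.1 + 1) * E = x'.1 * E + E := by ring
      obtain ⟨h7, h8⟩ := run_unique hg he he' (h3 ▸ h3' ▸ heq) h4 (by omega) (by omega)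
      exact ⟨Nat.eq_of_mul_eq_mul_right (by omega) (h2 ▸ h2' ▸ h7), h8⟩
    have key' : ∀ x ∈ Finset.range I ×ˢ Finset.Ioc T (2 * T),
        ∀ x' ∈ Finset.range I ×ˢ Finset.Ioc T (2 * T), x.1 ≤ x'.1 → w x = w x' → x = x' := by
      intro x hx x' hx' hle heq
      obtain ⟨h1, h2⟩ := key x hx x' hx' hle heq
      obtain ⟨-, h3⟩ := key x' hx' x hx h1.ge heq.symm
      simp only [Finset.mem_product, Finset.mem_Ioc] at hx hx'
      refine Prod.ext h1 ?_
      rcases lt_trichotomy x.2 x'.2 with h | h | h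
      · have := strictMono_from hmono (by omega) h
        omega
      · exact h
      · have := strictMono_from hmono (by omega) h
        omega
    intro x hx x' hx' heq
    rcases le_total x.1 x'.1 with h | h
    · exact key' x hx x' hx' h heq
    · exact (key' x' hx' x hx h heq.symm).symm
  have hcard : I * T ≤ complexity β N := by
    classical
    have h1 := Finset.card_image_of_injOn hinj
    rw [Finset.card_product, Finset.card_range, Nat.card_Ioc, show 2 * T - T = T by omega] at h1
    rw [complexity_eq, ← h1, ← Set.ncard_coe_finset]
    refine Set.ncard_le_ncard ?_ (finite_of_length fun w hw => hw.2)
    intro v hv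
    rw [Finset.mem_coe, Finset.mem_image] at hv
    obtain ⟨x, hx, rfl⟩ := hv
    exact ⟨(hw x hx).1, (hw x hx).2.1⟩
  have h1 : T ^ j ≤ 2 * (c * E) * I := by
    have h2 : 1 ≤ I := (Nat.le_div_iff_mul_le hcE).2 (by omega)
    have h3 := Nat.lt_mul_div_succ (T ^ j) hcE
    have h4 : c * E * (T ^ j / (c * E) + 1) ≤ c * E * (I + I) := Nat.mul_le_mul_left _ (by omega)
    linarith
  calc T ^ (j + 1) = T ^ j * T := pow_succ _ _
    _ ≤ 2 * (c * E) * I * T := Nat.mul_le_mul_right _ h1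
    _ = 2 * (c * E) * (I * T) := by ring
    _ ≤ _ := Nat.mul_le_mul_left _ hcard

end Factors

/-! ### Counting windows -/

section Few

variable {B : Type*}

/-- The number of words of length `N` in `S` is `O(N * F N)`. -/
def Few (F : ℕ → ℕ) (S : Set (List B)) : Prop :=
  ∃ C, ∀ N, 1 ≤ N → {w | w ∈ S ∧ w.length = N}.ncard ≤ C * (N * F N)

namespace Few

variable {F : ℕ → ℕ} {S S' : Set (List B)}

lemma mono [Finite B] (h : S ⊆ S') (hS : Few F S') : Few F S := by
  obtain ⟨C, hC⟩ := hS
  refine ⟨C, fun N hN => (Set.ncard_le_ncard ?_ ?_).trans (hC N hN)⟩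
  · exact fun w hw => ⟨h hw.1, hw.2⟩
  · exact finite_of_length fun w hw => hw.2

lemma union (h : Few F S) (h' : Few F S') : Few F (S ∪ S') := by
  obtain ⟨C, hC⟩ := h
  obtain ⟨C', hC'⟩ := h'
  refine ⟨C + C', fun N hN => ?_⟩
  have h1 : {w | w ∈ S ∪ S' ∧ w.length = N}
      = {w | w ∈ S ∧ w.length = N} ∪ {w | w ∈ S' ∧ w.length = N} := by
    ext w
    simp only [Set.mem_union, Set.mem_ofPred_eq, or_and_right]
  rw [h1, add_mul]
  exact (Set.ncard_union_le _ _).trans (Nat.add_le_add (hC N hN) (hC' N hN))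

lemma empty : Few F (∅ : Set (List B)) := ⟨0, by simp⟩

lemma iUnion_finset {ι : Type*} (I : Finset ι) {T : ι → Set (List B)}
    (h : ∀ i ∈ I, Few F (T i)) : Few F (⋃ i ∈ I, T i) := by
  classical
  induction I using Finset.induction_on with
  | empty => simpa using empty
  | insert i I _ ih =>
    rw [Finset.set_biUnion_insert]
    exact (h i (by simp)).union (ih fun i' hi' => h i' (by simp [hi']))

lemma iUnion {ι : Type*} [Finite ι] {T : ι → Set (List B)} (h : ∀ i, Few F (T i)) :
    Few F (⋃ i, T i) := by
  have := Fintype.ofFinite ι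
  simpa using iUnion_finset Finset.univ fun i _ => h i

/-- Words are few if they are determined by their length and few parameters. -/
lemma of_param {ι : Type*} (I : ℕ → Finset ι) (R : List B → ι → Prop)
    (h1 : ∀ w ∈ S, 1 ≤ w.length → ∃ i ∈ I w.length, R w i)
    (h2 : ∀ w ∈ S, ∀ w' ∈ S, ∀ i, w.length = w'.length → R w i → R w' i → w = w')
    (hI : ∃ C, ∀ N, 1 ≤ N → (I N).card ≤ C * (N * F N)) : Few F S := by
  obtain ⟨C, hC⟩ := hI
  refine ⟨C, fun N hN => le_trans ?_ (hC N hN)⟩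
  choose f hf1 hf2 using h1
  classical
  rcases isEmpty_or_nonempty ι with hι | ⟨⟨i₀⟩⟩
  · have : {w | w ∈ S ∧ w.length = N} = ∅ := by
      ext w
      simp only [Set.mem_ofPred_eq, Set.mem_empty_iff_false, iff_false]
      rintro ⟨hw, rfl⟩
      exact hι.elim (f w hw hN)
    simp [this]
  · let f' : List B → ι := fun w => if h : w ∈ S ∧ 1 ≤ w.length then f w h.1 h.2 else i₀
    have hf' : ∀ w (h : w ∈ S) (h' : 1 ≤ w.length), f' w = f w h h' := fun w h h' => by
      simp [f', h, h']
    rw [← Set.ncard_coe_finset]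
    refine Set.ncard_le_ncard_of_injOn f' ?_ ?_ (Finset.finite_toSet _)
    · rintro w ⟨hw, rfl⟩
      rw [hf' w hw hN]
      exact hf1 w hw hN
    · rintro w ⟨hw, rfl⟩ w' ⟨hw', hl⟩ heq
      have hN' : 1 ≤ w'.length := hl ▸ hN
      refine h2 w hw w' hw' (f w hw hN) hl.symm (hf2 w hw hN) ?_
      rw [← hf' w hw hN, heq, hf' w' hw' hN']
      exact hf2 w' hw' hN'

end Few

lemma exists_of_append_eq_append {u v u' v' : List B} (h : u ++ v = u' ++ v')
    (hl : u.length ≤ u'.length) : ∃ x, u' = u ++ x ∧ v = x ++ v' := by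
  obtain ⟨x, rfl⟩ : u <+: u' := List.prefix_of_prefix_length_le (List.prefix_append u v)
    (by rw [h]; exact List.prefix_append _ _) hl
  refine ⟨x, rfl, ?_⟩
  rw [List.append_assoc] at h
  exact List.append_cancel_left h

/-- Each word is a suffix of the later ones. -/
def SuffNested (P : ℕ → List B) : Prop := ∀ ⦃s t⦄, s ≤ t → P s <:+ P t

/-- Each word is a prefix of the later ones. -/
def PrefNested (Q : ℕ → List B) : Prop := ∀ ⦃s t⦄, s ≤ t → Q s <+: Q t

lemma SuffNested.append_const {P : ℕ → List B} (h : SuffNested P) (s : List B) :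
    SuffNested (fun t => P t ++ s) := by
  intro a b hab
  obtain ⟨u, hu⟩ := h hab
  exact ⟨u, by simp only [← hu, List.append_assoc]⟩

lemma suffNested_wpow (g : List B) {n : ℕ → ℕ} (hn : Monotone n) :
    SuffNested (fun t => wpow g (n t)) := fun _ _ h => wpow_suffix g (hn h)

lemma prefNested_wpow (g : List B) {n : ℕ → ℕ} (hn : Monotone n) :
    PrefNested (fun t => wpow g (n t)) := fun _ _ h => wpow_prefix g (hn h)

lemma suffNested_of_suffix_wpow {g : List B} {P : ℕ → List B} (h : ∀ t, ∃ K, P t <:+ wpow g K)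
    (hl : Monotone fun t => (P t).length) : SuffNested P := by
  intro s t hst
  obtain ⟨K, hK⟩ := h s
  obtain ⟨K', hK'⟩ := h t
  exact List.suffix_of_suffix_length_le (hK.trans (wpow_suffix g (le_max_left K K')))
    (hK'.trans (wpow_suffix g (le_max_right K K'))) (hl hst)

lemma prefNested_of_prefix_wpow {g : List B} {P : ℕ → List B} (h : ∀ t, ∃ K, P t <+: wpow g K)
    (hl : Monotone fun t => (P t).length) : PrefNested P := by
  intro s t hst
  obtain ⟨K, hK⟩ := h s
  obtain ⟨K', hK'⟩ := h t
  exact List.prefix_of_prefix_length_le (hK.trans (wpow_prefix g (le_max_left K K')))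
    (hK'.trans (wpow_prefix g (le_max_right K K'))) (hl hst)

/-- Windows around the junction of growing words. -/
def junction (P Q : ℕ → List B) (K : ℕ) : Set (List B) :=
  {w | ∃ t l r, P t ++ Q t = l ++ (w ++ r) ∧ l.length ≤ (P t).length ∧
    (P t).length ≤ l.length + w.length + K}

lemma few_junction {F : ℕ → ℕ} (hF : ∀ N, 1 ≤ F N) {P Q : ℕ → List B} (hP : SuffNested P)
    (hQ : PrefNested Q) (K : ℕ) : Few F (junction P Q K) := by
  refine Few.of_param (fun N => Finset.range (N + K + 1))
    (fun w o => ∃ t x r, x.length = o ∧ x <:+ P t ∧ x ++ Q t = w ++ r) ?_ ?_ ?_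
  · rintro w ⟨t, l, r, h1, h2, h3⟩ -
    obtain ⟨x, hx, hx'⟩ := exists_of_append_eq_append h1.symm h2
    refine ⟨x.length, Finset.mem_range.2 ?_, t, x, r, rfl, ⟨l, hx.symm⟩, hx'.symm⟩
    rw [hx, List.length_append] at h3
    omega
  · rintro w - w' - o hl ⟨t, x, r, rfl, hx, hw⟩ ⟨t', x', r', hxx, hx', hw'⟩
    have key : ∀ {t t' : ℕ} {x x' r r' w w' : List B}, t ≤ t' → x'.length = x.length →
        w.length = w'.length → x <:+ P t → x' <:+ P t' → x ++ Q t = w ++ r →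
        x' ++ Q t' = w' ++ r' → w = w' := by
      intro t t' x x' r r' w w' htt hxx hl hx hx' hw hw'
      obtain rfl : x = x' := (List.suffix_of_suffix_length_le (hx.trans (hP htt)) hx'
        hxx.ge).eq_of_length hxx.symm
      have h1 : w <+: x ++ Q t' := by
        refine List.IsPrefix.trans ?_ ((List.prefix_append_right_inj x).2 (hQ htt))
        rw [hw]
        exact List.prefix_append _ _
      have h2 : w' <+: x ++ Q t' := by
        rw [hw']
        exact List.prefix_append _ _
      exact (List.prefix_of_prefix_length_le h1 h2 hl.le).eq_of_length hl
    rcases le_total t t' with h | h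
    · exact key h hxx hl hx hx' hw hw'
    · exact (key h hxx.symm hl.symm hx' hx hw' hw).symm
  · refine ⟨K + 2, fun N hN => ?_⟩
    rw [Finset.card_range]
    have := hF N
    have h1 : N ≤ N * F N := Nat.le_mul_of_pos_right _ this
    nlinarith

lemma exists_prefix_of_infix_wpow {g w : List B} (hg : g ≠ []) {K : ℕ} (h : w <:+: wpow g K) :
    ∃ x, x.length < g.length ∧ x ++ w <+: wpow g K := by
  induction K with
  | zero =>
    obtain rfl : w = [] := by simpa using h
    exact ⟨[], List.length_pos_iff.2 hg, by simp⟩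
  | succ K ih =>
    obtain ⟨l, r, hlr⟩ := h
    rcases lt_or_ge l.length g.length with hl | hl
    · exact ⟨l, hl, r, hlr⟩
    · rw [wpow_succ, List.append_assoc] at hlr
      have h1 : g <+: l := List.prefix_of_prefix_length_le (List.prefix_append _ _)
        (hlr ▸ List.prefix_append _ _) hl
      obtain ⟨l', rfl⟩ := h1
      rw [List.append_assoc, List.append_cancel_left_eq] at hlr
      obtain ⟨x, hx, hx'⟩ := ih ⟨l', r, by rw [List.append_assoc, hlr]⟩
      exact ⟨x, hx, hx'.trans (wpow_prefix g (Nat.le_succ K))⟩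

lemma few_infix_wpow {F : ℕ → ℕ} (hF : ∀ N, 1 ≤ F N) {g : List B} (hg : g ≠ []) :
    Few F {w | ∃ K, w <:+: wpow g K} := by
  refine Few.of_param (fun _ => Finset.range g.length)
    (fun w o => ∃ x K, x.length = o ∧ x ++ w <+: wpow g K) ?_ ?_ ?_
  · rintro w ⟨K, hK⟩ -
    obtain ⟨x, hx, hx'⟩ := exists_prefix_of_infix_wpow hg hK
    exact ⟨x.length, Finset.mem_range.2 hx, x, K, rfl, hx'⟩
  · rintro w - w' - o hl ⟨x, K, rfl, hw⟩ ⟨x', K', hxx, hw'⟩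
    have h1 : x ++ w = x' ++ w' := (List.prefix_of_prefix_length_le
      (hw.trans (wpow_prefix g (le_max_left K K')))
      (hw'.trans (wpow_prefix g (le_max_right K K'))) (by simp [hl, hxx])).eq_of_length
      (by simp [hl, hxx])
    exact (List.append_inj h1 hxx.symm).2
  · refine ⟨g.length, fun N hN => ?_⟩
    rw [Finset.card_range]
    exact Nat.le_mul_of_pos_right _ (Nat.mul_pos hN (hF N))

/-- Windows of `P t ++ H t ++ Q t` touching `H t`. -/
def win (P H Q : ℕ → List B) : Set (List B) :=
  {w | ∃ t l r, P t ++ (H t ++ Q t) = l ++ (w ++ r) ∧ l.length ≤ (P t).length + (H t).length ∧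
    (P t).length ≤ l.length + w.length}

/-- For each `j ≤ k`, the lengths grow at least like `t ^ j` or at most like `t ^ (j - 1)`. -/
def Dich (k : ℕ) (P : ℕ → List B) : Prop :=
  ∀ j, 1 ≤ j → j ≤ k → (∃ c, ∀ t, t ^ j ≤ c * ((P t).length + 1)) ∨
    ∃ c, ∀ t, (P t).length ≤ c * (t + 1) ^ (j - 1)

lemma Dich.append {k : ℕ} {P P' : ℕ → List B} (h : Dich k P) (h' : Dich k P') :
    Dich k (fun t => P t ++ P' t) := by
  intro j h1 h2
  rcases h j h1 h2 with ⟨c, hc⟩ | ⟨c, hc⟩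
  · left
    refine ⟨c, fun t => (hc t).trans (Nat.mul_le_mul_left _ ?_)⟩
    simp only [List.length_append]
    omega
  · rcases h' j h1 h2 with ⟨c', hc'⟩ | ⟨c', hc'⟩
    · left
      refine ⟨c', fun t => (hc' t).trans (Nat.mul_le_mul_left _ ?_)⟩
      simp only [List.length_append]
      omega
    · right
      refine ⟨c + c', fun t => ?_⟩
      rw [List.length_append, add_mul]
      exact Nat.add_le_add (hc t) (hc' t)

lemma dich_const (k : ℕ) (s : List B) : Dich k (fun _ => s) := by
  intro j _ _
  right
  exact ⟨s.length, fun t => Nat.le_mul_of_pos_right _ (by positivity)⟩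

lemma dich_wpow {k j : ℕ} {g : List B} (hg : g ≠ []) {n : ℕ → ℕ} (hn : PolyDeg j n) :
    Dich k (fun t => wpow g (n t)) := by
  intro i h1 _
  rcases le_or_gt i j with hij | hij
  · left
    obtain ⟨c, hc⟩ := pow_le_of_choose_le hn.choose_le
    refine ⟨c, fun t => ?_⟩
    have h2 : t ^ i ≤ t ^ j := by
      rcases Nat.eq_zero_or_pos t with rfl | ht
      · simp [show i ≠ 0 by omega]
      · exact Nat.pow_le_pow_right ht hij
    refine h2.trans ((hc t).trans (Nat.mul_le_mul_left _ ?_))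
    have := le_mul_length hg (n t)
    rw [length_wpow]
    omega
  · right
    obtain ⟨c, hc⟩ := hn.le_pow
    refine ⟨c * g.length, fun t => ?_⟩
    rw [length_wpow]
    have h2 : (t + 1) ^ j ≤ (t + 1) ^ (i - 1) := Nat.pow_le_pow_right (by omega) (by omega)
    calc n t * g.length ≤ c * (t + 1) ^ (i - 1) * g.length :=
          Nat.mul_le_mul_right _ ((hc t).trans (Nat.mul_le_mul_left _ h2))
      _ = _ := by ring

end Few

section FewWin

variable {B : Type*}

/-- Windows of `P t ++ M t ++ R t` containing `M t`. -/
def span (P M R : ℕ → List B) : Set (List B) :=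
  {w | ∃ t l r, P t ++ (M t ++ R t) = l ++ (w ++ r) ∧ l.length ≤ (P t).length ∧
    (P t).length + (M t).length ≤ l.length + w.length}

/-- Windows of `P t ++ R t` meeting both parts, at times `O(F N)` where `N` is the length of the
window. -/
def timed (F : ℕ → ℕ) (c : ℕ) (P R : ℕ → List B) : Set (List B) :=
  {w | ∃ t l r, P t ++ R t = l ++ (w ++ r) ∧ l.length ≤ (P t).length ∧
    (P t).length ≤ l.length + w.length ∧ (1 ≤ w.length → t ≤ c * F w.length)}

lemma few_timed {F : ℕ → ℕ} (hF : ∀ N, 1 ≤ F N) (P R : ℕ → List B) (c : ℕ) :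
    Few F (timed F c P R) := by
  refine Few.of_param (fun N => Finset.range (c * F N + 1) ×ˢ Finset.range (N + 1))
    (fun w x => ∃ l r, P x.1 ++ R x.1 = l ++ (w ++ r) ∧
      l.length + x.2 = (P x.1).length) ?_ ?_ ?_
  · rintro w ⟨t, l, r, h1, h2, h3, hc⟩ hN
    refine ⟨(t, (P t).length - l.length), ?_, l, r, h1, ?_⟩
    · have := hc hN
      simp only [Finset.mem_product, Finset.mem_range]
      omega
    · dsimp only
      omega
  · rintro w - w' - ⟨t, o⟩ hl ⟨l, r, h1, h2⟩ ⟨l', r', h1', h2'⟩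
    rw [h1] at h1'
    have h3 := (List.append_inj h1' (by dsimp only at h2 h2'; omega)).2
    exact (List.append_inj h3 hl).1
  · refine ⟨2 * (c + 1), fun N hN => ?_⟩
    rw [Finset.card_product, Finset.card_range, Finset.card_range]
    have h1 := hF N
    calc (c * F N + 1) * (N + 1) ≤ ((c + 1) * F N) * (2 * N) := by
          refine Nat.mul_le_mul ?_ (by omega)
          rw [add_mul]
          omega
      _ = _ := by ring

lemma few_span_of_time [Finite B] {F : ℕ → ℕ} (hF : ∀ N, 1 ≤ F N) {P M R : ℕ → List B} {c : ℕ}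
    (hc : ∀ t N, 1 ≤ N → (M t).length ≤ N → t ≤ c * F N) : Few F (span P M R) := by
  refine (few_timed hF P (fun t => M t ++ R t) c).mono ?_
  rintro w ⟨t, l, r, h1, h2, h3⟩
  exact ⟨t, l, r, h1, h2, by omega, fun hw => hc t _ hw (by omega)⟩

lemma few_span_of_length {F : ℕ → ℕ} (hF : ∀ N, 1 ≤ F N) {P M R : ℕ → List B} {j c c' : ℕ}
    (hj : 1 ≤ j) (hc : ∀ t, (P t).length ≤ c * (t + 1) ^ (j - 1))
    (hc' : ∀ t, t ^ j ≤ c' * ((M t).length + 1)) : Few F (span P M R) := by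
  set T : ℕ → ℕ := fun N => Nat.findGreatest (fun t => t ^ j ≤ 2 * c' * N) (2 * c' * N) with hT
  refine Few.of_param
    (fun N => Finset.range (T N + 1) ×ˢ Finset.range (c * (T N + 1) ^ (j - 1) + 1))
    (fun w x => ∃ l r, P x.1 ++ (M x.1 ++ R x.1) = l ++ (w ++ r) ∧ l.length = x.2) ?_ ?_ ?_
  · rintro w ⟨t, l, r, h1, h2, h3⟩ hN
    refine ⟨(t, l.length), ?_, l, r, h1, rfl⟩
    have h4 : t ^ j ≤ 2 * c' * w.length := by
      refine (hc' t).trans ?_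
      rw [mul_comm 2, mul_assoc]
      exact Nat.mul_le_mul_left _ (by omega)
    have h5 : t ≤ T w.length :=
      Nat.le_findGreatest ((Nat.le_self_pow (by omega) t).trans h4) h4
    have h6 : c * (t + 1) ^ (j - 1) ≤ c * (T w.length + 1) ^ (j - 1) :=
      Nat.mul_le_mul_left _ (Nat.pow_le_pow_left (by omega) _)
    have := hc t
    simp only [Finset.mem_product, Finset.mem_range]
    omega
  · rintro w - w' - ⟨t, o⟩ hl ⟨l, r, h1, h2⟩ ⟨l', r', h1', h2'⟩
    rw [h1] at h1'
    have h3 := (List.append_inj h1' (h2.trans h2'.symm)).2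
    exact (List.append_inj h3 hl).1
  · refine ⟨(c + 1) * (2 ^ j * (2 * c' + 1)), fun N hN => ?_⟩
    rw [Finset.card_product, Finset.card_range, Finset.card_range]
    have h1 : T N ^ j ≤ 2 * c' * N :=
      Nat.findGreatest_spec (P := fun t => t ^ j ≤ 2 * c' * N) (m := 0) (Nat.zero_le _)
        (by simp [show j ≠ 0 by omega])
    have h2 : (T N + 1) ^ j ≤ 2 ^ j * (T N ^ j + 1) := by
      rcases Nat.eq_zero_or_pos (T N) with h | h
      · rw [h]
        have : 0 < 2 ^ j := by positivity
        have h0 : (0 : ℕ) ^ j = 0 := by simp [show j ≠ 0 by omega]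
        rw [h0]
        simp only [zero_add, one_pow]
        omega
      · calc (T N + 1) ^ j ≤ (2 * T N) ^ j := Nat.pow_le_pow_left (by omega) j
          _ = 2 ^ j * T N ^ j := mul_pow _ _ _
          _ ≤ _ := Nat.mul_le_mul_left _ (Nat.le_succ _)
    have h3 : (T N + 1) * (T N + 1) ^ (j - 1) = (T N + 1) ^ j := by
      rw [← pow_succ', Nat.sub_add_cancel hj]
    have h4 : 0 < (T N + 1) ^ (j - 1) := by positivity
    have h5 : N ≤ N * F N := Nat.le_mul_of_pos_right _ (hF N)
    calc (T N + 1) * (c * (T N + 1) ^ (j - 1) + 1)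
        ≤ (T N + 1) * ((c + 1) * (T N + 1) ^ (j - 1)) := by
          refine Nat.mul_le_mul_left _ ?_
          rw [add_mul]
          omega
      _ = (c + 1) * (T N + 1) ^ j := by rw [← h3]; ring
      _ ≤ (c + 1) * (2 ^ j * (T N ^ j + 1)) := Nat.mul_le_mul_left _ h2
      _ ≤ (c + 1) * (2 ^ j * ((2 * c' + 1) * N)) := by
          refine Nat.mul_le_mul_left _ (Nat.mul_le_mul_left _ ?_)
          rw [add_mul]
          omega
      _ ≤ (c + 1) * (2 ^ j * ((2 * c' + 1) * (N * F N))) := by gcongr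
      _ = _ := by ring

lemma hasRuns_of_nested {L : Set (List B)} {j : ℕ} (hj : 1 ≤ j) {g e' : List B} (hg : g ≠ [])
    {n : ℕ → ℕ} (hn : PolyDeg j n) {P R : ℕ → List B} (hP : SuffNested P) {t₁ t₂ : ℕ}
    (he : ∀ K, ¬ P t₁ <:+ wpow g K) (he' : ∀ K, ¬ e' <+: wpow g K)
    (hR : ∀ t, t₂ ≤ t → e' <+: R t) (hc : ∃ c, ∀ t, t ^ j ≤ c * ((P t).length + 1))
    (hL : ∀ t, P t ++ (wpow g (n t) ++ R t) ∈ L) : HasRuns L j := by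
  obtain ⟨c, hc⟩ := hc
  obtain ⟨c', hc'⟩ := hn.exists_bounds
  obtain ⟨i, rfl⟩ := Nat.exists_eq_add_of_le' hj
  refine ⟨g, P t₁, e', n, t₁ + t₂ + (i + 1), 2 * c + c', hg, he, he',
    fun t ht => hn.lt_succ (by omega), fun t ht => ?_⟩
  obtain ⟨h1, h2⟩ := hc' t (by omega)
  obtain ⟨X, hX⟩ := hP (show t₁ ≤ t by omega)
  obtain ⟨Y, hY⟩ := hR t (by omega)
  refine ⟨?_, ?_, X, Y, ?_, ?_⟩
  · rw [add_mul]
    omega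
  · rw [add_mul]
    omega
  · rw [hX, List.append_assoc _ e' Y, hY, List.append_assoc]
    exact hL t
  · rw [hX]
    have h3 : 0 < (P t).length := by
      rw [← hX, List.length_append]
      have : P t₁ ≠ [] := fun h => he 0 (by simp [h])
      have := List.length_pos_iff.2 this
      omega
    have h4 : c * ((P t).length + 1) ≤ c * (2 * (P t).length) := Nat.mul_le_mul_left _ (by omega)
    have := hc t
    nlinarith [Nat.zero_le (c' * (P t).length)]

lemma win_subset_of_suffix {P H Q : ℕ → List B} {s g : List B} {n : ℕ → ℕ}
    (h : ∀ t, ∃ K, P t ++ (s ++ wpow g (n t)) <:+ wpow g K) :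
    win P (fun t => s ++ (wpow g (n t) ++ H t)) Q ⊆
      {w | ∃ K, w <:+: wpow g K} ∪ win (fun t => P t ++ (s ++ wpow g (n t))) H Q := by
  rintro w ⟨t, l, r, h1, h2, h3⟩
  have h4 : P t ++ (s ++ wpow g (n t)) ++ (H t ++ Q t) = l ++ (w ++ r) := by
    rw [← h1]
    simp
  rcases le_total (P t ++ (s ++ wpow g (n t))).length (l ++ w).length with h5 | h5
  · right
    refine ⟨t, l, r, h4, ?_, ?_⟩
    · simp only [List.length_append] at h2 ⊢
      omega
    · simpa only [List.length_append] using h5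
  · left
    obtain ⟨K, hK⟩ := h t
    rw [← List.append_assoc l] at h4
    obtain ⟨x, hx, -⟩ := exists_of_append_eq_append h4.symm h5
    refine ⟨K, List.IsInfix.trans ?_ hK.isInfix⟩
    rw [hx]
    exact ⟨l, x, rfl⟩

lemma win_subset {P H Q : ℕ → List B} {s g : List B} {n : ℕ → ℕ} :
    win P (fun t => s ++ (wpow g (n t) ++ H t)) Q ⊆
      ({w | ∃ K, w <:+: wpow g K} ∪ junction (fun t => P t ++ s) (fun t => wpow g (n t)) s.length)
      ∪ (win (fun t => wpow g (n t)) H Q ∪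
        span (fun t => P t ++ s) (fun t => wpow g (n t)) (fun t => H t ++ Q t)) := by
  rintro w ⟨t, l, r, h1, h2, h3⟩
  have h4 : (P t ++ s) ++ (wpow g (n t) ++ (H t ++ Q t)) = l ++ (w ++ r) := by
    rw [← h1]
    simp
  rcases le_total l.length (P t ++ s).length with h5 | h5
  · rcases le_total (l ++ w).length ((P t ++ s) ++ wpow g (n t)).length with h6 | h6
    · left
      right
      have h7 : (l ++ w) ++ r = ((P t ++ s) ++ wpow g (n t)) ++ (H t ++ Q t) := by
        rw [List.append_assoc, ← h4]
        simp
      obtain ⟨x, hx, -⟩ := exists_of_append_eq_append h7 h6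
      refine ⟨t, l, x, by rw [hx, List.append_assoc], h5, ?_⟩
      simp only [List.length_append]
      omega
    · right
      right
      refine ⟨t, l, r, h4, h5, ?_⟩
      simpa only [List.length_append, Nat.add_assoc] using h6
  · obtain ⟨x, hx, hx'⟩ := exists_of_append_eq_append h4 h5
    rcases le_total (x ++ w).length (wpow g (n t)).length with h6 | h6
    · left
      left
      rw [← List.append_assoc x] at hx'
      obtain ⟨y, hy, -⟩ := exists_of_append_eq_append hx'.symm h6
      exact ⟨n t, x, y, hy.symm⟩
    · right
      left
      refine ⟨t, x, r, hx', ?_, by simpa using h6⟩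
      simp only [hx, List.length_append] at h2
      dsimp only
      omega

lemma few_infix {F : ℕ → ℕ} (hF : ∀ N, 1 ≤ F N) (v : List B) : Few F {w | w <:+: v} := by
  refine Few.of_param (fun _ => Finset.range (v.length + 1))
    (fun w o => ∃ l r, l ++ w ++ r = v ∧ l.length = o) ?_ ?_ ?_
  · rintro w ⟨l, r, h⟩ -
    refine ⟨l.length, Finset.mem_range.2 ?_, l, r, h, rfl⟩
    rw [← h]
    simp only [List.length_append]
    omega
  · rintro w - w' - o hl ⟨l, r, h, h'⟩ ⟨l', r', h1, h1'⟩
    rw [← h1, List.append_assoc, List.append_assoc] at h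
    exact (List.append_inj (List.append_inj h (h'.trans h1'.symm)).2 hl).1
  · refine ⟨v.length + 1, fun N hN => ?_⟩
    rw [Finset.card_range]
    exact Nat.le_mul_of_pos_right _ (Nat.mul_pos hN (hF N))

lemma win_congr {P H H' Q : ℕ → List B} (h : ∀ t, H t = H' t) : win P H Q = win P H' Q := by
  rw [funext h]

/-- The main counting estimate. -/
theorem few_win [Finite B] {L : Set (List B)} (hL : FactorClosed L) {k l : ℕ} (hl : 0 < l)
    {F : ℕ → ℕ} (hF : ∀ N, 1 ≤ F N)
    (hruns : ∀ j, 1 ≤ j → j ≤ k → ¬ HasRuns L j ∨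
      ∀ c, ∃ c', ∀ N t, 1 ≤ N → t ^ j ≤ c * N → t ≤ c' * F N) (m : ℕ) :
    ∀ (p : List (Block B)) (fin : List B) (P Q : ℕ → List B), p.length = m →
      (∀ b ∈ p, b.Good k l) → SuffNested P → PrefNested Q → Dich k P →
      (∀ t, P t ++ ((blocks p t ++ fin) ++ Q t) ∈ L) →
      Few F (win P (fun t => blocks p t ++ fin) Q) := by
  induction m with
  | zero =>
    intro p fin P Q hp _ hP hQ _ _
    obtain rfl := List.length_eq_zero_iff.1 hp
    refine (few_junction hF (hP.append_const fin) hQ fin.length).mono ?_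
    rintro w ⟨t, l, r, h1, h2, h3⟩
    refine ⟨t, l, r, by simpa using h1, ?_, ?_⟩
    · simpa using h2
    · simp only [List.length_append]
      omega
  | succ m ih =>
    intro p fin P Q hp hgood hP hQ hD hmem
    obtain ⟨b, p, rfl⟩ := List.exists_cons_of_length_eq_add_one hp
    simp only [List.length_cons, Nat.add_right_cancel_iff] at hp
    obtain ⟨hbl, j, hj1, hjk, hbn⟩ := hgood b (by simp)
    have hg : b.base ≠ [] := List.length_pos_iff.1 (hbl ▸ hl)
    have hgp : ∀ c ∈ p, c.Good k l := fun c hc => hgood c (by simp [hc])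
    have hP' := hP.append_const b.pre
    have hD' := hD.append (dich_const k b.pre)
    have hmem' : ∀ t, (P t ++ b.pre) ++ (wpow b.base (b.exp t) ++ ((blocks p t ++ fin) ++ Q t))
        ∈ L := fun t => by simpa using hmem t
    rw [win_congr (H' := fun t => b.pre ++ (wpow b.base (b.exp t) ++ (blocks p t ++ fin)))
      (fun t => by simp)]
    by_cases hleft : ∀ t, ∃ K, P t ++ b.pre <:+ wpow b.base K
    · have h1 : ∀ t, ∃ K, P t ++ (b.pre ++ wpow b.base (b.exp t)) <:+ wpow b.base K := by
        intro t
        obtain ⟨K, u, hu⟩ := hleft t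
        refine ⟨K + b.exp t, u, ?_⟩
        rw [wpow_add, ← hu]
        simp
      refine ((few_infix_wpow hF hg).union (ih p fin _ Q hp hgp
        (suffNested_of_suffix_wpow h1 ?_) hQ
        (hD.append ((dich_const k b.pre).append (dich_wpow hg hbn))) ?_)).mono
        (win_subset_of_suffix h1)
      · intro s t hst
        have h2 := (hP hst).length_le
        have h3 := Nat.mul_le_mul_right b.base.length (hbn.monotone hst)
        simp only [List.length_append, length_wpow]
        omega
      · intro t
        simpa using hmem t
    push Not at hleft
    obtain ⟨t₁, ht₁⟩ := hleft
    -- either the run merges to the right, or it is followed by a fixed obstruction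
    have hfinish : ∀ (e' : List B) (t₂ : ℕ), (∀ K, ¬ e' <+: wpow b.base K) →
        (∀ t, t₂ ≤ t → e' <+: (blocks p t ++ fin) ++ Q t) →
        Few F (win P (fun t => b.pre ++ (wpow b.base (b.exp t) ++ (blocks p t ++ fin))) Q) := by
      intro e' t₂ he' ht₂
      refine (((few_infix_wpow hF hg).union (few_junction hF hP'
        (prefNested_wpow _ hbn.monotone) _)).union (Few.union (ih p fin _ Q hp hgp
        (suffNested_wpow _ hbn.monotone) hQ (dich_wpow hg hbn) fun t => ?_) ?_)).mono win_subset
      · exact hL _ _ (List.suffix_append _ _).isInfix (hmem' t)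
      · obtain ⟨c, hc⟩ := pow_le_of_choose_le hbn.choose_le
        have hc2 : ∀ t, t ^ j ≤ c * ((wpow b.base (b.exp t)).length + 1) := fun t =>
          (hc t).trans (Nat.mul_le_mul_left _ (by
            have := le_mul_length hg (b.exp t)
            rw [length_wpow]
            omega))
        rcases hD' j hj1 hjk with hbig | ⟨c', hsmall⟩
        · have hrun := hasRuns_of_nested hj1 hg hbn hP' ht₁ he' ht₂ hbig hmem'
          obtain ⟨c', hc'⟩ := ((hruns j hj1 hjk).resolve_left (fun h => h hrun)) (2 * c)
          refine few_span_of_time hF (c := c') fun t N hN ht => hc' N t hN ((hc2 t).trans ?_)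
          rw [mul_comm 2, mul_assoc]
          exact Nat.mul_le_mul_left _ (by omega)
        · exact few_span_of_length hF hj1 hsmall hc2
    cases p with
    | nil =>
      by_cases hright : ∀ t, ∃ K, fin ++ Q t <+: wpow b.base K
      · have h1 : ∀ t, ∃ K, wpow b.base (b.exp t) ++ (fin ++ Q t) <+: wpow b.base K := by
          intro t
          obtain ⟨K, hK⟩ := hright t
          refine ⟨b.exp t + K, ?_⟩
          rw [wpow_add]
          exact (List.prefix_append_right_inj _).2 hK
        refine ((few_infix_wpow hF hg).union (few_junction hF hP'
          (prefNested_of_prefix_wpow h1 ?_) b.pre.length)).mono ?_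
        · intro s t hst
          have h2 := (hQ hst).length_le
          have h3 := Nat.mul_le_mul_right b.base.length (hbn.monotone hst)
          simp only [List.length_append, length_wpow]
          omega
        · rintro w ⟨t, l, r, h2, h3, h4⟩
          have h5 : (P t ++ b.pre) ++ (wpow b.base (b.exp t) ++ (fin ++ Q t)) = l ++ (w ++ r) := by
            rw [← h2]
            simp
          rcases le_total l.length (P t ++ b.pre).length with h6 | h6
          · right
            refine ⟨t, l, r, h5, h6, ?_⟩
            simp only [List.length_append]
            omega
          · left
            obtain ⟨x, -, hx⟩ := exists_of_append_eq_append h5 h6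
            obtain ⟨K, hK⟩ := h1 t
            refine ⟨K, List.IsInfix.trans ?_ hK.isInfix⟩
            rw [hx]
            exact ⟨x, r, by simp⟩
      · push Not at hright
        obtain ⟨t₂, ht₂⟩ := hright
        refine hfinish (fin ++ Q t₂) t₂ ht₂ fun t ht => ?_
        simpa using hQ ht
    | cons b1 p1 =>
      obtain ⟨h1l, j1, hj11, hj1k, h1n⟩ := hgp b1 (by simp)
      by_cases hc1 : b.base ++ b1.pre = b1.pre ++ b1.base
      · obtain ⟨p', fin', hlen, hg', hw'⟩ := exists_blocks_prepend (d := k) (l := l) b1.pre p1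
          fin (fun c hc => hgp c (by simp [hc]))
        have hword : ∀ t, b.pre ++ (wpow b.base (b.exp t) ++ (blocks (b1 :: p1) t ++ fin))
            = blocks (⟨b.pre, b.base, fun t => b.exp t + b1.exp t⟩ :: p') t ++ fin' := fun t => by
          have h1 := wpow_conj hc1 (b1.exp t)
          simp only [blocks_cons, wpow_add, List.append_assoc, hw']
          rw [← List.append_assoc (wpow b.base (b1.exp t)), h1]
          simp only [List.append_assoc]
        rw [win_congr hword]
        refine ih _ fin' P Q ?_ ?_ hP hQ hD fun t => ?_
        · simp only [List.length_cons] at hp ⊢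
          omega
        · intro c hc
          rcases List.mem_cons.1 hc with rfl | hc
          · exact ⟨hbl, _, le_max_of_le_left hj1, max_le hjk hj1k, hbn.add h1n⟩
          · exact hg' c hc
        · rw [← hword]
          simpa using hmem t
      · refine hfinish (b1.pre ++ b1.base) j1
          (fun K hK => hc1 (conj_of_prefix (hbl.trans h1l.symm) hK)) fun t ht => ?_
        obtain ⟨i, hi⟩ := Nat.exists_eq_add_of_le' (h1n.pos ht)
        rw [blocks_cons, hi, wpow_succ]
        simp only [List.append_assoc]
        rw [← List.append_assoc]
        exact List.prefix_append _ _

/-- The counting estimate for a tame middle part. -/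
theorem few_win_of_tame [Finite B] {L : Set (List B)} (hL : FactorClosed L) {k : ℕ}
    {F : ℕ → ℕ} (hF : ∀ N, 1 ≤ F N)
    (hruns : ∀ j, 1 ≤ j → j ≤ k → ¬ HasRuns L j ∨
      ∀ c, ∃ c', ∀ N t, 1 ≤ N → t ^ j ≤ c * N → t ≤ c' * F N)
    {P H Q : ℕ → List B} (hP : SuffNested P) (hQ : PrefNested Q)
    (hD : ∀ q r, 0 < q → Dich k (fun t => P (q * t + r))) (hH : Tame k H)
    (hmem : ∀ t, P t ++ (H t ++ Q t) ∈ L) : Few F (win P H Q) := by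
  obtain ⟨l, hl, hH⟩ := hH
  obtain ⟨q, hq, hH⟩ := hH l hl dvd_rfl
  obtain ⟨R, hR⟩ := hH q hq dvd_rfl
  have hmono : ∀ r, Monotone fun t => q * t + r := fun r s t hst => by
    dsimp only
    gcongr
  -- windows at bounded times, and windows on each residue class
  have h1 : ∀ r ∈ Finset.range q, Few F (win (fun t => P (q * t + (R + r)))
      (fun t => H (q * t + (R + r))) (fun t => Q (q * t + (R + r)))) := by
    intro r _
    obtain ⟨p, fin, hp, hW⟩ := hR (R + r) (Nat.le_add_right _ _)
    rw [win_congr hW]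
    refine few_win hL hl hF hruns _ p fin _ _ rfl hp (fun s t h => hP (hmono _ h))
      (fun s t h => hQ (hmono _ h)) (hD q _ hq) fun t => ?_
    rw [← hW]
    exact hmem _
  have h2 : ∀ t ∈ Finset.range R, Few F {w | w <:+: P t ++ (H t ++ Q t)} :=
    fun t _ => few_infix hF _
  refine ((Few.iUnion_finset _ h1).union (Few.iUnion_finset _ h2)).mono ?_
  rintro w ⟨t, l, r, h3, h4, h5⟩
  rcases lt_or_ge t R with ht | ht
  · right
    simp only [Set.mem_iUnion]
    exact ⟨t, Finset.mem_range.2 ht, l, r, by rw [h3, List.append_assoc]⟩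
  · left
    simp only [Set.mem_iUnion]
    have h6 : q * ((t - R) / q) + (R + (t - R) % q) = t := by
      have := Nat.div_add_mod (t - R) q
      omega
    refine ⟨(t - R) % q, Finset.mem_range.2 (Nat.mod_lt _ hq), (t - R) / q, l, r, ?_⟩
    simp only [h6]
    exact ⟨h3, h4, h5⟩

end FewWin

/-! ### Iterated morphisms -/

section Iterate

variable {A B : Type*} (φ : A → List A)

lemma substWord_eq_flatMap (w : List A) : substWord φ w = w.flatMap φ := by
  induction w with
  | nil => rfl
  | cons a w ih => simp [substWord, ih]

@[simp] lemma iterWord_zero (w : List A) : iterWord φ 0 w = w := rfl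

lemma iterWord_add (m n : ℕ) (w : List A) :
    iterWord φ (m + n) w = iterWord φ m (iterWord φ n w) :=
  Function.iterate_add_apply _ _ _ _

lemma iterWord_one (w : List A) : iterWord φ 1 w = w.flatMap φ := substWord_eq_flatMap φ w

lemma iterWord_succ (n : ℕ) (w : List A) : iterWord φ (n + 1) w = iterWord φ n (w.flatMap φ) := by
  rw [iterWord_add, iterWord_one]

lemma iterWord_succ_singleton (n : ℕ) (b : A) : iterWord φ (n + 1) [b] = iterWord φ n (φ b) := by
  rw [iterWord_succ]
  simp

lemma iterWord_succ' (n : ℕ) (w : List A) :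
    iterWord φ (n + 1) w = (iterWord φ n w).flatMap φ := by
  rw [Nat.add_comm, iterWord_add, iterWord_one]

@[simp] lemma iterWord_nil (n : ℕ) : iterWord φ n [] = [] := by
  induction n with
  | zero => rfl
  | succ n ih => rw [iterWord_succ', ih, List.flatMap_nil]

@[simp] lemma iterWord_append (n : ℕ) (u v : List A) :
    iterWord φ n (u ++ v) = iterWord φ n u ++ iterWord φ n v := by
  induction n with
  | zero => rfl
  | succ n ih => simp only [iterWord_succ', ih, List.flatMap_append]

lemma iterWord_cons (n : ℕ) (a : A) (w : List A) :
    iterWord φ n (a :: w) = iterWord φ n [a] ++ iterWord φ n w :=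
  iterWord_append φ n [a] w

lemma iterWord_infix {u w : List A} (h : u <:+: w) (n : ℕ) :
    iterWord φ n u <:+: iterWord φ n w := by
  obtain ⟨x, y, rfl⟩ := h
  exact ⟨iterWord φ n x, iterWord φ n y, by simp⟩

lemma singleton_infix {b : A} {w : List A} (h : b ∈ w) : [b] <:+: w := by
  obtain ⟨x, y, rfl⟩ := List.append_of_mem h
  exact ⟨x, y, by simp⟩

end Iterate

/-! ### The number of letters outside a set -/

section Count

variable {A : Type*}

open Classical in
/-- The number of letters of `w` outside `S`. -/
noncomputable def cnt (S : Set A) (w : List A) : ℕ := w.countP (fun b => b ∉ S)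

@[simp] lemma cnt_nil (S : Set A) : cnt S [] = 0 := rfl

@[simp] lemma cnt_append (S : Set A) (u v : List A) : cnt S (u ++ v) = cnt S u + cnt S v := by
  simp [cnt]

lemma cnt_cons (S : Set A) (a : A) (v : List A) : cnt S (a :: v) = cnt S [a] + cnt S v :=
  cnt_append S [a] v

lemma cnt_eq_zero {S : Set A} {w : List A} : cnt S w = 0 ↔ ∀ b ∈ w, b ∈ S := by
  simp [cnt]

lemma cnt_singleton {S : Set A} {b : A} (h : b ∉ S) : cnt S [b] = 1 := by
  simp [cnt, h]

lemma cnt_singleton_le (S : Set A) (b : A) : cnt S [b] ≤ 1 :=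
  List.countP_le_length

lemma cnt_le_length (S : Set A) (w : List A) : cnt S w ≤ w.length := List.countP_le_length

lemma cnt_pos {S : Set A} {w : List A} : 0 < cnt S w ↔ ∃ b ∈ w, b ∉ S := by
  simp [cnt]

lemma cnt_empty (w : List A) : cnt ∅ w = w.length := by
  simp [cnt]

lemma cnt_mono_infix (S : Set A) {u w : List A} (h : u <:+: w) : cnt S u ≤ cnt S w :=
  h.sublist.countP_le

/-- The set `S` is preserved by `φ`, and so is its complement up to letters of `S`. -/
structure Stable (φ : A → List A) (S : Set A) : Prop where
  closed : ∀ b ∈ S, ∀ c ∈ φ b, c ∈ S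
  exists_not_mem : ∀ b, b ∉ S → ∃ c ∈ φ b, c ∉ S

namespace Stable

variable {φ : A → List A} {S : Set A}

lemma mem_of_mem_iterWord (hS : Stable φ S) {w : List A} (h : ∀ b ∈ w, b ∈ S) (n : ℕ) :
    ∀ c ∈ iterWord φ n w, c ∈ S := by
  induction n with
  | zero => exact h
  | succ n ih =>
    intro c hc
    rw [iterWord_succ', List.mem_flatMap] at hc
    obtain ⟨b, hb, hc⟩ := hc
    exact hS.closed b (ih b hb) c hc

lemma cnt_le_cnt_flatMap (hS : Stable φ S) (w : List A) : cnt S w ≤ cnt S (w.flatMap φ) := by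
  induction w with
  | nil => simp
  | cons a w ih =>
    rw [cnt_cons, List.flatMap_cons, cnt_append]
    refine Nat.add_le_add ?_ ih
    by_cases ha : a ∈ S
    · rw [cnt_eq_zero.2 (by simpa using ha)]
      exact Nat.zero_le _
    · rw [cnt_singleton ha]
      exact cnt_pos.2 (hS.exists_not_mem a ha)

lemma cnt_le_cnt_iterWord (hS : Stable φ S) (n : ℕ) (w : List A) :
    cnt S w ≤ cnt S (iterWord φ n w) := by
  induction n with
  | zero => exact le_rfl
  | succ n ih =>
    rw [iterWord_succ']
    exact ih.trans (hS.cnt_le_cnt_flatMap _)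

lemma cnt_iterWord_mono (hS : Stable φ S) (w : List A) : Monotone fun n => cnt S (iterWord φ n w) := by
  refine monotone_nat_of_le_succ fun n => ?_
  rw [iterWord_succ']
  exact hS.cnt_le_cnt_flatMap _

lemma exists_not_mem_iterWord (hS : Stable φ S) {b : A} (hb : b ∉ S) (n : ℕ) :
    ∃ c ∈ iterWord φ n [b], c ∉ S :=
  cnt_pos.1 (lt_of_lt_of_le (by rw [cnt_singleton hb]; exact one_pos)
    (hS.cnt_le_cnt_iterWord n [b]))

end Stable

end Count

/-! ### Letters of polynomial growth -/

section Level

variable {A : Type*} (φ : A → List A)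

/-- Letters whose iterated images have bounded length up to letters of lower level. -/
def Level : ℕ → Set A
  | 0 => ∅
  | k + 1 => {b | ∃ M, ∀ t, cnt (Level k) (iterWord φ t [b]) ≤ M}

lemma exists_bound_of_forall_mem_level {k : ℕ} {w : List A} (h : ∀ b ∈ w, b ∈ Level φ (k + 1)) :
    ∃ M, ∀ t, cnt (Level φ k) (iterWord φ t w) ≤ M := by
  induction w with
  | nil => exact ⟨0, by simp⟩
  | cons a w ih =>
    obtain ⟨M, hM⟩ := ih fun b hb => h b (by simp [hb])
    obtain ⟨M', hM'⟩ := h a (by simp)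
    refine ⟨M' + M, fun t => ?_⟩
    rw [iterWord_cons, cnt_append]
    exact Nat.add_le_add (hM' t) (hM t)

variable {φ}

lemma stable_level (hφ : ∀ b, φ b ≠ []) (k : ℕ) : Stable φ (Level φ k) := by
  cases k with
  | zero =>
    refine ⟨fun b hb => hb.elim, fun b _ => ?_⟩
    obtain ⟨c, hc⟩ := List.exists_mem_of_ne_nil _ (hφ b)
    exact ⟨c, hc, fun h => h⟩
  | succ k =>
    constructor
    · rintro b ⟨M, hM⟩ c hc
      refine ⟨M, fun t => le_trans ?_ (hM (t + 1))⟩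
      rw [iterWord_succ_singleton]
      exact cnt_mono_infix _ (iterWord_infix φ (singleton_infix hc) t)
    · intro b hb
      by_contra! h
      obtain ⟨M, hM⟩ := exists_bound_of_forall_mem_level φ h
      refine hb ⟨M + 1, fun t => ?_⟩
      cases t with
      | zero => exact (cnt_singleton_le _ b).trans (Nat.le_add_left _ _)
      | succ t =>
        rw [iterWord_succ_singleton]
        exact (hM t).trans (Nat.le_succ _)

lemma level_subset_succ (hφ : ∀ b, φ b ≠ []) (k : ℕ) : Level φ k ⊆ Level φ (k + 1) :=
  fun b hb => ⟨0, fun t => (cnt_eq_zero.2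
    ((stable_level hφ k).mem_of_mem_iterWord (by simpa using hb) t)).le⟩

lemma level_monotone (hφ : ∀ b, φ b ≠ []) : Monotone (Level φ) :=
  monotone_nat_of_le_succ (level_subset_succ hφ)

lemma exists_level_eq [Finite A] (hφ : ∀ b, φ b ≠ []) :
    ∃ k, 1 ≤ k ∧ Level φ k = Level φ (k + 1) := by
  obtain ⟨n, hn⟩ := WellFoundedGT.monotone_chain_condition ⟨Level φ, level_monotone hφ⟩
  exact ⟨n + 1, by omega, (hn (n + 1) (by omega)).symm.trans (hn (n + 2) (by omega))⟩

lemma exists_two_le_cnt [Finite A] (hφ : ∀ b, φ b ≠ []) (k : ℕ) :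
    ∃ T, ∀ b, b ∉ Level φ (k + 1) → ∀ t, T ≤ t → 2 ≤ cnt (Level φ k) (iterWord φ t [b]) := by
  have h : ∀ b, ∃ T, b ∉ Level φ (k + 1) → 2 ≤ cnt (Level φ k) (iterWord φ T [b]) := by
    intro b
    by_cases hb : b ∈ Level φ (k + 1)
    · exact ⟨0, fun h => (h hb).elim⟩
    · by_contra! h
      exact hb ⟨1, fun t => Nat.le_of_lt_succ (h t).2⟩
  choose T hT using h
  obtain ⟨M, hM⟩ := Set.Finite.bddAbove (Set.finite_range T)
  exact ⟨M, fun b hb t ht => (hT b hb).trans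
    ((stable_level hφ k).cnt_iterWord_mono [b] ((hM ⟨b, rfl⟩).trans ht))⟩

lemma length_iterWord_le_of_mem {w : List A} {b : A} (hb : b ∈ w) (t : ℕ) :
    (iterWord φ t [b]).length ≤ (iterWord φ t w).length :=
  (iterWord_infix φ (singleton_infix hb) t).length_le

lemma exists_choose_le_length [Finite A] (hφ : ∀ b, φ b ≠ []) (k : ℕ) :
    ∃ h, 0 < h ∧ ∀ b, b ∉ Level φ k → ∀ m, m.choose k ≤ (iterWord φ (h * m) [b]).length := by
  induction k with
  | zero =>
    refine ⟨1, one_pos, fun b hb m => ?_⟩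
    obtain ⟨c, hc, -⟩ := (stable_level hφ 0).exists_not_mem_iterWord hb (1 * m)
    rw [Nat.choose_zero_right]
    exact List.length_pos_of_mem hc
  | succ k ih =>
    obtain ⟨h, hh, ih⟩ := ih
    obtain ⟨T, hT⟩ := exists_two_le_cnt hφ k
    refine ⟨h * (T + 1), by positivity, fun b hb m => ?_⟩
    induction m generalizing b with
    | zero => simp
    | succ m ihm =>
      obtain ⟨c, hc, hcS⟩ := (stable_level hφ (k + 1)).exists_not_mem_iterWord hb (h * (T + 1))
      have h1 := hT b hb (h * (T + 1)) (by nlinarith)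
      rw [Nat.mul_succ, iterWord_add]
      generalize iterWord φ (h * (T + 1)) [b] = w at hc h1
      obtain ⟨u, v, rfl⟩ := List.append_of_mem hc
      have h2 : 0 < cnt (Level φ k) (u ++ v) := by
        have := cnt_singleton_le (Level φ k) c
        rw [cnt_append, cnt_cons] at h1
        rw [cnt_append]
        omega
      obtain ⟨d, hd, hdS⟩ := cnt_pos.1 h2
      have h3 := ihm c hcS
      have h4 : m.choose k ≤ (iterWord φ (h * (T + 1) * m) [d]).length := by
        rw [mul_assoc]
        exact (Nat.choose_le_choose k (by nlinarith)).trans (ih d hdS _)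
      have h5 := length_iterWord_le_of_mem (φ := φ) hd (h * (T + 1) * m)
      rw [Nat.choose_succ_succ']
      rw [iterWord_append, List.length_append] at h5 ⊢
      rw [iterWord_cons, List.length_append]
      omega

lemma length_iterWord_mono (hφ : ∀ b, φ b ≠ []) (w : List A) :
    Monotone fun t => (iterWord φ t w).length := by
  have := (stable_level hφ 0).cnt_iterWord_mono w
  simpa only [Level, cnt_empty] using this

/-- Letters outside of `Level φ k` grow at least like `t ^ k`. -/
lemma exists_pow_le_length [Finite A] (hφ : ∀ b, φ b ≠ []) (k : ℕ) :
    ∃ c, ∀ b, b ∉ Level φ k → ∀ t, t ^ k ≤ c * (iterWord φ t [b]).length := by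
  obtain ⟨h, hh, hk⟩ := exists_choose_le_length hφ k
  have h1 : ∀ b, ∃ c, b ∉ Level φ k → ∀ t, t ^ k ≤ c * ((iterWord φ (h * t) [b]).length + 1) := by
    intro b
    by_cases hb : b ∈ Level φ k
    · exact ⟨0, fun h => (h hb).elim⟩
    · obtain ⟨c, hc⟩ := pow_le_of_choose_le (hk b hb)
      exact ⟨c, fun _ => hc⟩
  choose c hc using h1
  obtain ⟨M, hM⟩ := Set.Finite.bddAbove (Set.finite_range c)
  refine ⟨(2 * h) ^ k * (2 * M) + h ^ k, fun b hb t => ?_⟩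
  have h2 := length_iterWord_mono hφ [b] (Nat.mul_div_le t h)
  have h3 : 1 ≤ (iterWord φ t [b]).length := length_iterWord_mono hφ [b] (Nat.zero_le t)
  dsimp only at h2
  have h4 : t ≤ h * (t / h + 1) := (Nat.lt_mul_div_succ t hh).le
  have h5 : (t / h) ^ k ≤ M * ((iterWord φ (h * (t / h)) [b]).length + 1) :=
    (hc b hb _).trans (Nat.mul_le_mul_right _ (hM ⟨b, rfl⟩))
  have h6 : (t / h) ^ k ≤ 2 * M * (iterWord φ t [b]).length := by
    refine h5.trans ?_
    rw [mul_comm 2, mul_assoc]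
    exact Nat.mul_le_mul_left _ (by omega)
  rw [add_mul]
  rcases Nat.eq_zero_or_pos (t / h) with h0 | h0
  · rw [h0] at h4
    calc t ^ k ≤ h ^ k * 1 := by
          rw [mul_one]
          exact Nat.pow_le_pow_left (by simpa using h4) k
      _ ≤ h ^ k * (iterWord φ t [b]).length := Nat.mul_le_mul_left _ h3
      _ ≤ _ := Nat.le_add_left _ _
  · calc t ^ k ≤ (2 * h * (t / h)) ^ k := Nat.pow_le_pow_left (by nlinarith) k
      _ = (2 * h) ^ k * (t / h) ^ k := mul_pow _ _ _
      _ ≤ (2 * h) ^ k * (2 * M * (iterWord φ t [b]).length) := Nat.mul_le_mul_left _ h6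
      _ = (2 * h) ^ k * (2 * M) * (iterWord φ t [b]).length := (mul_assoc _ _ _).symm
      _ ≤ _ := Nat.le_add_right _ _

/-- If the levels stabilize then the remaining letters grow exponentially. -/
lemma exists_two_pow_le_length [Finite A] (hφ : ∀ b, φ b ≠ []) {k : ℕ}
    (hk : Level φ k = Level φ (k + 1)) :
    ∃ h, 0 < h ∧ ∀ b, b ∉ Level φ k → ∀ t, 2 ^ (t / h) ≤ (iterWord φ t [b]).length := by
  obtain ⟨T, hT⟩ := exists_two_le_cnt hφ k
  rw [← hk] at hT
  have h1 : ∀ w, 2 * cnt (Level φ k) w ≤ cnt (Level φ k) (iterWord φ (T + 1) w) := by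
    intro w
    induction w with
    | nil => simp
    | cons a w ih =>
      rw [iterWord_cons, cnt_append, cnt_cons, mul_add]
      refine Nat.add_le_add ?_ ih
      by_cases ha : a ∈ Level φ k
      · rw [cnt_eq_zero.2 (by simpa using ha)]
        exact Nat.zero_le _
      · rw [cnt_singleton ha]
        exact hT a ha _ (Nat.le_succ T)
  have h2 : ∀ m w, 2 ^ m * cnt (Level φ k) w ≤ cnt (Level φ k) (iterWord φ ((T + 1) * m) w) := by
    intro m
    induction m with
    | zero => simp
    | succ m ih =>
      intro w
      rw [Nat.mul_succ, iterWord_add, pow_succ, mul_assoc]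
      exact (Nat.mul_le_mul_left _ (h1 w)).trans (ih _)
  refine ⟨T + 1, by omega, fun b hb t => ?_⟩
  have h3 := h2 (t / (T + 1)) [b]
  rw [cnt_singleton hb, mul_one] at h3
  exact h3.trans ((cnt_le_length _ _).trans
    (length_iterWord_mono hφ [b] (Nat.mul_div_le t (T + 1))))

end Level

/-! ### Extreme letters outside of a stable set -/

section Extreme

variable {A : Type*} {φ : A → List A} {S : Set A}

lemma exists_iterate_idem_apply [Finite A] (f : A → A) :
    ∃ p, 0 < p ∧ ∀ n x, f^[p * (n + 1)] x = f^[p] x := by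
  obtain ⟨i, j, hij, h⟩ := Finite.exists_ne_map_eq_of_infinite fun n => f^[n]
  wlog hlt : i < j generalizing i j
  · exact this j i hij.symm h.symm (lt_of_le_of_ne (not_lt.1 hlt) hij.symm)
  obtain ⟨d, rfl⟩ := Nat.exists_eq_add_of_lt hlt
  have h1 : ∀ n, i ≤ n → f^[n + (d + 1)] = f^[n] := by
    intro n hn
    obtain ⟨m, rfl⟩ := Nat.exists_eq_add_of_le' hn
    rw [add_assoc, Function.iterate_add, ← add_assoc, ← h, ← Function.iterate_add]
  have h2 : ∀ m n, i ≤ n → f^[n + (d + 1) * m] = f^[n] := by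
    intro m
    induction m with
    | zero => simp
    | succ m ih =>
      intro n hn
      rw [Nat.mul_succ, ← add_assoc, h1 _ (by omega), ih n hn]
  refine ⟨(d + 1) * (i + 1), by positivity, fun n x => ?_⟩
  have h3 := h2 ((i + 1) * n) ((d + 1) * (i + 1)) (by nlinarith)
  rw [← mul_assoc, add_comm, ← Nat.mul_succ] at h3
  rw [h3]

/-- Some positive iterate of every self-map of a finite type is idempotent. -/
lemma exists_iterate_idem (A : Type*) [Finite A] :
    ∃ p, 0 < p ∧ ∀ (f : A → A) x, f^[p] (f^[p] x) = f^[p] x := by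
  have := Fintype.ofFinite (A → A)
  choose p hp h using fun f : A → A => exists_iterate_idem_apply f
  refine ⟨∏ f, p f, Finset.prod_pos fun f _ => hp f, fun f x => ?_⟩
  obtain ⟨m, hm⟩ := Finset.dvd_prod_of_mem p (Finset.mem_univ f)
  have hm0 : 0 < m := by
    refine Nat.pos_of_ne_zero fun h0 => ?_
    rw [h0, mul_zero] at hm
    exact (Finset.prod_pos fun f _ => hp f).ne' hm
  obtain ⟨m, rfl⟩ := Nat.exists_eq_add_of_le' hm0
  rw [hm, ← Function.iterate_add_apply, ← mul_add,
    show m + 1 + (m + 1) = (m + 1 + m) + 1 by omega, h, h]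

lemma exists_last_not_mem {w : List A} (h : ∃ c ∈ w, c ∉ S) :
    ∃ u z v, w = u ++ z :: v ∧ z ∉ S ∧ ∀ c ∈ v, c ∈ S := by
  induction w with
  | nil => simp at h
  | cons a w ih =>
    by_cases hw : ∃ c ∈ w, c ∉ S
    · obtain ⟨u, z, v, rfl, hz, hv⟩ := ih hw
      exact ⟨a :: u, z, v, rfl, hz, hv⟩
    · push Not at hw
      obtain ⟨c, hc, hcS⟩ := h
      rcases List.mem_cons.1 hc with rfl | hc
      · exact ⟨[], c, w, rfl, hcS, hw⟩
      · exact (hcS (hw c hc)).elim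

lemma exists_first_not_mem {w : List A} (h : ∃ c ∈ w, c ∉ S) :
    ∃ u z v, w = u ++ z :: v ∧ z ∉ S ∧ ∀ c ∈ u, c ∈ S := by
  obtain ⟨u, z, v, h1, h2, h3⟩ := exists_last_not_mem (w := w.reverse) (by simpa using h)
  refine ⟨v.reverse, z, u.reverse, ?_, h2, by simpa using h3⟩
  rw [← List.reverse_reverse w, h1]
  simp

/-- Following the last letter outside of `S`, one reaches a letter which reproduces itself. -/
lemma Stable.exists_last (hS : Stable φ S) {p : ℕ}
    (hp : ∀ (f : A → A) x, f^[p] (f^[p] x) = f^[p] x) {x : A} (hx : x ∉ S) :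
    ∃ z u v u' v', z ∉ S ∧ iterWord φ p [x] = u' ++ z :: v' ∧ iterWord φ p [z] = u ++ z :: v ∧
      (∀ c ∈ v, c ∈ S) ∧ ∀ c ∈ v', c ∈ S := by
  have h : ∀ x, ∃ z, x ∉ S → z ∉ S ∧ ∃ u v, φ x = u ++ z :: v ∧ ∀ c ∈ v, c ∈ S := by
    intro x
    by_cases hx : x ∈ S
    · exact ⟨x, fun h => (h hx).elim⟩
    · obtain ⟨u, z, v, h1, h2, h3⟩ := exists_last_not_mem (hS.exists_not_mem x hx)
      exact ⟨z, fun _ => ⟨h2, u, v, h1, h3⟩⟩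
  choose f hf using h
  have h1 : ∀ n x, x ∉ S → f^[n] x ∉ S ∧ ∃ u v, iterWord φ n [x] = u ++ f^[n] x :: v ∧
      ∀ c ∈ v, c ∈ S := by
    intro n
    induction n with
    | zero => exact fun x hx => ⟨hx, [], [], rfl, by simp⟩
    | succ n ih =>
      intro x hx
      obtain ⟨h2, u, v, h3, h4⟩ := hf x hx
      obtain ⟨h5, u', v', h6, h7⟩ := ih (f x) h2
      refine ⟨h5, iterWord φ n u ++ u', v' ++ iterWord φ n v, ?_, fun c hc => ?_⟩
      · rw [iterWord_succ_singleton, h3, iterWord_append, iterWord_cons, h6,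
          Function.iterate_succ_apply]
        simp
      · rcases List.mem_append.1 hc with hc | hc
        · exact h7 c hc
        · exact hS.mem_of_mem_iterWord h4 n c hc
  obtain ⟨h2, u', v', h3, h4⟩ := h1 p x hx
  obtain ⟨-, u, v, h5, h6⟩ := h1 p _ h2
  rw [hp] at h5
  exact ⟨_, u, v, u', v', h2, h3, h5, h6, h4⟩

/-- Following the first letter outside of `S`, one reaches a letter which reproduces itself. -/
lemma Stable.exists_first (hS : Stable φ S) {p : ℕ}
    (hp : ∀ (f : A → A) x, f^[p] (f^[p] x) = f^[p] x) {x : A} (hx : x ∉ S) :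
    ∃ z u v u' v', z ∉ S ∧ iterWord φ p [x] = u' ++ z :: v' ∧ iterWord φ p [z] = u ++ z :: v ∧
      (∀ c ∈ u, c ∈ S) ∧ ∀ c ∈ u', c ∈ S := by
  have h : ∀ x, ∃ z, x ∉ S → z ∉ S ∧ ∃ u v, φ x = u ++ z :: v ∧ ∀ c ∈ u, c ∈ S := by
    intro x
    by_cases hx : x ∈ S
    · exact ⟨x, fun h => (h hx).elim⟩
    · obtain ⟨u, z, v, h1, h2, h3⟩ := exists_first_not_mem (hS.exists_not_mem x hx)
      exact ⟨z, fun _ => ⟨h2, u, v, h1, h3⟩⟩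
  choose f hf using h
  have h1 : ∀ n x, x ∉ S → f^[n] x ∉ S ∧ ∃ u v, iterWord φ n [x] = u ++ f^[n] x :: v ∧
      ∀ c ∈ u, c ∈ S := by
    intro n
    induction n with
    | zero => exact fun x hx => ⟨hx, [], [], rfl, by simp⟩
    | succ n ih =>
      intro x hx
      obtain ⟨h2, u, v, h3, h4⟩ := hf x hx
      obtain ⟨h5, u', v', h6, h7⟩ := ih (f x) h2
      refine ⟨h5, iterWord φ n u ++ u', v' ++ iterWord φ n v, ?_, fun c hc => ?_⟩
      · rw [iterWord_succ_singleton, h3, iterWord_append, iterWord_cons, h6,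
          Function.iterate_succ_apply]
        simp
      · rcases List.mem_append.1 hc with hc | hc
        · exact hS.mem_of_mem_iterWord h4 n c hc
        · exact h7 c hc
  obtain ⟨h2, u', v', h3, h4⟩ := h1 p x hx
  obtain ⟨-, u, v, h5, h6⟩ := h1 p _ h2
  rw [hp] at h5
  exact ⟨_, u, v, u', v', h2, h3, h5, h6, h4⟩

end Extreme

/-! ### Images of iterates -/

section Img

variable {A B : Type*} (φ : A → List A) (ρ : A → List B)

/-- The image under `ρ` of the `t`-th iterate of `φ`. -/
def img (t : ℕ) (w : List A) : List B := (iterWord φ t w).flatMap ρ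

@[simp] lemma img_nil (t : ℕ) : img φ ρ t [] = [] := by simp [img]

@[simp] lemma img_append (t : ℕ) (u v : List A) :
    img φ ρ t (u ++ v) = img φ ρ t u ++ img φ ρ t v := by simp [img]

lemma img_cons (t : ℕ) (a : A) (v : List A) :
    img φ ρ t (a :: v) = img φ ρ t [a] ++ img φ ρ t v := img_append φ ρ t [a] v

lemma img_add (s t : ℕ) (w : List A) : img φ ρ (s + t) w = img φ ρ s (iterWord φ t w) := by
  rw [img, img, iterWord_add]

lemma img_eq_flatMap (t : ℕ) (w : List A) :
    img φ ρ t w = w.flatMap fun b => img φ ρ t [b] := by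
  induction w with
  | nil => simp
  | cons a w ih => rw [img_cons, ih, List.flatMap_cons]

lemma img_infix {u w : List A} (h : u <:+: w) (t : ℕ) : img φ ρ t u <:+: img φ ρ t w := by
  obtain ⟨x, y, rfl⟩ := h
  exact ⟨img φ ρ t x, img φ ρ t y, by simp⟩

variable {φ ρ}

lemma length_iterWord_le_length_img (hρ : ∀ b, ρ b ≠ []) (t : ℕ) (w : List A) :
    (iterWord φ t w).length ≤ (img φ ρ t w).length := by
  rw [img]
  generalize iterWord φ t w = w
  induction w with
  | nil => simp
  | cons a w ih =>
    have := List.length_pos_iff.2 (hρ a)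
    simp only [List.flatMap_cons, List.length_append, List.length_cons]
    omega

lemma length_img_le_of_mem {w : List A} {b : A} (hb : b ∈ w) (t : ℕ) :
    (img φ ρ t [b]).length ≤ (img φ ρ t w).length :=
  (img_infix φ ρ (singleton_infix hb) t).length_le

/-- The iterates of a letter which reproduces itself. -/
lemma img_of_reproduce {p : ℕ} {z : A} {u v : List A} (h : iterWord φ p [z] = u ++ z :: v)
    (r t : ℕ) : img φ ρ (p * t + r) [z] = wprodRev (fun i => img φ ρ (p * i + r) u) t ++
      (img φ ρ r [z] ++ wprod (fun i => img φ ρ (p * i + r) v) t) := by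
  induction t with
  | zero => simp
  | succ t ih =>
    rw [show p * (t + 1) + r = p * t + r + p by ring, img_add, h, img_append, img_cons, ih,
      wprodRev_succ, wprod_succ]
    simp

/-- The iterates of a letter which produces a letter which reproduces itself. -/
lemma img_of_produce {p : ℕ} {x z : A} {u' v' : List A} (h : iterWord φ p [x] = u' ++ z :: v')
    (r t : ℕ) : img φ ρ (p * t + (p + r)) [x] =
      img φ ρ (p * t + r) u' ++ (img φ ρ (p * t + r) [z] ++ img φ ρ (p * t + r) v') := by
  rw [show p * t + (p + r) = p * t + r + p by ring, img_add, h, img_append, img_cons]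

end Img

/-! ### Tameness of letters of polynomial growth -/

section TameLevel

variable {A B : Type*} {φ : A → List A} {ρ : A → List B} {L : Set (List B)}

/-- Words over `S` have tame iterates and tame products of iterates, of degree `k`. -/
structure TameOn (φ : A → List A) (ρ : A → List B) (L : Set (List B)) (S : Set A) (k : ℕ) :
    Prop where
  iterates : ∀ v : List A, (∀ c ∈ v, c ∈ S) → Tame k (fun t => img φ ρ t v)
  prod : ∀ v : List A, (∀ c ∈ v, c ∈ S) → ∀ p r, 0 < p →
    (∀ t, wprod (fun i => img φ ρ (p * i + r) v) t ∈ L) →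
    Tame k (wprod fun i => img φ ρ (p * i + r) v)
  prodRev : ∀ v : List A, (∀ c ∈ v, c ∈ S) → ∀ p r, 0 < p →
    (∀ t, wprodRev (fun i => img φ ρ (p * i + r) v) t ∈ L) →
    Tame k (wprodRev fun i => img φ ρ (p * i + r) v)

lemma TameOn.tame_core [Finite A] (hL : FactorClosed L) (hmem : ∀ b t, img φ ρ t [b] ∈ L)
    {S : Set A} {k : ℕ} (hS : Stable φ S) (hT : TameOn φ ρ L S k) {x : A} (hx : x ∉ S)
    (hx1 : ∀ t, cnt S (iterWord φ t [x]) ≤ 1) : Tame k (fun t => img φ ρ t [x]) := by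
  obtain ⟨p, hp, hidem⟩ := exists_iterate_idem A
  obtain ⟨z, u, v, u', v', hz, h1, h2, hv, hv'⟩ := hS.exists_last hidem hx
  have hu' : ∀ c ∈ u', c ∈ S := by
    rw [← cnt_eq_zero]
    have := hx1 p
    rw [h1, cnt_append, cnt_cons, cnt_singleton hz] at this
    omega
  have hu : ∀ c ∈ u, c ∈ S := by
    rw [← cnt_eq_zero]
    have := hx1 (p + p)
    rw [iterWord_add, h1, iterWord_append, iterWord_cons, h2, cnt_append, cnt_append, cnt_append,
      cnt_cons, cnt_singleton hz] at this
    omega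
  refine Tame.of_residues hp p fun r _ => ?_
  have h3 : ∀ t, img φ ρ (p * t + (p + r)) [x] = img φ ρ (p * t + r) u' ++
      ((wprodRev (fun i => img φ ρ (p * i + r) u) t ++
        (img φ ρ r [z] ++ wprod (fun i => img φ ρ (p * i + r) v) t)) ++
        img φ ρ (p * t + r) v') := by
    intro t
    rw [img_of_produce h1, img_of_reproduce h2]
  rw [funext h3]
  refine ((hT.iterates u' hu').subsample hp r).append (((hT.prodRev u hu p r hp fun t => ?_).append
    ((Tame.const k _).append (hT.prod v hv p r hp fun t => ?_))).append
    ((hT.iterates v' hv').subsample hp r))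
  · refine hL _ _ ?_ (hmem z (p * t + r))
    rw [img_of_reproduce h2]
    exact (List.prefix_append _ _).isInfix
  · refine hL _ _ ?_ (hmem z (p * t + r))
    rw [img_of_reproduce h2, ← List.append_assoc]
    exact (List.suffix_append _ _).isInfix

lemma exists_cnt_max {S : Set A} {b : A} (h : ∃ M, ∀ t, cnt S (iterWord φ t [b]) ≤ M) :
    ∃ t₀, ∀ t, cnt S (iterWord φ t [b]) ≤ cnt S (iterWord φ t₀ [b]) := by
  obtain ⟨M, hM⟩ := h
  have hb : BddAbove (Set.range fun t => cnt S (iterWord φ t [b])) :=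
    ⟨M, by rintro _ ⟨t, rfl⟩; exact hM t⟩
  obtain ⟨t₀, ht₀⟩ := Nat.sSup_mem (Set.range_nonempty _) hb
  refine ⟨t₀, fun t => ?_⟩
  dsimp only at ht₀
  rw [ht₀]
  exact le_csSup hb ⟨t, rfl⟩

lemma TameOn.tame_letter [Finite A] (hL : FactorClosed L) (hmem : ∀ b t, img φ ρ t [b] ∈ L)
    {S : Set A} {k : ℕ} (hS : Stable φ S) (hT : TameOn φ ρ L S k) {b : A}
    (hb : ∃ M, ∀ t, cnt S (iterWord φ t [b]) ≤ M) : Tame k (fun t => img φ ρ t [b]) := by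
  obtain ⟨t₀, ht₀⟩ := exists_cnt_max hb
  refine Tame.of_shift t₀ ?_
  simp only [img_add]
  rw [funext fun t => img_eq_flatMap φ ρ t (iterWord φ t₀ [b])]
  refine Tame.flatMap _ fun c hc => ?_
  by_cases hcS : c ∈ S
  · exact hT.iterates [c] (by simpa using hcS)
  · refine hT.tame_core hL hmem hS hcS fun t => ?_
    have h1 := ht₀ (t + t₀)
    rw [iterWord_add] at h1
    obtain ⟨x, y, hxy⟩ := List.append_of_mem hc
    rw [hxy, iterWord_append, iterWord_cons, cnt_append, cnt_append, cnt_append, cnt_cons,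
      cnt_singleton hcS] at h1
    have h2 := hS.cnt_le_cnt_iterWord t x
    have h3 := hS.cnt_le_cnt_iterWord t y
    omega

/-- Without long runs, letters of level `k` are tame. -/
theorem tameOn_level [Finite A] (hφ : ∀ b, φ b ≠ []) (hL : FactorClosed L)
    (hmem : ∀ b t, img φ ρ t [b] ∈ L) (k : ℕ)
    (hno : ∀ j, 1 ≤ j → j < k → ¬ HasRunsBoth L j) : TameOn φ ρ L (Level φ k) k := by
  induction k with
  | zero =>
    have h : ∀ v : List A, (∀ c ∈ v, c ∈ Level φ 0) → v = [] :=
      fun v hv => List.eq_nil_iff_forall_not_mem.2 fun c hc => hv c hc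
    have h0 : ∀ t, wprod (fun _ => ([] : List B)) t = [] := fun t => by
      induction t with
      | zero => rfl
      | succ t ih => simp [wprod_succ, ih]
    have h0' : ∀ t, wprodRev (fun _ => ([] : List B)) t = [] := fun t => by
      induction t with
      | zero => rfl
      | succ t ih => simp [wprodRev_succ, ih]
    constructor
    · rintro v hv
      obtain rfl := h v hv
      simpa using Tame.const 0 []
    · rintro v hv p r - -
      obtain rfl := h v hv
      simp only [img_nil, funext h0]
      exact Tame.const 0 []
    · rintro v hv p r - -
      obtain rfl := h v hv
      simp only [img_nil, funext h0']
      exact Tame.const 0 []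
  | succ k ih =>
    have hT := ih fun j h1 h2 => hno j h1 (by omega)
    have h : ∀ v : List A, (∀ c ∈ v, c ∈ Level φ (k + 1)) → Tame k (fun t => img φ ρ t v) := by
      intro v hv
      rw [funext fun t => img_eq_flatMap φ ρ t v]
      exact Tame.flatMap _ fun c hc => hT.tame_letter hL hmem (stable_level hφ k) (hv c hc)
    exact ⟨fun v hv => (h v hv).mono (Nat.le_succ k),
      fun v hv p r hp hm =>
        tame_wprod hL (fun j h1 h2 => hno j h1 (by omega)) ((h v hv).subsample hp r) hm,
      fun v hv p r hp hm =>
        tame_wprodRev hL (fun j h1 h2 => hno j h1 (by omega)) ((h v hv).subsample hp r) hm⟩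

end TameLevel

/-! ### Windows of iterates -/

section Upper

variable {A B : Type*} {φ : A → List A} {ρ : A → List B} {L : Set (List B)}

lemma prefix_flatMap {g : A → List B} {l : List A} {w : List B} (h : w <+: l.flatMap g) :
    w = [] ∨ ∃ E y w₂, E ++ [y] <+: l ∧ w₂ <+: g y ∧ w = E.flatMap g ++ w₂ := by
  induction l generalizing w with
  | nil => exact Or.inl (by simpa using h)
  | cons a l ih =>
    right
    rw [List.flatMap_cons] at h
    rcases le_total w.length (g a).length with h1 | h1
    · exact ⟨[], a, w, ⟨l, rfl⟩, List.prefix_of_prefix_length_le h (List.prefix_append _ _) h1, rfl⟩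
    · obtain ⟨w', rfl⟩ := List.prefix_of_prefix_length_le (List.prefix_append _ _) h h1
      rw [List.prefix_append_right_inj] at h
      rcases ih h with rfl | ⟨E, y, w₂, h2, h3, rfl⟩
      · exact ⟨[], a, g a, ⟨l, rfl⟩, List.prefix_rfl, by simp⟩
      · exact ⟨a :: E, y, w₂, by simpa using h2, h3, by simp⟩

/-- A factor of a concatenation is a factor of one of the words or spans several of them. -/
lemma infix_flatMap {g : A → List B} {l : List A} {w : List B} (h : w <:+: l.flatMap g) :
    w = [] ∨ (∃ c ∈ l, w <:+: g c) ∨ ∃ x E y w₁ w₂, x :: (E ++ [y]) <:+: l ∧ w₁ <:+ g x ∧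
      w₂ <+: g y ∧ w = w₁ ++ (E.flatMap g ++ w₂) := by
  induction l with
  | nil => exact Or.inl (by simpa using h)
  | cons a l ih =>
    rw [List.flatMap_cons, List.infix_append_iff] at h
    rcases h with h | h | ⟨w₁, w', rfl, h1, h2⟩
    · exact Or.inr (Or.inl ⟨a, by simp, h⟩)
    · rcases ih h with h | ⟨c, hc, h⟩ | ⟨x, E, y, w₁, w₂, h1, h2⟩
      · exact Or.inl h
      · exact Or.inr (Or.inl ⟨c, by simp [hc], h⟩)
      · exact Or.inr (Or.inr ⟨x, E, y, w₁, w₂, h1.trans (List.suffix_cons a l).isInfix, h2⟩)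
    · rcases prefix_flatMap h2 with rfl | ⟨E, y, w₂, h3, h4, rfl⟩
      · exact Or.inr (Or.inl ⟨a, by simp, by simpa using h1.isInfix⟩)
      · exact Or.inr (Or.inr ⟨a, E, y, w₁, w₂,
          ((List.prefix_cons_inj a).2 h3).isInfix, h1, h4, rfl⟩)

lemma suffNested_wprodRev (U : ℕ → List B) : SuffNested (wprodRev U) := by
  intro s t hst
  induction t, hst using Nat.le_induction with
  | base => exact List.suffix_rfl
  | succ t _ ih =>
    rw [wprodRev_succ]
    exact ih.trans (List.suffix_append _ _)

lemma prefNested_wprod (U : ℕ → List B) : PrefNested (wprod U) := by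
  intro s t hst
  induction t, hst using Nat.le_induction with
  | base => exact List.prefix_rfl
  | succ t _ ih =>
    rw [wprod_succ]
    exact ih.trans (List.prefix_append _ _)

lemma dich_of_pow_le {k : ℕ} {P : ℕ → List B} {c : ℕ} (h : ∀ t, t ^ k ≤ c * ((P t).length + 1))
    {q : ℕ} (hq : 0 < q) (r : ℕ) : Dich k (fun t => P (q * t + r)) := by
  intro j h1 h2
  left
  refine ⟨c, fun t => ?_⟩
  rcases Nat.eq_zero_or_pos t with rfl | ht
  · rw [zero_pow (by omega)]
    exact Nat.zero_le _
  · have h3 : t ≤ q * t + r := by nlinarith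
    exact (Nat.pow_le_pow_right ht h2).trans ((Nat.pow_le_pow_left h3 k).trans (h _))

lemma exists_pow_le_wprodRev {k c p r : ℕ} (hp : 0 < p) {e : A} {u : List A} (he : e ∈ u)
    (h : ∀ t, t ^ k ≤ c * (img φ ρ t [e]).length) :
    ∃ c', ∀ t, t ^ k ≤ c' * ((wprodRev (fun i => img φ ρ (p * i + r) u) t).length + 1) := by
  refine ⟨2 ^ k * (c + 1), fun t => ?_⟩
  have h0 : 1 ≤ 2 ^ k := Nat.one_le_two_pow
  rcases t with _ | i
  · have : 0 ^ k ≤ 1 ^ k := Nat.pow_le_pow_left (Nat.zero_le 1) k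
    rw [one_pow] at this
    refine this.trans ?_
    have : 1 * 1 ≤ 2 ^ k * (c + 1) := Nat.mul_le_mul h0 (by omega)
    simpa using this
  · rw [wprodRev_succ, List.length_append]
    have h1 := length_img_le_of_mem (φ := φ) (ρ := ρ) he (p * i + r)
    set X := (img φ ρ (p * i + r) u).length with hX
    set Y := (wprodRev (fun i => img φ ρ (p * i + r) u) i).length
    have h2 : i ^ k ≤ c * X := (Nat.pow_le_pow_left (show i ≤ p * i + r by nlinarith) k).trans
      ((h _).trans (Nat.mul_le_mul_left _ h1))
    have h3 : (i + 1) ^ k ≤ 2 ^ k * (i ^ k + 1) := by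
      rcases Nat.eq_zero_or_pos i with rfl | hi
      · rw [zero_add, one_pow]
        exact Nat.mul_pos (by omega) (Nat.succ_pos _)
      · calc (i + 1) ^ k ≤ (2 * i) ^ k := Nat.pow_le_pow_left (by omega) k
          _ = 2 ^ k * i ^ k := mul_pow _ _ _
          _ ≤ _ := Nat.mul_le_mul_left _ (Nat.le_succ _)
    refine h3.trans ?_
    rw [mul_assoc]
    refine Nat.mul_le_mul_left _ ?_
    nlinarith [Nat.zero_le (c * Y)]

variable {F : ℕ → ℕ} {k : ℕ} {S : Set A} {p : ℕ}

/-- Short suffixes of iterates of a letter are suffixes of a nested sequence followed by a tame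
sequence. -/
lemma exists_left (hF : ∀ N, 1 ≤ F N) (hL : FactorClosed L) (hmem : ∀ b t, img φ ρ t [b] ∈ L)
    (hS : Stable φ S) (hT : TameOn φ ρ L S k)
    (hpow : ∃ c, ∀ b, b ∉ S → ∀ t, t ^ k ≤ c * (img φ ρ t [b]).length)
    (htime : ∃ c, ∀ b, b ∉ S → ∀ t N, 1 ≤ N → (img φ ρ t [b]).length ≤ N → t ≤ c * F N)
    (hp : 0 < p) (hidem : ∀ (f : A → A) x, f^[p] (f^[p] x) = f^[p] x) (x : A) :
    ∃ c, ∀ r, ∃ P H : ℕ → List B, SuffNested P ∧ (∀ q r, 0 < q → Dich k (fun t => P (q * t + r))) ∧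
      Tame k H ∧ (∀ t, P t ++ H t <:+ img φ ρ (p * t + (p + r)) [x]) ∧
      ∀ t w N, 1 ≤ N → w <:+ img φ ρ (p * t + (p + r)) [x] → w.length ≤ N →
        w <:+ P t ++ H t ∨ p * t + (p + r) ≤ c * F N := by
  by_cases hx : x ∈ S
  · exact ⟨0, fun r => ⟨fun _ => [], fun t => img φ ρ (p * t + (p + r)) [x],
      fun _ _ _ => List.suffix_rfl, fun _ _ _ => dich_const k [],
      (hT.iterates [x] (by simpa using hx)).subsample hp _, fun t => by simp,
      fun t w N _ hw _ => Or.inl (by simpa using hw)⟩⟩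
  obtain ⟨c, hc⟩ := htime
  obtain ⟨z, u, v, u', v', hz, h1, h2, hv, hv'⟩ := hS.exists_last hidem hx
  refine ⟨c + p, fun r => ?_⟩
  set U := wprodRev fun i => img φ ρ (p * i + r) u with hU
  set V := wprod fun i => img φ ρ (p * i + r) v with hV
  have hx' : ∀ t, img φ ρ (p * t + (p + r)) [x] =
      img φ ρ (p * t + r) u' ++ (img φ ρ (p * t + r) [z] ++ img φ ρ (p * t + r) v') :=
    img_of_produce h1 r
  have hz' : ∀ t, img φ ρ (p * t + r) [z] = U t ++ (img φ ρ r [z] ++ V t) := img_of_reproduce h2 r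
  have hVt : Tame k V := hT.prod v hv p r hp fun t => hL _ _
    (by rw [hz', ← List.append_assoc]; exact (List.suffix_append _ _).isInfix) (hmem z (p * t + r))
  have hvt := (hT.iterates v' hv').subsample hp r
  have hend : ∀ t w N, 1 ≤ N → w <:+ img φ ρ (p * t + (p + r)) [x] → w.length ≤ N →
      w <:+ U t ++ (img φ ρ r [z] ++ (V t ++ img φ ρ (p * t + r) v')) ∨
        p * t + (p + r) ≤ (c + p) * F N := by
    intro t w N hN hw hwN
    have h3 : U t ++ (img φ ρ r [z] ++ (V t ++ img φ ρ (p * t + r) v')) =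
        img φ ρ (p * t + r) [z] ++ img φ ρ (p * t + r) v' := by
      rw [hz']
      simp
    rw [hx'] at hw
    rw [h3]
    rcases le_total w.length (img φ ρ (p * t + r) [z] ++ img φ ρ (p * t + r) v').length with h | h
    · exact Or.inl (List.suffix_of_suffix_length_le hw (List.suffix_append _ _) h)
    · right
      rw [List.length_append] at h
      have h4 := hc z hz (p * t + r) N hN (by omega)
      have h5 : p * 1 ≤ p * F N := Nat.mul_le_mul_left _ (hF N)
      rw [add_mul]
      omega
  have hsuff : ∀ t, U t ++ (img φ ρ r [z] ++ (V t ++ img φ ρ (p * t + r) v')) <:+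
      img φ ρ (p * t + (p + r)) [x] := by
    intro t
    refine ⟨img φ ρ (p * t + r) u', ?_⟩
    rw [hx', hz']
    simp
  by_cases hu : ∀ b ∈ u, b ∈ S
  · refine ⟨fun _ => [], fun t => U t ++ (img φ ρ r [z] ++ (V t ++ img φ ρ (p * t + r) v')),
      fun _ _ _ => List.suffix_rfl, fun _ _ _ => dich_const k [], ?_, hsuff, hend⟩
    refine Tame.append (hT.prodRev u hu p r hp fun t => hL _ _ ?_ (hmem z (p * t + r)))
      ((Tame.const k _).append (hVt.append hvt))
    rw [hz']
    exact (List.prefix_append _ _).isInfix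
  · push Not at hu
    obtain ⟨e, he, heS⟩ := hu
    obtain ⟨c₁, hc₁⟩ := hpow
    obtain ⟨c₂, hc₂⟩ := exists_pow_le_wprodRev (φ := φ) (ρ := ρ) (r := r) hp he (hc₁ e heS)
    exact ⟨U, fun t => img φ ρ r [z] ++ (V t ++ img φ ρ (p * t + r) v'), suffNested_wprodRev _,
      fun q r' hq => dich_of_pow_le hc₂ hq r', (Tame.const k _).append (hVt.append hvt),
      hsuff, hend⟩

/-- Short prefixes of iterates of a letter are prefixes of a tame sequence followed by a nested
sequence. -/
lemma exists_right (hF : ∀ N, 1 ≤ F N) (hL : FactorClosed L) (hmem : ∀ b t, img φ ρ t [b] ∈ L)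
    (hS : Stable φ S) (hT : TameOn φ ρ L S k)
    (htime : ∃ c, ∀ b, b ∉ S → ∀ t N, 1 ≤ N → (img φ ρ t [b]).length ≤ N → t ≤ c * F N)
    (hp : 0 < p) (hidem : ∀ (f : A → A) x, f^[p] (f^[p] x) = f^[p] x) (x : A) :
    ∃ c, ∀ r, ∃ H Q : ℕ → List B, PrefNested Q ∧
      Tame k H ∧ (∀ t, H t ++ Q t <+: img φ ρ (p * t + (p + r)) [x]) ∧
      ∀ t w N, 1 ≤ N → w <+: img φ ρ (p * t + (p + r)) [x] → w.length ≤ N →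
        w <+: H t ++ Q t ∨ p * t + (p + r) ≤ c * F N := by
  by_cases hx : x ∈ S
  · exact ⟨0, fun r => ⟨fun t => img φ ρ (p * t + (p + r)) [x], fun _ => [],
      fun _ _ _ => List.prefix_rfl,
      (hT.iterates [x] (by simpa using hx)).subsample hp _, fun t => by simp,
      fun t w N _ hw _ => Or.inl (by simpa using hw)⟩⟩
  obtain ⟨c, hc⟩ := htime
  obtain ⟨z, u, v, u', v', hz, h1, h2, hu, hu'⟩ := hS.exists_first hidem hx
  refine ⟨c + p, fun r => ?_⟩
  set U := wprodRev fun i => img φ ρ (p * i + r) u with hU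
  set V := wprod fun i => img φ ρ (p * i + r) v with hV
  have hx' : ∀ t, img φ ρ (p * t + (p + r)) [x] =
      img φ ρ (p * t + r) u' ++ (img φ ρ (p * t + r) [z] ++ img φ ρ (p * t + r) v') :=
    img_of_produce h1 r
  have hz' : ∀ t, img φ ρ (p * t + r) [z] = U t ++ (img φ ρ r [z] ++ V t) := img_of_reproduce h2 r
  have hUt : Tame k U := hT.prodRev u hu p r hp fun t => hL _ _
    (by rw [hz']; exact (List.prefix_append _ _).isInfix) (hmem z (p * t + r))
  have heq : ∀ t, img φ ρ (p * t + r) u' ++ (U t ++ img φ ρ r [z]) ++ V t =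
      img φ ρ (p * t + r) u' ++ img φ ρ (p * t + r) [z] := by
    intro t
    rw [hz']
    simp
  refine ⟨fun t => img φ ρ (p * t + r) u' ++ (U t ++ img φ ρ r [z]), V, prefNested_wprod _,
    ((hT.iterates u' hu').subsample hp r).append (hUt.append (Tame.const k _)), fun t => ?_, ?_⟩
  · rw [heq, hx', ← List.append_assoc]
    exact List.prefix_append _ _
  · intro t w N hN hw hwN
    rw [heq]
    rw [hx', ← List.append_assoc] at hw
    rcases le_total w.length (img φ ρ (p * t + r) u' ++ img φ ρ (p * t + r) [z]).length with h | h
    · exact Or.inl (List.prefix_of_prefix_length_le hw (List.prefix_append _ _) h)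
    · right
      rw [List.length_append] at h
      have h4 := hc z hz (p * t + r) N hN (by omega)
      have h5 : p * 1 ≤ p * F N := Nat.mul_le_mul_left _ (hF N)
      rw [add_mul]
      omega

/-- Factors of iterates of `x :: (E ++ [y])` covering the iterate of `E`. -/
def cut (φ : A → List A) (ρ : A → List B) (x : A) (E : List A) (y : A) : Set (List B) :=
  {w | ∃ s w₁ w₂, w₁ <:+ img φ ρ s [x] ∧ w₂ <+: img φ ρ s [y] ∧ w = w₁ ++ (img φ ρ s E ++ w₂)}

lemma mem_timed_of_cut {x y : A} {E : List A} {s c : ℕ} {w₁ w₂ : List B}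
    (h1 : w₁ <:+ img φ ρ s [x]) (h2 : w₂ <+: img φ ρ s [y])
    (h : 1 ≤ (w₁ ++ (img φ ρ s E ++ w₂)).length →
      s ≤ c * F (w₁ ++ (img φ ρ s E ++ w₂)).length) :
    w₁ ++ (img φ ρ s E ++ w₂) ∈
      timed F c (fun s => img φ ρ s [x]) (fun s => img φ ρ s (E ++ [y])) := by
  obtain ⟨l, hl⟩ := h1
  obtain ⟨r, hr⟩ := h2
  refine ⟨s, l, r, ?_, ?_, ?_, h⟩
  · simp only [img_append, ← hl, ← hr, List.append_assoc]
  · simp only [← hl, List.length_append]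
    omega
  · simp only [← hl, List.length_append]
    omega

lemma few_cut [Finite A] [Finite B] (hF : ∀ N, 1 ≤ F N) (hL : FactorClosed L)
    (hmem : ∀ b t, img φ ρ t [b] ∈ L) (hS : Stable φ S) (hT : TameOn φ ρ L S k)
    (hpow : ∃ c, ∀ b, b ∉ S → ∀ t, t ^ k ≤ c * (img φ ρ t [b]).length)
    (htime : ∃ c, ∀ b, b ∉ S → ∀ t N, 1 ≤ N → (img φ ρ t [b]).length ≤ N → t ≤ c * F N)
    (hruns : ∀ j, 1 ≤ j → j ≤ k → ¬ HasRuns L j ∨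
      ∀ c, ∃ c', ∀ N t, 1 ≤ N → t ^ j ≤ c * N → t ≤ c' * F N)
    {x y : A} {E : List A} (hmem' : ∀ s, img φ ρ s (x :: (E ++ [y])) ∈ L) :
    Few F (cut φ ρ x E y) := by
  by_cases hE : ∀ b ∈ E, b ∈ S
  · obtain ⟨p, hp, hidem⟩ := exists_iterate_idem A
    obtain ⟨c₁, hl⟩ := exists_left hF hL hmem hS hT hpow htime hp hidem x
    obtain ⟨c₂, hr⟩ := exists_right hF hL hmem hS hT htime hp hidem y
    choose P Hl hP hD hHl hPs hPw using hl
    choose Hr Q hQ hHr hQs hQw using hr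
    have hwin : ∀ r ∈ Finset.range p, Few F (win (P r)
        (fun t => Hl r t ++ (img φ ρ (p * t + (p + r)) E ++ Hr r t)) (Q r)) := by
      intro r _
      refine few_win_of_tame hL hF hruns (hP r) (hQ r) (hD r)
        ((hHl r).append (((hT.iterates E hE).subsample hp _).append (hHr r))) fun t => ?_
      refine hL _ _ ?_ (hmem' (p * t + (p + r)))
      obtain ⟨X, hX⟩ := hPs r t
      obtain ⟨Y, hY⟩ := hQs r t
      refine ⟨X, Y, ?_⟩
      rw [img_cons, img_append, ← hX, ← hY]
      simp
    refine ((few_timed hF (fun s => img φ ρ s [x]) (fun s => img φ ρ s (E ++ [y]))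
      (c₁ + c₂ + p)).union (Few.iUnion_finset _ hwin)).mono ?_
    rintro _ ⟨s, w₁, w₂, h1, h2, rfl⟩
    by_cases htm : 1 ≤ (w₁ ++ (img φ ρ s E ++ w₂)).length →
      s ≤ (c₁ + c₂ + p) * F (w₁ ++ (img φ ρ s E ++ w₂)).length
    · exact Or.inl (mem_timed_of_cut h1 h2 htm)
    · right
      push Not at htm
      obtain ⟨hN, hs⟩ := htm
      set N := (w₁ ++ (img φ ρ s E ++ w₂)).length with hNdef
      have hN1 : w₁.length ≤ N := by
        rw [hNdef, List.length_append]
        omega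
      have hN2 : w₂.length ≤ N := by
        rw [hNdef, List.length_append, List.length_append]
        omega
      clear_value N
      rw [add_mul, add_mul] at hs
      have hFp : p * 1 ≤ p * F N := Nat.mul_le_mul_left _ (hF N)
      have hs' : p * ((s - p) / p) + (p + (s - p) % p) = s := by
        have := Nat.div_add_mod (s - p) p
        omega
      have hr : (s - p) % p < p := Nat.mod_lt _ hp
      generalize (s - p) % p = r at hs' hr
      generalize (s - p) / p = t at hs'
      subst hs'
      have h3 : w₁ <:+ P r t ++ Hl r t :=
        (hPw r t w₁ N hN h1 hN1).resolve_right (by omega)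
      have h4 : w₂ <+: Hr r t ++ Q r t :=
        (hQw r t w₂ N hN h2 hN2).resolve_right (by omega)
      simp only [Set.mem_iUnion]
      obtain ⟨X, hX⟩ := h3
      obtain ⟨Y, hY⟩ := h4
      refine ⟨r, Finset.mem_range.2 hr, t, X, Y, ?_, ?_, ?_⟩
      · calc P r t ++ (Hl r t ++ (img φ ρ (p * t + (p + r)) E ++ Hr r t) ++ Q r t)
            = (P r t ++ Hl r t) ++ (img φ ρ (p * t + (p + r)) E ++ (Hr r t ++ Q r t)) := by simp
          _ = _ := by
            rw [← hX, ← hY]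
            simp
      all_goals
        have := congrArg List.length hX
        simp only [List.length_append] at this ⊢
        omega
  · push Not at hE
    obtain ⟨e, he, heS⟩ := hE
    obtain ⟨c, hc⟩ := htime
    refine (few_timed hF (fun s => img φ ρ s [x]) (fun s => img φ ρ s (E ++ [y])) c).mono ?_
    rintro _ ⟨s, w₁, w₂, h1, h2, rfl⟩
    refine mem_timed_of_cut h1 h2 fun hN => hc e heS s _ hN ?_
    have := length_img_le_of_mem (φ := φ) (ρ := ρ) he s
    simp only [List.length_append]
    omega

/-- The upper bound: there are few factors if all letters outside of `S` grow fast enough and there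
are no long runs which could produce many factors. -/
theorem few_of_iterates [Finite A] [Finite B] (hF : ∀ N, 1 ≤ F N) (hL : FactorClosed L)
    (hmem : ∀ b t, img φ ρ t [b] ∈ L) (hcov : ∀ w ∈ L, ∃ b t, w <:+: img φ ρ t [b])
    (hS : Stable φ S) (hT : TameOn φ ρ L S k)
    (hpow : ∃ c, ∀ b, b ∉ S → ∀ t, t ^ k ≤ c * (img φ ρ t [b]).length)
    (htime : ∃ c, ∀ b, b ∉ S → ∀ t N, 1 ≤ N → (img φ ρ t [b]).length ≤ N → t ≤ c * F N)
    (hruns : ∀ j, 1 ≤ j → j ≤ k → ¬ HasRuns L j ∨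
      ∀ c, ∃ c', ∀ N t, 1 ≤ N → t ^ j ≤ c * N → t ≤ c' * F N) : Few F L := by
  have hfin : {E : List A | ∃ b, E <:+: φ b}.Finite := by
    obtain ⟨M, hM⟩ := (Set.finite_range fun b => (φ b).length).bddAbove
    refine (List.finite_length_le A M).subset ?_
    rintro E ⟨b, hb⟩
    exact hb.length_le.trans (hM ⟨b, rfl⟩)
  have := hfin.to_subtype
  have h1 : ∀ i : A × {E : List A | ∃ b, E <:+: φ b} × A,
      Few F {w | (∃ b, i.1 :: (i.2.1.1 ++ [i.2.2]) <:+: φ b) ∧ w ∈ cut φ ρ i.1 i.2.1.1 i.2.2} := by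
    rintro ⟨x, E, y⟩
    by_cases h : ∃ b, x :: (E.1 ++ [y]) <:+: φ b
    · refine (few_cut hF hL hmem hS hT hpow htime hruns fun s => ?_).mono fun w hw => hw.2
      obtain ⟨b, hb⟩ := h
      refine hL _ _ (img_infix φ ρ hb s) ?_
      have := hmem b (s + 1)
      rwa [img_add, iterWord_one, List.flatMap_singleton] at this
    · exact Few.empty.mono fun w hw => (h hw.1).elim
  refine ((Few.iUnion fun b => few_infix hF (ρ b)).union
    ((few_infix hF []).union (Few.iUnion h1))).mono fun w hw => ?_
  obtain ⟨b, t, hbt⟩ := hcov w hw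
  induction t generalizing b with
  | zero =>
    left
    simp only [Set.mem_iUnion]
    exact ⟨b, by simpa [img] using hbt⟩
  | succ t ih =>
    rw [img_add, iterWord_one, List.flatMap_singleton, img_eq_flatMap] at hbt
    rcases infix_flatMap hbt with rfl | ⟨c, -, hc⟩ | ⟨x, E, y, w₁, w₂, h2, h3, h4, rfl⟩
    · exact Or.inr (Or.inl List.infix_rfl)
    · exact ih c hc
    · refine Or.inr (Or.inr ?_)
      simp only [Set.mem_iUnion]
      refine ⟨(x, ⟨E, b, List.IsInfix.trans ⟨[x], [y], by simp⟩ h2⟩, y), ⟨b, h2⟩,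
        t, w₁, w₂, h3, h4, ?_⟩
      rw [img_eq_flatMap φ ρ t E]

end Upper

/-! ### The growth dichotomy for nonerasing morphisms -/

section Dichotomy

/-- The integer part of the `k`-th root. -/
def root (k N : ℕ) : ℕ := Nat.findGreatest (fun t => t ^ k ≤ N) N

lemma root_pow_le {k : ℕ} (hk : 1 ≤ k) (N : ℕ) : root k N ^ k ≤ N :=
  Nat.findGreatest_spec (P := fun t => t ^ k ≤ N) (Nat.zero_le N)
    (by rw [zero_pow (by omega)]; exact Nat.zero_le N)

lemma lt_root_succ_pow {k : ℕ} (hk : 1 ≤ k) (N : ℕ) : N < (root k N + 1) ^ k := by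
  by_contra! h
  have h1 : root k N + 1 ≤ N := (Nat.le_self_pow (by omega) _).trans h
  have h2 : root k N + 1 ≤ root k N := Nat.le_findGreatest (P := fun t => t ^ k ≤ N) h1 h
  omega

lemma le_mul_root {k : ℕ} (hk : 1 ≤ k) {c N t : ℕ} (h : t ^ k ≤ c * N) :
    t ≤ (c + 1) * (root k N + 1) := by
  refine le_of_not_gt fun hlt => ?_
  have h1 : ((c + 1) * (root k N + 1)) ^ k ≤ t ^ k := Nat.pow_le_pow_left hlt.le k
  rw [mul_pow] at h1
  have h2 : c + 1 ≤ (c + 1) ^ k := Nat.le_self_pow (by omega) _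
  have h3 := lt_root_succ_pow hk N
  have h4 : (c + 1) * (root k N + 1) ^ k ≤ (c + 1) ^ k * (root k N + 1) ^ k :=
    Nat.mul_le_mul_right _ h2
  nlinarith

lemma root_le_rpow {k : ℕ} (hk : 1 ≤ k) (N : ℕ) : (root k N : ℝ) ≤ (N : ℝ) ^ (1 / (k : ℝ)) := by
  have h : ((root k N : ℝ)) ^ k ≤ N := by exact_mod_cast root_pow_le hk N
  rw [one_div]
  calc (root k N : ℝ) = ((root k N : ℝ) ^ k) ^ ((k : ℝ)⁻¹) :=
        (Real.pow_rpow_inv_natCast (Nat.cast_nonneg _) (by omega)).symm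
    _ ≤ _ := Real.rpow_le_rpow (by positivity) h (by positivity)

lemma rpow_le_of_le_pow {k N m : ℕ} (hk : 1 ≤ k) (h : N ≤ m ^ k) :
    (N : ℝ) ^ (1 / (k : ℝ)) ≤ m := by
  have h : (N : ℝ) ≤ (m : ℝ) ^ k := by exact_mod_cast h
  rw [one_div]
  calc (N : ℝ) ^ ((k : ℝ)⁻¹) ≤ ((m : ℝ) ^ k) ^ ((k : ℝ)⁻¹) :=
        Real.rpow_le_rpow (by positivity) h (by positivity)
    _ = _ := Real.pow_rpow_inv_natCast (Nat.cast_nonneg _) (by omega)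

lemma rpow_one_add {k N : ℕ} (hN : 1 ≤ N) :
    (N : ℝ) ^ ((1 : ℝ) + 1 / (k : ℝ)) = N * (N : ℝ) ^ (1 / (k : ℝ)) := by
  rw [Real.rpow_add (by exact_mod_cast hN), Real.rpow_one]

variable {A B : Type*} {φ : A → List A} {ρ : A → List B} {β : ℕ → B}

lemma Few.complexity_le {F : ℕ → ℕ} (h : Few F (lang β)) :
    ∃ C, ∀ N, 1 ≤ N → complexity β N ≤ C * (N * F N) := by
  obtain ⟨C, hC⟩ := h
  refine ⟨C, fun N hN => ?_⟩
  rw [complexity_eq]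
  exact hC N hN

lemma isBigO_of_few_root {k : ℕ} (hk : 1 ≤ k) (h : Few (fun N => root k N + 1) (lang β)) :
    (fun n => (complexity β n : ℝ)) =O[atTop] (fun n => (n : ℝ) ^ ((1 : ℝ) + 1 / (k : ℝ))) := by
  obtain ⟨C, hC⟩ := h.complexity_le
  refine IsBigO.of_bound (2 * C) (eventually_atTop.2 ⟨1, fun N hN => ?_⟩)
  have hN' : (1 : ℝ) ≤ N := by exact_mod_cast hN
  rw [Real.norm_of_nonneg (Nat.cast_nonneg _), Real.norm_of_nonneg (by positivity),
    rpow_one_add hN]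
  have h1 : (complexity β N : ℝ) ≤ C * (N * (root k N + 1)) := by exact_mod_cast hC N hN
  have h2 := root_le_rpow hk N
  have h3 : (1 : ℝ) ≤ (N : ℝ) ^ (1 / (k : ℝ)) := Real.one_le_rpow hN' (by positivity)
  calc (complexity β N : ℝ) ≤ C * (N * (root k N + 1)) := h1
    _ ≤ C * (N * (2 * (N : ℝ) ^ (1 / (k : ℝ)))) := by
      gcongr
      linarith
    _ = _ := by ring

lemma isBigO_of_hasRuns [Finite B] {k : ℕ} (hk : 1 ≤ k) (h : HasRuns (lang β) k) :
    (fun n : ℕ => (n : ℝ) ^ ((1 : ℝ) + 1 / (k : ℝ))) =O[atTop]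
      (fun n => (complexity β n : ℝ)) := by
  obtain ⟨M, K, T₀, hM, h⟩ := h.le_complexity hk
  refine IsBigO.of_bound (2 ^ (k + 1) * M ^ 2 * K)
    (eventually_atTop.2 ⟨M * (T₀ + 1) ^ k, fun N hN => ?_⟩)
  have hN1 : 1 ≤ N := le_trans (Nat.mul_pos hM (by positivity)) hN
  set T := root k (N / M) with hT
  have h1 : T ^ k ≤ N / M := root_pow_le hk _
  have h2 : N / M < (T + 1) ^ k := lt_root_succ_pow hk _
  have h3 : T₀ + 1 ≤ T := by
    have : (T₀ + 1) ^ k < (T + 1) ^ k := lt_of_le_of_lt ((Nat.le_div_iff_mul_le hM).2 (by linarith)) h2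
    have := lt_of_pow_lt_pow_left₀ k (Nat.zero_le _) this
    omega
  have h4 : M * T ^ k ≤ N := (Nat.mul_le_mul_left M h1).trans (Nat.mul_div_le N M)
  have h5 : N ≤ M * (2 * T) ^ k := by
    have h6 : (T + 1) ^ k ≤ (2 * T) ^ k := Nat.pow_le_pow_left (by omega) k
    have h7 := Nat.lt_mul_div_succ N hM
    exact h7.le.trans (Nat.mul_le_mul_left M (by omega))
  have h6 : (N : ℝ) ^ (1 / (k : ℝ)) ≤ ((M * (2 * T) : ℕ) : ℝ) := by
    refine rpow_le_of_le_pow hk (h5.trans ?_)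
    rw [mul_pow M]
    exact Nat.mul_le_mul_right _ (Nat.le_self_pow (by omega) M)
  have h7 : (T : ℝ) ^ (k + 1) ≤ K * complexity β N := by
    exact_mod_cast h T N (by omega) h4
  have h8 : (N : ℝ) ≤ M * (2 * T) ^ k := by exact_mod_cast h5
  rw [Real.norm_of_nonneg (by positivity), Real.norm_of_nonneg (Nat.cast_nonneg _),
    rpow_one_add hN1]
  calc (N : ℝ) * (N : ℝ) ^ (1 / (k : ℝ)) ≤ (M * (2 * T) ^ k) * (M * (2 * T)) := by
        push_cast at h6
        gcongr
    _ = 2 ^ (k + 1) * M ^ 2 * (T : ℝ) ^ (k + 1) := by ring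
    _ ≤ 2 ^ (k + 1) * M ^ 2 * (K * complexity β N) := by gcongr
    _ = _ := by ring

lemma isBigO_of_few_log (h : Few (fun N => Nat.log 2 N + 1) (lang β)) :
    (fun n => (complexity β n : ℝ)) =O[atTop] (fun n => (n : ℝ) * Real.log n) := by
  obtain ⟨C, hC⟩ := h.complexity_le
  refine IsBigO.of_bound (3 * C) (eventually_atTop.2 ⟨3, fun N hN => ?_⟩)
  have hN' : (3 : ℝ) ≤ N := by exact_mod_cast hN
  have hlog : 1 ≤ Real.log N := by
    rw [Real.le_log_iff_exp_le (by linarith)]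
    linarith [Real.exp_one_lt_d9]
  rw [Real.norm_of_nonneg (Nat.cast_nonneg _), Real.norm_of_nonneg (by positivity)]
  have h1 : (complexity β N : ℝ) ≤ C * (N * (Nat.log 2 N + 1)) := by
    exact_mod_cast hC N (by omega)
  have h2 : (Nat.log 2 N : ℝ) ≤ 2 * Real.log N := by
    have h3 : (2 : ℝ) ^ Nat.log 2 N ≤ N := by exact_mod_cast Nat.pow_log_le_self 2 (by omega)
    have h4 := Real.log_le_log (by positivity) h3
    rw [Real.log_pow] at h4
    nlinarith [Real.log_two_gt_d9, Nat.cast_nonneg (α := ℝ) (Nat.log 2 N)]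
  calc (complexity β N : ℝ) ≤ C * (N * (Nat.log 2 N + 1)) := h1
    _ ≤ C * (N * (3 * Real.log N)) := by
      gcongr
      linarith
    _ = _ := by ring

/-- The dichotomy for words whose factors are covered by the iterates of a nonerasing morphism. -/
theorem dichotomy_of_nonerasing [Finite A] [Finite B] (hφ : ∀ b, φ b ≠ []) (hρ : ∀ b, ρ b ≠ [])
    (hmem : ∀ b t, img φ ρ t [b] ∈ lang β) (hcov : ∀ w ∈ lang β, ∃ b t, w <:+: img φ ρ t [b]) :
    (∃ k : ℕ, 1 ≤ k ∧ (fun n => (complexity β n : ℝ)) =Θ[atTop]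
      (fun n => (n : ℝ) ^ ((1 : ℝ) + 1 / (k : ℝ)))) ∨
      (fun n => (complexity β n : ℝ)) =O[atTop] (fun n => (n : ℝ) * Real.log n) := by
  classical
  have hL := factorClosed_lang β
  have hpow : ∀ k, ∃ c, ∀ b, b ∉ Level φ k → ∀ t, t ^ k ≤ c * (img φ ρ t [b]).length := by
    intro k
    obtain ⟨c, hc⟩ := exists_pow_le_length hφ k
    exact ⟨c, fun b hb t => (hc b hb t).trans
      (Nat.mul_le_mul_left _ (length_iterWord_le_length_img hρ t [b]))⟩
  by_cases hJ : ∃ j, 1 ≤ j ∧ HasRuns (lang β) j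
  · left
    obtain ⟨k, ⟨hk, hruns⟩, hmin⟩ : ∃ k, (1 ≤ k ∧ HasRuns (lang β) k) ∧
        ∀ j < k, ¬ (1 ≤ j ∧ HasRuns (lang β) j) :=
      ⟨Nat.find hJ, Nat.find_spec hJ, fun j hj => Nat.find_min hJ hj⟩
    refine ⟨k, hk, isBigO_of_few_root hk ?_, isBigO_of_hasRuns hk hruns⟩
    refine few_of_iterates (fun N => Nat.succ_pos _) hL hmem hcov (stable_level hφ k)
      (tameOn_level hφ hL hmem k fun j h1 h2 h3 => hmin j h2 ⟨h1, h3.hasRuns⟩) (hpow k) ?_ ?_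
    · obtain ⟨c, hc⟩ := hpow k
      exact ⟨c + 1, fun b hb t N _ hN =>
        le_mul_root hk ((hc b hb t).trans (Nat.mul_le_mul_left _ hN))⟩
    · intro j h1 h2
      rcases lt_or_eq_of_le h2 with h2 | rfl
      · exact Or.inl fun h3 => hmin j h2 ⟨h1, h3⟩
      · exact Or.inr fun c => ⟨c + 1, fun N t _ h => le_mul_root h1 h⟩
  · right
    push Not at hJ
    obtain ⟨k, -, hk⟩ := exists_level_eq hφ
    refine isBigO_of_few_log (few_of_iterates (fun N => Nat.succ_pos _) hL hmem hcov
      (stable_level hφ k) (tameOn_level hφ hL hmem k fun j h1 _ h3 => hJ j h1 h3.hasRuns) (hpow k)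
      ?_ fun j h1 _ => Or.inl (hJ j h1))
    obtain ⟨h, hh, h2⟩ := exists_two_pow_le_length hφ hk
    refine ⟨h, fun b hb t N hN hl => ?_⟩
    have h3 : t / h ≤ Nat.log 2 N := Nat.le_log_of_pow_le one_lt_two
      ((h2 b hb t).trans ((length_iterWord_le_length_img hρ t [b]).trans hl))
    exact (Nat.lt_mul_div_succ t hh).le.trans (Nat.mul_le_mul_left _ (Nat.succ_le_succ h3))

end Dichotomy

/-! ### Reduction to nonerasing morphisms -/

section Reduction

variable {A B : Type*} (φ : A → List A) (a : A)

/-- Letters occurring in the iterates of `a` and never erased. -/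
def Alive (b : A) : Prop := (∀ n, iterWord φ n [b] ≠ []) ∧ ∃ t, b ∈ iterWord φ t [a]

open Classical in
/-- Erase the letters which are not alive. -/
noncomputable def prune (w : List A) : List A := w.filter fun b => Alive φ a b

open Classical in
/-- The nonerasing morphism induced on the letters which are alive. -/
noncomputable def pruned (b : A) : List A := if Alive φ a b then prune φ a (φ b) else [a]

variable {φ a}

lemma iterWord_eq_nil_of_le {m n : ℕ} (h : m ≤ n) {w : List A} (hw : iterWord φ m w = []) :
    iterWord φ n w = [] := by
  obtain ⟨k, rfl⟩ := Nat.exists_eq_add_of_le' h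
  rw [iterWord_add, hw, iterWord_nil]

lemma exists_alive_mem {b : A} (hb : Alive φ a b) : ∃ c ∈ φ b, Alive φ a c := by
  by_contra! h
  have h1 : ∀ c ∈ φ b, ∃ n, iterWord φ n [c] = [] := by
    intro c hc
    by_contra! hn
    obtain ⟨t, ht⟩ := hb.2
    refine h c hc ⟨hn, t + 1, ?_⟩
    rw [iterWord_succ', List.mem_flatMap]
    exact ⟨b, ht, hc⟩
  have h2 : ∀ w : List A, (∀ c ∈ w, ∃ n, iterWord φ n [c] = []) → ∃ n, iterWord φ n w = [] := by
    intro w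
    induction w with
    | nil => exact fun _ => ⟨0, rfl⟩
    | cons c w ih =>
      intro hw
      obtain ⟨n, hn⟩ := ih fun d hd => hw d (by simp [hd])
      obtain ⟨m, hm⟩ := hw c (by simp)
      refine ⟨m + n, ?_⟩
      rw [iterWord_cons, iterWord_eq_nil_of_le (Nat.le_add_right m n) hm,
        iterWord_eq_nil_of_le (Nat.le_add_left n m) hn, List.append_nil]
  obtain ⟨n, hn⟩ := h2 _ h1
  exact hb.1 (n + 1) (by rw [iterWord_succ_singleton, hn])

lemma pruned_ne_nil (b : A) : pruned φ a b ≠ [] := by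
  unfold pruned
  split_ifs with hb
  · obtain ⟨c, hc, hca⟩ := exists_alive_mem hb
    exact List.ne_nil_of_mem (List.mem_filter.2 ⟨hc, by simpa using hca⟩)
  · exact List.cons_ne_nil _ _

lemma prune_append (u v : List A) : prune φ a (u ++ v) = prune φ a u ++ prune φ a v :=
  List.filter_append _ _

lemma prune_cons_of_alive {b : A} (hb : Alive φ a b) (w : List A) :
    prune φ a (b :: w) = b :: prune φ a w :=
  List.filter_cons_of_pos (by simpa using hb)

lemma prune_cons_of_not_alive {b : A} (hb : ¬ Alive φ a b) (w : List A) :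
    prune φ a (b :: w) = prune φ a w :=
  List.filter_cons_of_neg (by simpa using hb)

lemma exists_iterWord_eq_nil {b : A} (hb : ¬ Alive φ a b) (hr : ∃ t, b ∈ iterWord φ t [a]) :
    ∃ n, iterWord φ n [b] = [] := by
  by_contra! h
  exact hb ⟨h, hr⟩

lemma prune_flatMap {w : List A} (hw : ∀ b ∈ w, ∃ t, b ∈ iterWord φ t [a]) :
    prune φ a (w.flatMap φ) = (prune φ a w).flatMap (pruned φ a) := by
  induction w with
  | nil => rfl
  | cons b w ih =>
    rw [List.flatMap_cons, prune_append, ih fun c hc => hw c (by simp [hc])]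
    by_cases hb : Alive φ a b
    · rw [prune_cons_of_alive hb, List.flatMap_cons, pruned, if_pos hb]
    · obtain ⟨n, hn⟩ := exists_iterWord_eq_nil hb (hw b (by simp))
      have h1 : prune φ a (φ b) = [] := by
        refine List.filter_eq_nil_iff.2 fun c hc hca => ?_
        have hca : Alive φ a c := by simpa using hca
        refine hca.1 n (List.eq_nil_of_infix_nil ?_)
        have h := iterWord_infix φ (singleton_infix hc) n
        rwa [← iterWord_succ_singleton, iterWord_eq_nil_of_le (Nat.le_succ n) hn] at h
      rw [prune_cons_of_not_alive hb, h1, List.nil_append]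

lemma prune_iterWord {w : List A} (hw : ∀ b ∈ w, ∃ t, b ∈ iterWord φ t [a]) (t : ℕ) :
    prune φ a (iterWord φ t w) = iterWord (pruned φ a) t (prune φ a w) := by
  induction t generalizing w with
  | zero => rfl
  | succ t ih =>
    rw [iterWord_succ, iterWord_succ, ← prune_flatMap hw, ih]
    intro b hb
    rw [List.mem_flatMap] at hb
    obtain ⟨c, hc, hb⟩ := hb
    obtain ⟨s, hs⟩ := hw c hc
    refine ⟨s + 1, ?_⟩
    rw [iterWord_succ', List.mem_flatMap]
    exact ⟨c, hs, hb⟩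

lemma exists_iterWord_eq_iterWord_prune [Finite A] : ∃ T, ∀ w : List A,
    (∀ b ∈ w, ∃ t, b ∈ iterWord φ t [a]) → iterWord φ T w = iterWord φ T (prune φ a w) := by
  have h : ∀ b, ∃ n, ¬ Alive φ a b → (∃ t, b ∈ iterWord φ t [a]) → iterWord φ n [b] = [] := by
    intro b
    by_cases hb : ¬ Alive φ a b ∧ ∃ t, b ∈ iterWord φ t [a]
    · obtain ⟨n, hn⟩ := exists_iterWord_eq_nil hb.1 hb.2
      exact ⟨n, fun _ _ => hn⟩
    · exact ⟨0, fun h1 h2 => (hb ⟨h1, h2⟩).elim⟩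
  choose n hn using h
  obtain ⟨T, hT⟩ := (Set.finite_range n).bddAbove
  refine ⟨T, fun w => ?_⟩
  induction w with
  | nil => exact fun _ => rfl
  | cons b w ih =>
    intro hw
    have ih := ih fun c hc => hw c (by simp [hc])
    by_cases hb : Alive φ a b
    · rw [prune_cons_of_alive hb, iterWord_cons, ih, ← iterWord_cons]
    · rw [prune_cons_of_not_alive hb, iterWord_cons, ih,
        iterWord_eq_nil_of_le (hT ⟨b, rfl⟩) (hn b hb (hw b (by simp))), List.nil_append]

open Classical in
/-- The images of the letters which are alive under a high iterate followed by the coding. -/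
noncomputable def finalImage (φ : A → List A) (a : A) (ψ : A → B) (T : ℕ) (b : A) : List B :=
  if Alive φ a b then (iterWord φ T [b]).map ψ else (iterWord φ T [a]).map ψ

lemma alive_of_mem_prune {w : List A} {b : A} (h : b ∈ prune φ a w) : Alive φ a b :=
  by simpa using (List.mem_filter.1 h).2

lemma flatMap_finalImage (ψ : A → B) (T : ℕ) {w : List A} (hw : ∀ b ∈ w, Alive φ a b) :
    w.flatMap (finalImage φ a ψ T) = (iterWord φ T w).map ψ := by
  induction w with
  | nil => simp
  | cons b w ih =>
    rw [List.flatMap_cons, ih fun c hc => hw c (by simp [hc]), iterWord_cons, List.map_append,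
      finalImage, if_pos (hw b (by simp))]

lemma img_pruned (ψ : A → B) {T : ℕ} (hT : ∀ w : List A,
    (∀ b ∈ w, ∃ t, b ∈ iterWord φ t [a]) → iterWord φ T w = iterWord φ T (prune φ a w))
    {b : A} (hb : Alive φ a b) (t : ℕ) :
    img (pruned φ a) (finalImage φ a ψ T) t [b] = (iterWord φ (T + t) [b]).map ψ := by
  have h1 : [b] = prune φ a [b] := by
    rw [prune_cons_of_alive hb]
    rfl
  rw [img, h1, ← prune_iterWord (by simpa using hb.2),
    flatMap_finalImage ψ T fun c => alive_of_mem_prune, ← hT, ← h1, iterWord_add]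
  intro c hc
  obtain ⟨s, hs⟩ := hb.2
  refine ⟨t + s, ?_⟩
  rw [iterWord_add]
  exact (iterWord_infix φ (singleton_infix hs) t).subset hc

lemma length_iterWord_gt {γ : List A} (ha : φ a = a :: γ) (hγ : ∀ n : ℕ, iterWord φ n γ ≠ [])
    (n : ℕ) : n < (iterWord φ n [a]).length := by
  induction n with
  | zero => simp
  | succ n ih =>
    rw [iterWord_succ_singleton, ha, iterWord_cons, List.length_append]
    have := List.length_pos_iff.2 (hγ n)
    omega

end Reduction

section Conclusion

variable {A B : Type*} {φ : A → List A} {a : A} {γ : List A} {α : ℕ → A}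

lemma alive_self (ha : φ a = a :: γ) (hγ : ∀ n : ℕ, iterWord φ n γ ≠ []) : Alive φ a a :=
  ⟨fun n => List.length_pos_iff.1 (Nat.zero_lt_of_lt (length_iterWord_gt ha hγ n)), 0, by simp⟩

lemma map_iterWord_eq_factor (hα : ∀ (n i : ℕ) (h : i < (iterWord φ n [a]).length),
    (iterWord φ n [a]).get ⟨i, h⟩ = α i) (ψ : A → B) (n : ℕ) :
    (iterWord φ n [a]).map ψ = factor (fun i => ψ (α i)) 0 (iterWord φ n [a]).length := by
  refine List.ext_getElem (by simp) fun i h1 h2 => ?_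
  have := hα n i (by simpa using h1)
  rw [List.get_eq_getElem] at this
  simp [factor, this]

lemma finalImage_ne_nil (h : Alive φ a a) (ψ : A → B) (T : ℕ) (b : A) :
    finalImage φ a ψ T b ≠ [] := by
  unfold finalImage
  split_ifs with hb
  · exact fun h' => hb.1 T (List.map_eq_nil_iff.1 h')
  · exact fun h' => h.1 T (List.map_eq_nil_iff.1 h')

lemma img_pruned_mem (h : Alive φ a a) (ψ : A → B) {L : Set (List B)} (hL : FactorClosed L)
    (hmem : ∀ n, (iterWord φ n [a]).map ψ ∈ L) {T : ℕ} (hT : ∀ w : List A,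
    (∀ b ∈ w, ∃ t, b ∈ iterWord φ t [a]) → iterWord φ T w = iterWord φ T (prune φ a w))
    (b : A) (t : ℕ) : img (pruned φ a) (finalImage φ a ψ T) t [b] ∈ L := by
  by_cases hb : Alive φ a b
  · obtain ⟨s, hs⟩ := hb.2
    rw [img_pruned ψ hT hb]
    refine hL _ _ (List.IsInfix.map ψ (iterWord_infix φ (singleton_infix hs) (T + t))) ?_
    rw [← iterWord_add]
    exact hmem _
  · cases t with
    | zero =>
      have : img (pruned φ a) (finalImage φ a ψ T) 0 [b] = (iterWord φ T [a]).map ψ := by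
        simp [img, finalImage, hb]
      rw [this]
      exact hmem _
    | succ t =>
      have : img (pruned φ a) (finalImage φ a ψ T) (t + 1) [b] =
          img (pruned φ a) (finalImage φ a ψ T) t [a] := by
        rw [img, img, iterWord_succ_singleton, pruned, if_neg hb]
      rw [this, img_pruned ψ hT h]
      exact hmem _

end Conclusion

end MorphicComplexity

open MorphicComplexity in
/-- The subword complexity of a morphic sequence is either `Θ(n^(1+1/k))` for
some `k ≥ 1`, or `O(n log n)`. -/
theorem stmt0 {A B : Type*} [Fintype A] [Fintype B]
    (φ : A → List A) (a : A) (γ : List A)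
    (ha : φ a = a :: γ)
    (hγ : ∀ n : ℕ, iterWord φ n γ ≠ [])
    (α : ℕ → A)
    (hα : ∀ (n i : ℕ) (h : i < (iterWord φ n [a]).length),
      (iterWord φ n [a]).get ⟨i, h⟩ = α i)
    (ψ : A → B) (β : ℕ → B) (hβ : β = fun i => ψ (α i)) :
    (∃ k : ℕ, 1 ≤ k ∧
        (fun n => (complexity β n : ℝ)) =Θ[atTop]
          (fun n => (n : ℝ) ^ ((1 : ℝ) + 1 / (k : ℝ)))) ∨
      (fun n => (complexity β n : ℝ)) =O[atTop]
        (fun n => (n : ℝ) * Real.log n) := by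
  obtain ⟨T, hT⟩ := exists_iterWord_eq_iterWord_prune (φ := φ) (a := a)
  have haa := alive_self ha hγ
  have hpre : ∀ n, (iterWord φ n [a]).map ψ = factor β 0 (iterWord φ n [a]).length := by
    rw [hβ]
    exact map_iterWord_eq_factor hα ψ
  refine dichotomy_of_nonerasing (φ := pruned φ a) (ρ := finalImage φ a ψ T) pruned_ne_nil
    (finalImage_ne_nil haa ψ T)
    (img_pruned_mem haa ψ (factorClosed_lang β) (fun n => mem_lang_iff.2 ⟨_, _, hpre n⟩) hT) ?_
  intro w hw
  obtain ⟨i, n, rfl⟩ := mem_lang_iff.1 hw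
  refine ⟨a, i + n, ?_⟩
  rw [img_pruned ψ hT haa, hpre]
  obtain ⟨m, hm⟩ := Nat.exists_eq_add_of_le
    (le_trans (Nat.le_add_left (i + n) T) (length_iterWord_gt ha hγ (T + (i + n))).le)
  rw [hm, factor_add, factor_add, Nat.zero_add]
  exact List.infix_append _ _ _
end

section
/- Let γ be a finite word which is weakly p₁-periodic with left period δ (so |δ| = p₁ ≥ 1) and simultaneously weakly p₂-periodic with left period σ (so |σ| = p₂ ≥ 1), and suppose |γ| ≥ 2p₁ and |γ| ≥ 2p₂. Then there exists a finite word λ and positive integers k, l such that δ = λ^k (λ repeated k times) and σ = λ^l (λ repeated l times). -/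
/-- `γ` is weakly `p`-periodic: `γ_i = γ_{i+p}` for all `0 ≤ i < |γ| − p`. -/
def WeaklyPeriodic {A : Type*} (γ : List A) (p : ℕ) : Prop :=
  ∀ i : ℕ, i + p < γ.length → γ[i]? = γ[i + p]?

/-- The word `lam` repeated `n` times. -/
def repWord {A : Type*} : ℕ → List A → List A
  | 0, _ => []
  | n + 1, lam => lam ++ repWord n lam

/-- A prefix of a `g`-periodic word whose length is a multiple `k * g` of the period is the `k`-th
power of the prefix of length `g`. -/
theorem List.HasPeriod.take_mul_eq_repWord {A : Type*} {w : List A} {g : ℕ}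
    (per : w.HasPeriod g) (k : ℕ) (hk : k * g ≤ w.length) :
    w.take (k * g) = repWord k (w.take g) := by
  induction k with
  | zero => simp [repWord]
  | succ k ih =>
    rw [Nat.succ_mul] at hk
    have hdrop : (w.drop g).take (k * g) = w.take (k * g) := by
      refine (prefix_iff_eq_take.mp ((take_prefix _ _).trans (per.drop_prefix g))).trans ?_
      rw [length_take, length_drop, Nat.min_eq_left (by omega)]
    rw [repWord, ← ih (by omega), ← hdrop, Nat.succ_mul, Nat.add_comm, take_add]

theorem WeaklyPeriodic.hasPeriod {A : Type*} {w : List A} {p : ℕ} (h : WeaklyPeriodic w p) :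
    w.HasPeriod p :=
  List.hasPeriod_iff_getElem?.mpr fun i hi => h i (by omega)

/-- If `γ` is weakly `p₁`-periodic with left period `δ` and weakly `p₂`-periodic
with left period `σ`, and `|γ| ≥ 2p₁`, `|γ| ≥ 2p₂`, then `δ` and `σ` are both
powers of a common word `λ`. -/
theorem stmt1 {A : Type*} (γ δ σ : List A) (p₁ p₂ : ℕ)
    (hp₁ : 1 ≤ p₁) (hp₂ : 1 ≤ p₂)
    (hδlen : δ.length = p₁) (hσlen : σ.length = p₂)
    (hδpre : δ <+: γ) (hσpre : σ <+: γ)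
    (hper₁ : WeaklyPeriodic γ p₁) (hper₂ : WeaklyPeriodic γ p₂)
    (hlen₁ : 2 * p₁ ≤ γ.length) (hlen₂ : 2 * p₂ ≤ γ.length) :
    ∃ (lam : List A) (k l : ℕ), 1 ≤ k ∧ 1 ≤ l ∧
      δ = repWord k lam ∧ σ = repWord l lam := by
  have hper := hper₁.hasPeriod.gcd hper₂.hasPeriod (by omega)
  obtain ⟨k, hk⟩ := Nat.gcd_dvd_left p₁ p₂
  obtain ⟨l, hl⟩ := Nat.gcd_dvd_right p₁ p₂
  rw [Nat.mul_comm] at hk hl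
  refine ⟨γ.take (p₁.gcd p₂), k, l, ?_, ?_, ?_, ?_⟩
  · exact Nat.pos_of_ne_zero fun h => by simp [h] at hk; omega
  · exact Nat.pos_of_ne_zero fun h => by simp [h] at hl; omega
  · rw [← hper.take_mul_eq_repWord k (by omega), ← hk, ← hδlen]
    exact List.prefix_iff_eq_take.mp hδpre
  · rw [← hper.take_mul_eq_repWord l (by omega), ← hl, ← hσlen]
    exact List.prefix_iff_eq_take.mp hσpre
end

section
/- Let γ be a finite word. If there exists an integer p ≥ 1 such that γ is weakly p-periodic and 2p ≤ |γ|, then γ has a minimal left period and a minimal right period. Moreover, if λ is the minimal left (resp. right) period of γ and γ is weakly p-periodic with left (resp. right) period δ, where 2p ≤ |γ|, then |λ| divides p and δ = λ^(p/|λ|). -/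
/-- `γ` is weakly `|δ|`-periodic with left period `δ`. -/
def WeaklyLeftPeriodic {A : Type*} (γ δ : List A) : Prop :=
  1 ≤ δ.length ∧ δ <+: γ ∧ WeaklyPeriodic γ δ.length

/-- `γ` is weakly `|δ|`-periodic with right period `δ`. -/
def WeaklyRightPeriodic {A : Type*} (γ δ : List A) : Prop :=
  1 ≤ δ.length ∧ δ <:+ γ ∧ WeaklyPeriodic γ δ.length

/-- `lam` is the minimal left period of `γ`. -/
def MinimalLeftPeriod {A : Type*} (γ lam : List A) : Prop :=
  2 * lam.length ≤ γ.length ∧ WeaklyLeftPeriodic γ lam ∧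
    ∀ p : ℕ, 1 ≤ p → p < lam.length → ¬ WeaklyPeriodic γ p

/-- `lam` is the minimal right period of `γ`. -/
def MinimalRightPeriod {A : Type*} (γ lam : List A) : Prop :=
  2 * lam.length ≤ γ.length ∧ WeaklyRightPeriodic γ lam ∧
    ∀ p : ℕ, 1 ≤ p → p < lam.length → ¬ WeaklyPeriodic γ p

theorem WeaklyPeriodic.sub {A : Type*} {γ : List A} {p q : ℕ} (hp : WeaklyPeriodic γ p)
    (hq : WeaklyPeriodic γ q) (hqp : q ≤ p) (hlen : p + q ≤ γ.length) :
    WeaklyPeriodic γ (p - q) := by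
  intro i hi
  by_cases h : i + p < γ.length
  · rw [hp i h, hq (i + (p - q)) (by omega)]
    congr 1
    omega
  · have h₁ := hq (i - q) (by omega)
    have h₂ := hp (i - q) (by omega)
    rw [show i - q + q = i by omega] at h₁
    rw [show i - q + p = i + (p - q) by omega] at h₂
    rw [← h₁, h₂]

theorem WeaklyPeriodic.mul_left {A : Type*} {γ : List A} {p : ℕ} (hp : WeaklyPeriodic γ p)
    (k : ℕ) : WeaklyPeriodic γ (k * p) := by
  induction k with
  | zero => intro i _; simp
  | succ k ih =>
    intro i hi
    rw [Nat.succ_mul, ← Nat.add_assoc] at hi ⊢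
    rw [ih i (by omega), hp _ hi]

theorem WeaklyPeriodic.of_append_left {A : Type*} {s t : List A} {p : ℕ}
    (h : WeaklyPeriodic (s ++ t) p) : WeaklyPeriodic s p := by
  intro i hi
  have := h i (by rw [List.length_append]; omega)
  rwa [List.getElem?_append_left (by omega), List.getElem?_append_left hi] at this

theorem WeaklyPeriodic.of_append_right {A : Type*} {s t : List A} {p : ℕ}
    (h : WeaklyPeriodic (s ++ t) p) : WeaklyPeriodic t p := by
  intro i hi
  have := h (s.length + i) (by rw [List.length_append]; omega)
  rwa [Nat.add_assoc, List.getElem?_append_right (by omega),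
    List.getElem?_append_right (by omega), Nat.add_sub_cancel_left,
    Nat.add_sub_cancel_left] at this

/-- A smallest period `l` divides every period `p` such that `2 * p ≤ |γ|`. -/
theorem WeaklyPeriodic.dvd_of_minimal {A : Type*} {γ : List A} {l : ℕ} (hl : 1 ≤ l)
    (hper : WeaklyPeriodic γ l)
    (hmin : ∀ q : ℕ, 1 ≤ q → q < l → ¬ WeaklyPeriodic γ q) {p : ℕ}
    (hp : WeaklyPeriodic γ p) (hlen : 2 * p ≤ γ.length) : l ∣ p := by
  induction p using Nat.strong_induction_on with
  | _ p ih =>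
    rcases Nat.eq_zero_or_pos p with rfl | hpos
    · exact dvd_zero l
    · have hlp : l ≤ p := not_lt.mp fun hlt => hmin p hpos hlt hp
      exact (Nat.dvd_sub_iff_left hlp dvd_rfl).mp
        (ih (p - l) (by omega) (hp.sub hper hlp (by omega)) (by omega))

theorem WeaklyPeriodic.eq_repWord {A : Type*} {lam : List A} (k : ℕ) {δ : List A}
    (hper : WeaklyPeriodic δ lam.length) (hlen : δ.length = k * lam.length)
    (hpre : ∀ i : ℕ, i < lam.length → i < δ.length → δ[i]? = lam[i]?) :
    δ = repWord k lam := by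
  induction k generalizing δ with
  | zero => simpa [repWord] using hlen
  | succ k ih =>
    rw [Nat.succ_mul] at hlen
    obtain ⟨t, rfl⟩ : lam <+: δ := by
      rw [List.prefix_iff_getElem?]
      intro i hi
      rw [hpre i hi (by omega), List.getElem?_eq_getElem hi]
    rw [List.length_append] at hlen
    rw [repWord, ← ih hper.of_append_right (by omega)]
    intro i hi hit
    have := hper i (by rw [List.length_append]; omega)
    rw [List.getElem?_append_left hi, List.getElem?_append_right (by omega),
      Nat.add_sub_cancel] at this
    exact this.symm

theorem WeaklyPeriodic.eq_repWord_of_prefix {A : Type*} {lam δ : List A}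
    (hper : WeaklyPeriodic δ lam.length) (hdvd : lam.length ∣ δ.length) (hpre : lam <+: δ) :
    δ = repWord (δ.length / lam.length) lam := by
  refine hper.eq_repWord _ (Nat.div_mul_cancel hdvd).symm fun i hi _ => ?_
  obtain ⟨t, rfl⟩ := hpre
  exact List.getElem?_append_left hi

theorem WeaklyPeriodic.eq_repWord_of_suffix {A : Type*} {lam δ : List A}
    (hper : WeaklyPeriodic δ lam.length) (hdvd : lam.length ∣ δ.length) (hsuf : lam <:+ δ) :
    δ = repWord (δ.length / lam.length) lam := by
  refine hper.eq_repWord _ (Nat.div_mul_cancel hdvd).symm fun i hi _ => ?_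
  obtain ⟨s, rfl⟩ := hsuf
  rw [List.length_append, Nat.dvd_add_left dvd_rfl] at hdvd
  obtain ⟨m, hm⟩ := hdvd
  rw [hper.mul_left m i (by rw [List.length_append]; lia),
    List.getElem?_append_right (by lia)]
  congr 1
  lia

theorem WeaklyPeriodic.exists_minimal {A : Type*} {γ : List A}
    (h : ∃ p : ℕ, 1 ≤ p ∧ WeaklyPeriodic γ p ∧ 2 * p ≤ γ.length) :
    ∃ l : ℕ, 1 ≤ l ∧ WeaklyPeriodic γ l ∧ 2 * l ≤ γ.length ∧
      ∀ q : ℕ, 1 ≤ q → q < l → ¬ WeaklyPeriodic γ q := by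
  classical
  obtain ⟨hl, hper, hlen⟩ := Nat.find_spec h
  exact ⟨Nat.find h, hl, hper, hlen, fun q hq hlt hqper =>
    Nat.find_min h hlt ⟨hq, hqper, by omega⟩⟩

/-- If `γ` is weakly `p`-periodic for some `p ≥ 1` with `2p ≤ |γ|`, then `γ`
has minimal left and right periods; and any left (resp. right) period `δ`
with `2|δ| ≤ |γ|` is the minimal period repeated `|δ|/|λ|` times. -/
theorem stmt2 {A : Type*} (γ : List A)
    (h : ∃ p : ℕ, 1 ≤ p ∧ WeaklyPeriodic γ p ∧ 2 * p ≤ γ.length) :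
    ((∃ lam : List A, MinimalLeftPeriod γ lam) ∧
      (∃ lam : List A, MinimalRightPeriod γ lam)) ∧
    (∀ lam δ : List A, MinimalLeftPeriod γ lam →
        WeaklyLeftPeriodic γ δ → 2 * δ.length ≤ γ.length →
        lam.length ∣ δ.length ∧ δ = repWord (δ.length / lam.length) lam) ∧
    (∀ lam δ : List A, MinimalRightPeriod γ lam →
        WeaklyRightPeriodic γ δ → 2 * δ.length ≤ γ.length →
        lam.length ∣ δ.length ∧ δ = repWord (δ.length / lam.length) lam) := by
  refine ⟨?_, ?_, ?_⟩
  · obtain ⟨l, hl, hper, hlen, hmin⟩ := WeaklyPeriodic.exists_minimal h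
    have htake : (γ.take l).length = l := by rw [List.length_take]; omega
    have hdrop : (γ.drop (γ.length - l)).length = l := by rw [List.length_drop]; omega
    refine ⟨⟨γ.take l, ?_⟩, ⟨γ.drop (γ.length - l), ?_⟩⟩
    · rw [MinimalLeftPeriod, WeaklyLeftPeriodic, htake]
      exact ⟨hlen, ⟨hl, List.take_prefix _ _, hper⟩, hmin⟩
    · rw [MinimalRightPeriod, WeaklyRightPeriodic, hdrop]
      exact ⟨hlen, ⟨hl, List.drop_suffix _ _, hper⟩, hmin⟩
  · rintro lam δ ⟨-, ⟨hl, hlam, hper⟩, hmin⟩ ⟨hδ, hpre, hperδ⟩ hlen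
    have hdvd := hper.dvd_of_minimal hl hmin hperδ hlen
    have hlamδ := List.prefix_of_prefix_length_le hlam hpre (Nat.le_of_dvd hδ hdvd)
    obtain ⟨t, rfl⟩ := hpre
    exact ⟨hdvd, hper.of_append_left.eq_repWord_of_prefix hdvd hlamδ⟩
  · rintro lam δ ⟨-, ⟨hl, hlam, hper⟩, hmin⟩ ⟨hδ, hsuf, hperδ⟩ hlen
    have hdvd := hper.dvd_of_minimal hl hmin hperδ hlen
    have hlamδ := List.suffix_of_suffix_length_le hlam hsuf (Nat.le_of_dvd hδ hdvd)
    obtain ⟨s, rfl⟩ := hsuf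
    exact ⟨hdvd, hper.of_append_right.eq_repWord_of_suffix hdvd hlamδ⟩
end

section
/- Let Σ be a finite alphabet and φ : Σ* → Σ* a nonerasing morphism. Then for every letter b ∈ Σ, either there exists an integer k ≥ 1 such that |φ^n(b)| = Θ(n^(k−1)) as n → ∞ (b has finite order k), or there exists a real number q > 1 such that |φ^n(b)| = Ω(q^n) as n → ∞ (b has order ∞). -/
open Asymptotics Filter

/-- A function growing like a power of `n` or at least exponentially, with bounds valid for
every `n`. -/
def TameGrowth (f : ℕ → ℝ) : Prop :=
  (∃ k : ℕ, ∃ c C : ℝ, 0 < c ∧ 0 < C ∧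
    ∀ n : ℕ, c * ((n : ℝ) + 1) ^ k ≤ f n ∧ f n ≤ C * ((n : ℝ) + 1) ^ k) ∨
  (∃ q c : ℝ, 1 < q ∧ 0 < c ∧ ∀ n : ℕ, c * q ^ n ≤ f n)

theorem TameGrowth.nonneg {f : ℕ → ℝ} (hf : TameGrowth f) (n : ℕ) : 0 ≤ f n := by
  rcases hf with ⟨k, c, C, hc, -, h⟩ | ⟨q, c, hq, hc, h⟩
  · exact le_trans (by positivity) (h n).1
  · exact le_trans (by positivity) (h n)

theorem TameGrowth.add {f g : ℕ → ℝ} (hf : TameGrowth f) (hg : TameGrowth g) :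
    TameGrowth (fun n => f n + g n) := by
  have hf0 := hf.nonneg
  have hg0 := hg.nonneg
  rcases hf with ⟨k, c, C, hc, hC, h⟩ | ⟨q, c, hq, hc, h⟩
  · rcases hg with ⟨l, d, D, hd, hD, h'⟩ | ⟨q, c, hq, hc, h'⟩
    · have one_le (n : ℕ) : (1 : ℝ) ≤ (n : ℝ) + 1 := by
        have : (0 : ℝ) ≤ n := n.cast_nonneg
        linarith
      rcases le_total k l with hkl | hkl
      · refine Or.inl ⟨l, d, C + D, hd, by positivity, fun n => ⟨?_, ?_⟩⟩
        · linarith [hf0 n, (h' n).1]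
        · have := mul_le_mul_of_nonneg_left (pow_le_pow_right₀ (one_le n) hkl) hC.le
          linarith [(h n).2, (h' n).2]
      · refine Or.inl ⟨k, c, C + D, hc, by positivity, fun n => ⟨?_, ?_⟩⟩
        · linarith [hg0 n, (h n).1]
        · have := mul_le_mul_of_nonneg_left (pow_le_pow_right₀ (one_le n) hkl) hD.le
          linarith [(h n).2, (h' n).2]
    · exact Or.inr ⟨q, c, hq, hc, fun n => by linarith [h' n, hf0 n]⟩
  · exact Or.inr ⟨q, c, hq, hc, fun n => by linarith [h n, hg0 n]⟩

theorem TameGrowth.of_exp_le_shift {f g : ℕ → ℝ} (hf : ∀ n, 1 ≤ f n) {p : ℕ}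
    (hfg : ∀ n, g n ≤ f (n + p)) {q c : ℝ} (hq : 1 < q) (hc : 0 < c)
    (h : ∀ n : ℕ, c * q ^ n ≤ g n) : TameGrowth f := by
  have hqp : 0 < q ^ p := by positivity
  refine Or.inr ⟨q, min 1 c / q ^ p, hq, by positivity, fun n => ?_⟩
  rw [div_mul_eq_mul_div, div_le_iff₀ hqp]
  rcases le_total p n with hpn | hpn
  · obtain ⟨m, rfl⟩ := Nat.exists_eq_add_of_le' hpn
    rw [pow_add, ← mul_assoc]
    gcongr
    calc min 1 c * q ^ m ≤ c * q ^ m := by gcongr; exact min_le_right _ _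
      _ ≤ f (m + p) := (h m).trans (hfg m)
  · exact mul_le_mul ((min_le_left _ _).trans (hf n)) (pow_le_pow_right₀ hq.le hpn)
      (by positivity) (by linarith [hf n])

theorem TameGrowth.of_two_mul_le {f : ℕ → ℝ} (hf : ∀ n, 1 ≤ f n) {m : ℕ} (hm : 0 < m)
    (h : ∀ n, 2 * f n ≤ f (n + m)) : TameGrowth f := by
  have hq : (1 : ℝ) < 2 ^ ((m : ℝ)⁻¹) := Real.one_lt_rpow (by norm_num) (by positivity)
  have hqm : ((2 : ℝ) ^ ((m : ℝ)⁻¹)) ^ m = 2 :=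
    Real.rpow_inv_natCast_pow (by norm_num) hm.ne'
  generalize (2 : ℝ) ^ ((m : ℝ)⁻¹) = q at hq hqm
  refine Or.inr ⟨q, 1 / 2, hq, by norm_num, fun n => ?_⟩
  induction n using Nat.strong_induction_on with
  | _ n ih =>
    rcases lt_or_ge n m with hnm | hnm
    · have := pow_le_pow_right₀ hq.le hnm.le
      linarith [hf n]
    · obtain ⟨j, rfl⟩ := Nat.exists_eq_add_of_le' hnm
      rw [pow_add, hqm]
      linarith [h j, ih j (by omega)]

theorem TameGrowth.of_shift_one {f : ℕ → ℝ} (hf : ∀ n, 1 ≤ f n) (hmono : Monotone f)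
    (h : TameGrowth fun n => f (n + 1)) : TameGrowth f := by
  rcases h with ⟨k, c, C, hc, hC, h⟩ | ⟨q, c, hq, hc, h⟩
  · refine Or.inl ⟨k, min 1 (c / 2 ^ k), C, by positivity, hC,
      fun n => ⟨?_, (hmono n.le_succ).trans (h n).2⟩⟩
    rcases n with _ | n
    · simpa using Or.inl (hf 0)
    · calc min 1 (c / 2 ^ k) * (((n + 1 : ℕ) : ℝ) + 1) ^ k
          ≤ (c / 2 ^ k) * (2 * ((n : ℝ) + 1)) ^ k := by
            gcongr
            · exact min_le_right _ _
            · push_cast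
              have : (0 : ℝ) ≤ n := n.cast_nonneg
              linarith
        _ = c * ((n : ℝ) + 1) ^ k := by
            rw [mul_pow]
            field_simp
        _ ≤ f (n + 1) := (h n).1
  · exact of_exp_le_shift hf (fun n => le_rfl) hq hc h

theorem exists_add_pow_succ_le (p : ℝ) (hp : 0 ≤ p) (k : ℕ) :
    ∃ K : ℝ, 0 < K ∧ ∀ x : ℝ, 1 ≤ x → (x + p) ^ (k + 1) ≤ x ^ (k + 1) + K * x ^ k := by
  induction k with
  | zero => exact ⟨p + 1, by positivity, fun x _ => by simp⟩
  | succ k ih =>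
    obtain ⟨K, hK, h⟩ := ih
    refine ⟨p + K + p * K, by positivity, fun x hx => ?_⟩
    have hxk : p * K * x ^ k ≤ p * K * x ^ (k + 1) := by
      gcongr
      omega
    calc (x + p) ^ (k + 1 + 1) = (x + p) ^ (k + 1) * (x + p) := pow_succ _ _
      _ ≤ (x ^ (k + 1) + K * x ^ k) * (x + p) := by gcongr; exact h x hx
      _ = x ^ (k + 1 + 1) + (p + K) * x ^ (k + 1) + p * K * x ^ k := by ring
      _ ≤ _ := by linarith

theorem TameGrowth.of_shift_eq_self {f : ℕ → ℝ} (hf : ∀ n, 1 ≤ f n) (hmono : Monotone f)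
    {p : ℕ} (hp : 0 < p) (h : ∀ n, f (n + p) = f n) : TameGrowth f := by
  refine Or.inl ⟨0, 1, f p, one_pos, by linarith [hf p], fun n => ⟨by simpa using hf n, ?_⟩⟩
  rw [pow_zero, mul_one]
  induction n using Nat.strong_induction_on with
  | _ n ih =>
    rcases lt_or_ge n p with hnp | hnp
    · exact hmono hnp.le
    · obtain ⟨j, rfl⟩ := Nat.exists_eq_add_of_le' hnp
      rw [h j]
      exact ih j (by omega)

theorem TameGrowth.of_shift_eq_add {f g : ℕ → ℝ} (hf : ∀ n, 1 ≤ f n) (hmono : Monotone f)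
    {p : ℕ} (hp : 0 < p) (h : ∀ n, f (n + p) = f n + g n) (hg : TameGrowth g) :
    TameGrowth f := by
  rcases hg with ⟨k, c, C, hc, hC, hg⟩ | ⟨q, c, hq, hc, hg⟩
  · obtain ⟨K, hK, hKx⟩ := exists_add_pow_succ_le p p.cast_nonneg k
    have hp1 : (1 : ℝ) ≤ p := by exact_mod_cast hp
    have hfp : 0 < f p := by linarith [hf p]
    refine Or.inl ⟨k + 1, min (1 / (p : ℝ) ^ (k + 1)) (c / K), max (f p) C,
      by positivity, by positivity, fun n => ⟨?_, ?_⟩⟩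
    · set d := min (1 / (p : ℝ) ^ (k + 1)) (c / K)
      have hd : 0 < d := by positivity
      have hdp : d * (p : ℝ) ^ (k + 1) ≤ 1 :=
        (le_div_iff₀ (by positivity)).1 (min_le_left _ _)
      have hdK : d * K ≤ c := (le_div_iff₀ hK).1 (min_le_right _ _)
      induction n using Nat.strong_induction_on with
      | _ n ih =>
        rcases lt_or_ge n p with hnp | hnp
        · have hnp' : (n : ℝ) + 1 ≤ p := by exact_mod_cast hnp
          calc d * ((n : ℝ) + 1) ^ (k + 1) ≤ d * (p : ℝ) ^ (k + 1) := by gcongr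
            _ ≤ f n := hdp.trans (hf n)
        · obtain ⟨j, rfl⟩ := Nat.exists_eq_add_of_le' hnp
          have hj : (1 : ℝ) ≤ (j : ℝ) + 1 := by
            have : (0 : ℝ) ≤ j := j.cast_nonneg
            linarith
          calc d * (((j + p : ℕ) : ℝ) + 1) ^ (k + 1)
              = d * ((j : ℝ) + 1 + p) ^ (k + 1) := by push_cast; ring
            _ ≤ d * (((j : ℝ) + 1) ^ (k + 1) + K * ((j : ℝ) + 1) ^ k) := by
                gcongr
                exact hKx _ hj
            _ = d * ((j : ℝ) + 1) ^ (k + 1) + d * K * ((j : ℝ) + 1) ^ k := by ring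
            _ ≤ f j + c * ((j : ℝ) + 1) ^ k := by
                gcongr
                exact ih j (by omega)
            _ ≤ f (j + p) := by linarith [h j, (hg j).1]
    · set D := max (f p) C
      have hD : 0 < D := by positivity
      induction n using Nat.strong_induction_on with
      | _ n ih =>
        rcases lt_or_ge n p with hnp | hnp
        · have hn : (1 : ℝ) ≤ ((n : ℝ) + 1) ^ (k + 1) := by
            apply one_le_pow₀
            have : (0 : ℝ) ≤ n := n.cast_nonneg
            linarith
          calc f n ≤ D := (hmono hnp.le).trans (le_max_left _ _)
            _ ≤ _ := le_mul_of_one_le_right hD.le hn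
        · obtain ⟨j, rfl⟩ := Nat.exists_eq_add_of_le' hnp
          calc f (j + p) ≤ D * ((j : ℝ) + 1) ^ (k + 1) + C * ((j : ℝ) + 1) ^ k := by
                linarith [h j, (hg j).2, ih j (by omega)]
            _ ≤ D * ((j : ℝ) + 1) ^ (k + 1) + D * ((j : ℝ) + 1) ^ k := by
                gcongr
                exact le_max_right _ _
            _ = D * (((j : ℝ) + 1) ^ k * ((j : ℝ) + 1 + 1)) := by ring
            _ ≤ D * (((j : ℝ) + 1 + p) ^ k * ((j : ℝ) + 1 + p)) := by
                gcongr
                linarith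
            _ = D * (((j + p : ℕ) : ℝ) + 1) ^ (k + 1) := by push_cast; ring
  · refine of_exp_le_shift hf (p := p) (fun n => ?_) hq hc hg
    linarith [h n, hf n]

theorem TameGrowth.isTheta_or_isBigO {f : ℕ → ℝ} (hf : TameGrowth f) :
    (∃ k : ℕ, 1 ≤ k ∧ f =Θ[atTop] (fun n => (n : ℝ) ^ (k - 1))) ∨
      (∃ q : ℝ, 1 < q ∧ (fun n => q ^ n) =O[atTop] f) := by
  have hf0 := hf.nonneg
  rcases hf with ⟨k, c, C, hc, hC, h⟩ | ⟨q, c, hq, hc, h⟩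
  · refine Or.inl ⟨k + 1, by omega, ?_, ?_⟩
    · refine IsBigO.of_bound (C * 2 ^ k) ?_
      filter_upwards [eventually_ge_atTop 1] with n hn
      have hn' : (1 : ℝ) ≤ n := by exact_mod_cast hn
      rw [Real.norm_of_nonneg (hf0 n), Real.norm_of_nonneg (by positivity),
        Nat.add_sub_cancel, mul_assoc, ← mul_pow]
      refine (h n).2.trans ?_
      gcongr
      linarith
    · refine IsBigO.of_bound c⁻¹ (Eventually.of_forall fun n => ?_)
      rw [Real.norm_of_nonneg (hf0 n), Real.norm_of_nonneg (by positivity),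
        Nat.add_sub_cancel, ← div_eq_inv_mul, le_div_iff₀' hc]
      refine le_trans ?_ (h n).1
      gcongr
      linarith
  · refine Or.inr ⟨q, hq, IsBigO.of_bound c⁻¹ (Eventually.of_forall fun n => ?_)⟩
    rw [Real.norm_of_nonneg (hf0 n), Real.norm_of_nonneg (by positivity),
      ← div_eq_inv_mul, le_div_iff₀' hc]
    exact h n

section Words

variable {A : Type*} (φ : A → List A)

theorem substWord_append (u v : List A) :
    substWord φ (u ++ v) = substWord φ u ++ substWord φ v := by
  induction u with
  | nil => rfl
  | cons a u ih => simp [substWord, ih]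

theorem iterWord_append (n : ℕ) (u v : List A) :
    iterWord φ n (u ++ v) = iterWord φ n u ++ iterWord φ n v := by
  induction n generalizing u v with
  | zero => rfl
  | succ n ih => simpa [iterWord, substWord_append] using ih _ _

theorem iterWord_add (n p : ℕ) (w : List A) :
    iterWord φ (n + p) w = iterWord φ n (iterWord φ p w) :=
  Function.iterate_add_apply _ _ _ _

theorem iterWord_one_singleton (b : A) : iterWord φ 1 [b] = φ b := by
  simp [iterWord, substWord]

theorem length_le_length_substWord {φ : A → List A} (hφ : ∀ b, φ b ≠ []) (w : List A) :
    w.length ≤ (substWord φ w).length := by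
  induction w with
  | nil => simp [substWord]
  | cons a w ih =>
    have := List.length_pos_iff.2 (hφ a)
    simp only [substWord, List.length_append, List.length_cons]
    omega

theorem monotone_length_iterWord {φ : A → List A} (hφ : ∀ b, φ b ≠ []) (w : List A) :
    Monotone fun n => (iterWord φ n w).length := by
  refine monotone_nat_of_le_succ fun n => ?_
  simp only [iterWord, Function.iterate_succ_apply']
  exact length_le_length_substWord hφ _

theorem length_iterWord_append_cons (n : ℕ) (u v : List A) (b : A) :
    (iterWord φ n (u ++ b :: v)).length =
      (iterWord φ n [b]).length + (iterWord φ n (u ++ v)).length := by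
  rw [← List.singleton_append, iterWord_append, iterWord_append, iterWord_append]
  simp only [List.length_append]
  omega

theorem length_iterWord_le_of_mem {b : A} {w : List A} (hb : b ∈ w) (n : ℕ) :
    (iterWord φ n [b]).length ≤ (iterWord φ n w).length := by
  obtain ⟨u, v, rfl⟩ := List.append_of_mem hb
  rw [length_iterWord_append_cons]
  exact Nat.le_add_right _ _

theorem mem_iterWord_add {a b c : A} {n p : ℕ} (hab : b ∈ iterWord φ p [a])
    (hbc : c ∈ iterWord φ n [b]) : c ∈ iterWord φ (n + p) [a] := by
  obtain ⟨u, v, huv⟩ := List.append_of_mem hab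
  rw [iterWord_add, huv, ← List.singleton_append, iterWord_append, iterWord_append]
  simp [hbc]

theorem tameGrowth_length_iterWord_of_forall_mem {w : List A} (hw : w ≠ [])
    (h : ∀ a ∈ w, TameGrowth fun n => ((iterWord φ n [a]).length : ℝ)) :
    TameGrowth fun n => ((iterWord φ n w).length : ℝ) := by
  induction w with
  | nil => exact absurd rfl hw
  | cons a w ih =>
    rcases eq_or_ne w [] with rfl | hw'
    · exact h a (by simp)
    · have := (h a (by simp)).add (ih hw' fun c hc => h c (by simp [hc]))
      convert this using 2 with n
      exact_mod_cast length_iterWord_append_cons φ n [] w a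

/-- The letters occurring in some iterate of the morphism on `b`. -/
def reachableLetters (b : A) : Set A := {c | ∃ n, c ∈ iterWord φ n [b]}

theorem ncard_reachableLetters_lt [Finite A] {b c : A} (hc : c ∈ reachableLetters φ b)
    (hb : b ∉ reachableLetters φ c) :
    (reachableLetters φ c).ncard < (reachableLetters φ b).ncard := by
  refine Set.ncard_lt_ncard ?_ (Set.toFinite _)
  refine (Set.ssubset_iff_of_subset ?_).2 ⟨b, ⟨0, by simp [iterWord]⟩, hb⟩
  rintro d ⟨n, hd⟩
  obtain ⟨p, hp⟩ := hc
  exact ⟨n + p, mem_iterWord_add φ hp hd⟩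

theorem tameGrowth_length_iterWord [Finite A] {φ : A → List A} (hφ : ∀ b, φ b ≠ []) (b : A) :
    TameGrowth fun n => ((iterWord φ n [b]).length : ℝ) := by
  induction hN : (reachableLetters φ b).ncard using Nat.strong_induction_on generalizing b with
  | _ N ih =>
    subst hN
    have hmono : Monotone fun n => ((iterWord φ n [b]).length : ℝ) :=
      fun m n hmn => Nat.cast_le.2 (monotone_length_iterWord hφ [b] hmn)
    have hone (n : ℕ) : (1 : ℝ) ≤ (iterWord φ n [b]).length := by
      simpa [iterWord] using hmono n.zero_le
    by_cases hcycle : ∃ p, 0 < p ∧ b ∈ iterWord φ p [b]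
    · obtain ⟨p, hp, hbp⟩ := hcycle
      obtain ⟨u, v, huv⟩ := List.append_of_mem hbp
      have hrec (n : ℕ) : (iterWord φ (n + p) [b]).length =
          (iterWord φ n [b]).length + (iterWord φ n (u ++ v)).length := by
        rw [iterWord_add, huv, length_iterWord_append_cons]
      by_cases hret : ∃ c ∈ u ++ v, b ∈ reachableLetters φ c
      · obtain ⟨c, hc, j, hj⟩ := hret
        refine TameGrowth.of_two_mul_le hone (m := j + p) (by omega) fun n => ?_
        have hcb : (iterWord φ n [b]).length ≤ (iterWord φ (n + j) [c]).length := by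
          rw [iterWord_add]
          exact length_iterWord_le_of_mem φ hj n
        have hle := monotone_length_iterWord hφ [b] (Nat.le_add_right n j)
        have hcw := length_iterWord_le_of_mem φ hc (n + j)
        have hrec' := hrec (n + j)
        rw [add_assoc] at hrec'
        dsimp only at hle
        have : 2 * (iterWord φ n [b]).length ≤ (iterWord φ (n + (j + p)) [b]).length := by
          omega
        exact_mod_cast this
      · push Not at hret
        rcases eq_or_ne (u ++ v) [] with hnil | hne
        · refine TameGrowth.of_shift_eq_self hone hmono hp fun n => ?_
          have hempty : (iterWord φ n ([] : List A)).length = 0 := by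
            have := iterWord_append φ n [] []
            simpa using congrArg List.length this
          rw [hrec, hnil, hempty, add_zero]
        · refine TameGrowth.of_shift_eq_add hone hmono hp
            (fun n => by rw [hrec, Nat.cast_add])
            (tameGrowth_length_iterWord_of_forall_mem φ hne fun c hc => ?_)
          refine ih _ (ncard_reachableLetters_lt φ ⟨p, ?_⟩ (hret c hc)) c rfl
          rw [huv]
          simp only [List.mem_append, List.mem_cons] at hc ⊢
          tauto
    · refine TameGrowth.of_shift_one hone hmono ?_
      simp only [iterWord_add, iterWord_one_singleton]
      refine tameGrowth_length_iterWord_of_forall_mem φ (hφ b) fun c hc => ?_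
      rw [← iterWord_one_singleton φ b] at hc
      refine ih _ (ncard_reachableLetters_lt φ ⟨1, hc⟩ ?_) c rfl
      rintro ⟨n, hn⟩
      exact hcycle ⟨n + 1, n.succ_pos, mem_iterWord_add φ hc hn⟩

end Words

/-- For a nonerasing morphism on a finite alphabet, each letter `b` either has
some finite order `k ≥ 1` (i.e. `|φ^n(b)| = Θ(n^(k−1))`), or has order `∞`
(i.e. `|φ^n(b)| = Ω(q^n)` for some real `q > 1`). -/
theorem stmt5 {A : Type*} [Fintype A] (φ : A → List A)
    (hφ : ∀ b : A, φ b ≠ []) (b : A) :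
    (∃ k : ℕ, 1 ≤ k ∧
        (fun n => ((iterWord φ n [b]).length : ℝ)) =Θ[atTop]
          (fun n => (n : ℝ) ^ (k - 1))) ∨
      (∃ q : ℝ, 1 < q ∧
        (fun n => q ^ n) =O[atTop]
          (fun n => ((iterWord φ n [b]).length : ℝ))) := by
  exact (tameGrowth_length_iterWord hφ b).isTheta_or_isBigO
end
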